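/- Let A ⊂ X and let x ∈ X∖A be such that A is 1-thin at x. Then there exist R > 0 and functions u₁, u₂ ∈ BV(X) that are 1-superminimizers in the ball B(x,R), such that max{u₁^∧(y), u₂^∧(y)} = 1 for every y ∈ A ∩ B(x,R) and u₁^∨(x) = 0 = u₂^∨(x). (Weak Cartan property for p = 1.) -/

import Mathlib

open MeasureTheory Metric Filter Set
open scoped ENNReal NNReal Topology

noncomputable section

namespace MetricBV

variable {X : Type*} [MetricSpace X] [MeasurableSpace X]

/-- A rectifiable curve, encoded as a Lipschitz map on the interval `[0,1]`
(every rectifiable curve admits such a reparametrization). -/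
structure Curve (X : Type*) [MetricSpace X] where
  toFun : ℝ → X
  lipschitz : ∃ K : ℝ≥0, LipschitzOnWith K toFun (Set.Icc 0 1)

/-- The metric speed of a curve at a point. -/
def speed (γ : ℝ → X) (t : ℝ) : ℝ≥0∞ :=
  Filter.limsup (fun h : ℝ => ENNReal.ofReal (dist (γ (t + h)) (γ t) / |h|)) (𝓝[≠] (0 : ℝ))

/-- The curve integral `∫_γ g ds`. -/
def curveIntegral (g : X → ℝ≥0∞) (γ : Curve X) : ℝ≥0∞ :=
  ∫⁻ t in Set.Icc (0 : ℝ) 1, g (γ.toFun t) * speed γ.toFun t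

/-- A curve lies in a set `Ω`. -/
def Curve.In (γ : Curve X) (Ω : Set X) : Prop :=
  ∀ t ∈ Set.Icc (0 : ℝ) 1, γ.toFun t ∈ Ω

/-- The 1-modulus of a family of curves. -/
def Mod1 (μ : Measure X) (Γ : Set (Curve X)) : ℝ≥0∞ :=
  ⨅ (ρ : X → ℝ≥0∞) (_ : Measurable ρ) (_ : ∀ γ ∈ Γ, 1 ≤ curveIntegral ρ γ),
    ∫⁻ x, ρ x ∂μ

/-- `g` is an upper gradient of `u` in `Ω`: the upper gradient inequality holds
along every curve contained in `Ω`. -/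
def IsUpperGradientOn (g : X → ℝ≥0∞) (u : X → ℝ) (Ω : Set X) : Prop :=
  ∀ γ : Curve X, γ.In Ω →
    ENNReal.ofReal |u (γ.toFun 1) - u (γ.toFun 0)| ≤ curveIntegral g γ

/-- `g` is a 1-weak upper gradient of `u` in `Ω`: the upper gradient inequality holds
along every curve in `Ω` outside a family of zero 1-modulus. -/
def IsWeakUpperGradientOn (μ : Measure X) (g : X → ℝ≥0∞) (u : X → ℝ) (Ω : Set X) : Prop :=
  ∃ Γ : Set (Curve X), Mod1 μ Γ = 0 ∧
    ∀ γ : Curve X, γ ∉ Γ → γ.In Ω →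
      ENNReal.ofReal |u (γ.toFun 1) - u (γ.toFun 0)| ≤ curveIntegral g γ

/-- Membership in the Newtonian space `N^{1,1}(X)`. -/
def MemN11 (μ : Measure X) (u : X → ℝ) : Prop :=
  Integrable u μ ∧ ∃ g : X → ℝ≥0∞, Measurable g ∧
    IsWeakUpperGradientOn μ g u Set.univ ∧ ∫⁻ x, g x ∂μ < ⊤

/-- The 1-capacity `cap₁(A) = inf ‖u‖_{N^{1,1}(X)}` over `u ∈ N^{1,1}(X)` with `u ≥ 1` on `A`. -/
def cap1 (μ : Measure X) (A : Set X) : ℝ≥0∞ :=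
  ⨅ (u : X → ℝ) (_ : MemN11 μ u) (_ : ∀ x ∈ A, 1 ≤ u x)
    (g : X → ℝ≥0∞) (_ : Measurable g) (_ : IsWeakUpperGradientOn μ g u Set.univ),
    (∫⁻ x, ENNReal.ofReal |u x| ∂μ + ∫⁻ x, g x ∂μ)

/-- The variational 1-capacity `cap₁(A,Ω) = inf ∫ g_u dμ` over `u ∈ N^{1,1}(X)` with
`u ≥ 1` on `A` and `u = 0` on `X ∖ Ω`. -/
def vcap1 (μ : Measure X) (A Ω : Set X) : ℝ≥0∞ :=
  ⨅ (u : X → ℝ) (_ : MemN11 μ u) (_ : ∀ x ∈ A, 1 ≤ u x) (_ : ∀ x ∈ Ωᶜ, u x = 0)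
    (g : X → ℝ≥0∞) (_ : Measurable g) (_ : IsWeakUpperGradientOn μ g u Set.univ),
    ∫⁻ x, g x ∂μ

/-- Locally Lipschitz in `Ω`: Lipschitz on every compact subset of `Ω`. -/
def LocLipschitzOn (u : X → ℝ) (Ω : Set X) : Prop :=
  ∀ K : Set X, IsCompact K → K ⊆ Ω → ∃ L : ℝ≥0, LipschitzOnWith L u K

/-- Convergence `v i → u` in `L¹_loc(Ω)`. -/
def TendstoL1Loc (μ : Measure X) (v : ℕ → X → ℝ) (u : X → ℝ) (Ω : Set X) : Prop :=
  ∀ K : Set X, IsCompact K → K ⊆ Ω →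
    Filter.Tendsto (fun i => ∫⁻ x in K, ENNReal.ofReal |v i x - u x| ∂μ)
      Filter.atTop (𝓝 0)

/-- The total variation `‖Du‖(Ω)` of `u` in an open set `Ω`: the infimum of
`liminf ∫_Ω g_i dμ` over sequences of locally Lipschitz functions `v i → u` in `L¹_loc(Ω)`
with `g i` a 1-weak upper gradient of `v i` in `Ω`. -/
def tv (μ : Measure X) (u : X → ℝ) (Ω : Set X) : ℝ≥0∞ :=
  ⨅ (v : ℕ → X → ℝ) (_ : ∀ i, LocLipschitzOn (v i) Ω) (_ : TendstoL1Loc μ v u Ω)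
    (g : ℕ → X → ℝ≥0∞) (_ : ∀ i, Measurable (g i))
    (_ : ∀ i, IsWeakUpperGradientOn μ (g i) (v i) Ω),
    Filter.liminf (fun i => ∫⁻ x in Ω, g i x ∂μ) Filter.atTop

/-- The total variation `‖Du‖(A)` for an arbitrary set `A`. -/
def tvs (μ : Measure X) (u : X → ℝ) (A : Set X) : ℝ≥0∞ :=
  ⨅ (U : Set X) (_ : IsOpen U) (_ : A ⊆ U), tv μ u U

/-- The characteristic function of a set, as a real-valued function. -/
def chi (E : Set X) : X → ℝ := Set.indicator E fun _ => (1 : ℝ)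

/-- The perimeter `P(E,Ω) = ‖Dχ_E‖(Ω)` of `E` in an open set `Ω`. -/
def perim (μ : Measure X) (E : Set X) (Ω : Set X) : ℝ≥0∞ := tv μ (chi E) Ω

/-- `u ∈ BV(Ω)`: `u ∈ L¹(Ω)` and `‖Du‖(Ω) < ∞`. -/
def MemBV (μ : Measure X) (u : X → ℝ) (Ω : Set X) : Prop :=
  IntegrableOn u Ω μ ∧ tv μ u Ω < ⊤

/-- `u ∈ BV_loc(Ω)`. -/
def MemBVloc (μ : Measure X) (u : X → ℝ) (Ω : Set X) : Prop :=
  ∀ K : Set X, IsCompact K → K ⊆ Ω → ∃ U : Set X, IsOpen U ∧ K ⊆ U ∧ U ⊆ Ω ∧ MemBV μ u U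

/-- `φ ∈ BV_c(Ω)`: a BV function with compact support in `Ω`. -/
def MemBVc (μ : Measure X) (φ : X → ℝ) (Ω : Set X) : Prop :=
  MemBV μ φ Ω ∧ IsCompact (tsupport φ) ∧ tsupport φ ⊆ Ω

/-- `u` is a 1-minimizer (function of least gradient) in `Ω`. -/
def IsMinimizer (μ : Measure X) (u : X → ℝ) (Ω : Set X) : Prop :=
  MemBVloc μ u Ω ∧ ∀ φ : X → ℝ, MemBVc μ φ Ω →
    tvs μ u (tsupport φ) ≤ tvs μ (fun y => u y + φ y) (tsupport φ)

/-- `u` is a 1-superminimizer in `Ω`. -/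
def IsSuperminimizer (μ : Measure X) (u : X → ℝ) (Ω : Set X) : Prop :=
  MemBVloc μ u Ω ∧ ∀ φ : X → ℝ, MemBVc μ φ Ω → (∀ x, 0 ≤ φ x) →
    tvs μ u (tsupport φ) ≤ tvs μ (fun y => u y + φ y) (tsupport φ)

/-- `u` is a 1-subminimizer in `Ω`. -/
def IsSubminimizer (μ : Measure X) (u : X → ℝ) (Ω : Set X) : Prop :=
  MemBVloc μ u Ω ∧ ∀ φ : X → ℝ, MemBVc μ φ Ω → (∀ x, φ x ≤ 0) →
    tvs μ u (tsupport φ) ≤ tvs μ (fun y => u y + φ y) (tsupport φ)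

/-- The lower approximate limit `u^∧(x)`, with values in `[-∞,∞]`. -/
def lowerApprox (μ : Measure X) (u : X → ℝ) (x : X) : EReal :=
  sSup ((fun t : ℝ => (t : EReal)) '' {t : ℝ | Filter.Tendsto
    (fun r : ℝ => μ ({y | u y < t} ∩ Metric.ball x r) / μ (Metric.ball x r))
    (𝓝[>] (0 : ℝ)) (𝓝 0)})

/-- The upper approximate limit `u^∨(x)`, with values in `[-∞,∞]`. -/
def upperApprox (μ : Measure X) (u : X → ℝ) (x : X) : EReal :=
  sInf ((fun t : ℝ => (t : EReal)) '' {t : ℝ | Filter.Tendsto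
    (fun r : ℝ => μ ({y | t < u y} ∩ Metric.ball x r) / μ (Metric.ball x r))
    (𝓝[>] (0 : ℝ)) (𝓝 0)})

/-- The upper approximate limit of an extended-real-valued function. -/
def upperApproxE (μ : Measure X) (ψ : X → EReal) (x : X) : EReal :=
  sInf ((fun t : ℝ => (t : EReal)) '' {t : ℝ | Filter.Tendsto
    (fun r : ℝ => μ ({y | (t : EReal) < ψ y} ∩ Metric.ball x r) / μ (Metric.ball x r))
    (𝓝[>] (0 : ℝ)) (𝓝 0)})

/-- The measure-theoretic interior `I_E`. -/
def measInterior (μ : Measure X) (E : Set X) : Set X :=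
  {x : X | Filter.Tendsto (fun r : ℝ => μ (Metric.ball x r \ E) / μ (Metric.ball x r))
    (𝓝[>] (0 : ℝ)) (𝓝 0)}

/-- The measure-theoretic boundary `∂*E`. -/
def measBoundary (μ : Measure X) (E : Set X) : Set X :=
  {x : X | 0 < Filter.limsup (fun r : ℝ => μ (Metric.ball x r ∩ E) / μ (Metric.ball x r))
      (𝓝[>] (0 : ℝ)) ∧
    0 < Filter.limsup (fun r : ℝ => μ (Metric.ball x r \ E) / μ (Metric.ball x r))
      (𝓝[>] (0 : ℝ))}

/-- `A` is 1-thin at `x`. -/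
def IsThinAt (μ : Measure X) (A : Set X) (x : X) : Prop :=
  Filter.Tendsto (fun r : ℝ =>
      ENNReal.ofReal r * vcap1 μ (A ∩ Metric.ball x r) (Metric.ball x (2 * r))
        / μ (Metric.ball x r))
    (𝓝[>] (0 : ℝ)) (𝓝 0)

/-- `U` is 1-finely open. -/
def IsFinelyOpen (μ : Measure X) (U : Set X) : Prop :=
  ∀ x ∈ U, IsThinAt μ Uᶜ x

/-- The class `K_{ψ,f}(Ω)` of admissible functions for the obstacle problem. -/
def MemK (μ : Measure X) (ψ : X → EReal) (f : X → ℝ) (Ω : Set X) (u : X → ℝ) : Prop :=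
  MemBVloc μ u Set.univ ∧ (∀ᵐ x ∂μ, x ∈ Ω → ψ x ≤ (u x : EReal)) ∧
    (∀ᵐ x ∂μ, x ∉ Ω → u x = f x)

/-- `u` is a solution of the `K_{ψ,f}(Ω)`-obstacle problem. -/
def IsObstacleSolution (μ : Measure X) (ψ : X → EReal) (f : X → ℝ) (Ω : Set X)
    (u : X → ℝ) : Prop :=
  MemK μ ψ f Ω u ∧ ∀ v : X → ℝ, MemK μ ψ f Ω v → tv μ u Set.univ ≤ tv μ v Set.univ

/-- The standing assumptions: `(X,d,μ)` is a complete metric space with at least two points,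
`μ` is a doubling measure with constant `Cd`, and `X` supports a `(1,1)`-Poincaré inequality
with constants `CP`, `lam`. -/
structure MMS {X : Type*} [MetricSpace X] [MeasurableSpace X] (μ : Measure X)
    (Cd CP lam : ℝ) : Prop where
  complete : CompleteSpace X
  nontrivial : Nontrivial X
  hCd : 1 ≤ Cd
  hCP : 0 < CP
  hlam : 1 ≤ lam
  doubling : ∀ (x : X) (r : ℝ), 0 < r →
    0 < μ (Metric.ball x (2 * r)) ∧
    μ (Metric.ball x (2 * r)) ≤ ENNReal.ofReal Cd * μ (Metric.ball x r) ∧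
    μ (Metric.ball x r) < ⊤
  poincare : ∀ (x : X) (r : ℝ), 0 < r → ∀ u : X → ℝ, MeasureTheory.LocallyIntegrable u μ →
    ∀ g : X → ℝ≥0∞, Measurable g → IsUpperGradientOn g u Set.univ →
      ∫⁻ y in Metric.ball x r, ENNReal.ofReal |u y - ⨍ z in Metric.ball x r, u z ∂μ| ∂μ ≤
        ENNReal.ofReal (CP * r) * (μ (Metric.ball x r) / μ (Metric.ball x (lam * r))) *
          ∫⁻ y in Metric.ball x (lam * r), g y ∂μ

set_option linter.unusedSectionVars false

/-! ### Derivatives along curves -/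

/-- If the increments of `f` are controlled by the integrals of `h`, then `|f'| ≤ h` a.e. -/
theorem ae_deriv_le_of_integral_bound {f : ℝ → ℝ} {h : ℝ → ℝ≥0∞} {a b : ℝ} (hab : a ≤ b)
    (hfin : ∫⁻ t in Icc a b, h t ≠ ⊤)
    (hle : ∀ s t, a ≤ s → s ≤ t → t ≤ b →
      ENNReal.ofReal |f t - f s| ≤ ∫⁻ τ in Icc s t, h τ) :
    ∀ᵐ t, t ∈ Ioo a b → DifferentiableAt ℝ f t → ENNReal.ofReal |deriv f t| ≤ h t := by
  obtain ⟨k, hkm, hkh, hk⟩ := exists_measurable_le_lintegral_eq (volume.restrict (Icc a b)) h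
  have hkfin : ∫⁻ t in Icc a b, k t ≠ ⊤ := hk ▸ hfin
  have hsub : ∀ s t, a ≤ s → s ≤ t → t ≤ b → ∫⁻ τ in Icc s t, h τ ≤ ∫⁻ τ in Icc s t, k τ := by
    intro s t has hst htb
    have hss : Icc s t ⊆ Icc a b := Icc_subset_Icc has htb
    have e1 := lintegral_inter_add_sdiff (μ := volume) h (Icc a b) (measurableSet_Icc (a := s) (b := t))
    have e2 := lintegral_inter_add_sdiff (μ := volume) k (Icc a b) (measurableSet_Icc (a := s) (b := t))
    rw [inter_eq_self_of_subset_right hss] at e1 e2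
    have hle' : ∫⁻ τ in Icc a b \ Icc s t, k τ ≤ ∫⁻ τ in Icc a b \ Icc s t, h τ :=
      lintegral_mono hkh
    have hfin' : ∫⁻ τ in Icc a b \ Icc s t, k τ ≠ ⊤ :=
      ne_top_of_le_ne_top hkfin (lintegral_mono_set sdiff_subset)
    refine (ENNReal.add_le_add_iff_right hfin').1 ?_
    calc _ ≤ (∫⁻ τ in Icc s t, h τ) + ∫⁻ τ in Icc a b \ Icc s t, h τ := by gcongr
      _ = _ := by rw [e1, e2, hk]
  have hint : IntegrableOn (fun t => (k t).toReal) (Icc a b) :=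
    integrable_toReal_of_lintegral_ne_top hkm.aemeasurable hkfin
  have hii : IntervalIntegrable (fun t => (k t).toReal) volume a b :=
    (intervalIntegrable_iff_integrableOn_Icc_of_le hab).2 hint
  have hkt : ∀ᵐ t, t ∈ Icc a b → k t < ⊤ := by
    rw [← ae_restrict_iff' measurableSet_Icc]
    exact ae_lt_top hkm hkfin
  filter_upwards [hii.ae_hasDerivAt_integral, hkt] with t h1 h2 ht hd
  have htI : t ∈ Icc a b := Ioo_subset_Icc_self ht
  have hG := h1 (by rwa [uIcc_of_le hab]) a (by simp)
  set G : ℝ → ℝ := fun x => ∫ τ in a..x, (k τ).toReal with hGdef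
  have key : ∀ s t, a ≤ s → s ≤ t → t ≤ b → |f t - f s| ≤ G t - G s := by
    intro s t has hst htb
    have hss : Icc s t ⊆ Icc a b := Icc_subset_Icc has htb
    have hsi : IntegrableOn (fun t => (k t).toReal) (Icc s t) := hint.mono_set hss
    have e : G t - G s = ∫ τ in Icc s t, (k τ).toReal := by
      rw [hGdef]
      simp only
      rw [intervalIntegral.integral_interval_sub_left, intervalIntegral.integral_of_le hst,
        integral_Icc_eq_integral_Ioc]
      · exact (intervalIntegrable_iff_integrableOn_Icc_of_le (has.trans hst)).2
          (hint.mono_set (Icc_subset_Icc le_rfl htb))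
      · exact (intervalIntegrable_iff_integrableOn_Icc_of_le has).2
          (hint.mono_set (Icc_subset_Icc le_rfl (hst.trans htb)))
    have hf' : ∫⁻ τ in Icc s t, k τ ≠ ⊤ := ne_top_of_le_ne_top hkfin (lintegral_mono_set hss)
    have e2 : ∫ τ in Icc s t, (k τ).toReal = (∫⁻ τ in Icc s t, k τ).toReal :=
      integral_toReal hkm.aemeasurable (ae_lt_top hkm hf')
    rw [e, e2]
    exact (ENNReal.ofReal_le_iff_le_toReal hf').1 ((hle s t has hst htb).trans
      (hsub s t has hst htb))
  have hbd : |deriv f t| ≤ (k t).toReal := by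
    have l1 := (hasDerivAt_iff_tendsto_slope.1 hd.hasDerivAt).abs
    have l2 := (hasDerivAt_iff_tendsto_slope.1 hG)
    refine le_of_tendsto_of_tendsto l1 l2 ?_
    have hmem : Ioo a b ∈ 𝓝[≠] t := mem_nhdsWithin_of_mem_nhds (Ioo_mem_nhds ht.1 ht.2)
    filter_upwards [hmem, self_mem_nhdsWithin] with τ hτ hne
    rw [slope_def_field, slope_def_field, abs_div]
    rcases lt_or_gt_of_ne (show τ ≠ t from hne) with hlt | hgt
    · have := key τ t hτ.1.le hlt.le ht.2.le
      rw [abs_of_neg (sub_neg.2 hlt), ← neg_div_neg_eq (G τ - G t), abs_sub_comm]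
      have : 0 < -(τ - t) := by linarith
      gcongr
      linarith
    · have := key t τ ht.1.le hgt.le hτ.2.le
      have h0 : 0 < τ - t := sub_pos.2 hgt
      rw [abs_of_pos h0]
      gcongr
  calc ENNReal.ofReal |deriv f t| ≤ ENNReal.ofReal (k t).toReal := ENNReal.ofReal_le_ofReal hbd
    _ = k t := ENNReal.ofReal_toReal (h2 htI).ne
    _ ≤ h t := hkh t

/-- The affine reparametrization of the restriction of a curve to `[a,b]`. -/
def Curve.sub (γ : Curve X) (a b : ℝ) (ha : 0 ≤ a) (hab : a ≤ b) (hb : b ≤ 1) : Curve X where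
  toFun t := γ.toFun (a + (b - a) * t)
  lipschitz := by
    obtain ⟨K, hK⟩ := γ.lipschitz
    refine ⟨K * Real.toNNReal (b - a), ?_⟩
    have h2 : LipschitzOnWith (Real.toNNReal (b - a)) (fun t : ℝ => a + (b - a) * t) (Icc 0 1) := by
      refine LipschitzOnWith.of_dist_le_mul fun s _ t _ => ?_
      rw [Real.dist_eq, Real.dist_eq, Real.coe_toNNReal _ (by linarith),
        show a + (b - a) * s - (a + (b - a) * t) = (b - a) * (s - t) by ring, abs_mul,
        abs_of_nonneg (by linarith : 0 ≤ b - a)]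
    refine hK.comp h2 fun t ht => ⟨by nlinarith [ht.1, ht.2], by nlinarith [ht.1, ht.2]⟩


theorem speed_comp_affine_le (γ : ℝ → X) {a c : ℝ} (hc : 0 < c) (t : ℝ) :
    speed (fun s => γ (a + c * s)) t ≤ ENNReal.ofReal c * speed γ (a + c * t) := by
  unfold speed
  rw [← ENNReal.limsup_const_mul_of_ne_top ENNReal.ofReal_ne_top]
  have hmap : Tendsto (fun h : ℝ => c * h) (𝓝[≠] 0) (𝓝[≠] 0) := by
    refine tendsto_nhdsWithin_iff.2 ⟨?_, ?_⟩
    · exact ((continuous_const_mul c).tendsto' 0 0 (by simp)).mono_left nhdsWithin_le_nhds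
    · filter_upwards [self_mem_nhdsWithin] with h hh
      exact mul_ne_zero hc.ne' hh
  calc _ = limsup ((fun h : ℝ => ENNReal.ofReal c *
            ENNReal.ofReal (dist (γ (a + c * t + h)) (γ (a + c * t)) / |h|)) ∘ fun h => c * h)
            (𝓝[≠] 0) := by
        congr 1
        ext h
        simp only [Function.comp]
        rw [← ENNReal.ofReal_mul hc.le, abs_mul, abs_of_pos hc]
        congr 1
        rw [show a + c * (t + h) = a + c * t + c * h by ring]
        field_simp
    _ ≤ _ := by
        rw [Filter.limsup_comp]
        exact limsup_le_limsup_of_le hmap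

theorem lintegral_comp_affine_le (g : X → ℝ≥0∞) (γ : ℝ → X) {a b : ℝ} (hab : a < b) :
    ∫⁻ t in Icc (0 : ℝ) 1, g (γ (a + (b - a) * t)) * speed (fun s => γ (a + (b - a) * s)) t ≤
      ∫⁻ t in Icc a b, g (γ t) * speed γ t := by
  have hc : 0 < b - a := sub_pos.2 hab
  have himg : (fun t : ℝ => a + (b - a) * t) '' Icc 0 1 = Icc a b := by
    have h := Set.image_affine_Icc' hc a 0 1
    simp only [mul_zero, zero_add, mul_one, sub_add_cancel] at h
    rw [← h]
    exact image_congr fun t _ => add_comm _ _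
  have hd : ∀ t ∈ Icc (0 : ℝ) 1, HasDerivWithinAt (fun t : ℝ => a + (b - a) * t) (b - a)
      (Icc 0 1) t := fun t _ => by
    simpa using (((hasDerivAt_id t).const_mul (b - a)).const_add a).hasDerivWithinAt
  have hinj : InjOn (fun t : ℝ => a + (b - a) * t) (Icc 0 1) := fun s _ t _ h => by
    have := add_left_cancel h
    exact mul_left_cancel₀ hc.ne' this
  rw [← himg, lintegral_image_eq_lintegral_abs_deriv_mul measurableSet_Icc hd hinj]
  refine lintegral_mono fun t => ?_
  calc _ ≤ g (γ (a + (b - a) * t)) * (ENNReal.ofReal (b - a) * speed γ (a + (b - a) * t)) := by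
        gcongr
        exact speed_comp_affine_le γ hc t
    _ = _ := by rw [abs_of_pos hc]; ring

theorem curveIntegral_sub_le (g : X → ℝ≥0∞) (γ : Curve X) {a b : ℝ} (ha : 0 ≤ a) (hab : a < b)
    (hb : b ≤ 1) :
    curveIntegral g (γ.sub a b ha hab.le hb) ≤ ∫⁻ t in Icc a b, g (γ.toFun t) * speed γ.toFun t :=
  lintegral_comp_affine_le g γ.toFun hab

theorem Curve.continuousOn (γ : Curve X) : ContinuousOn γ.toFun (Icc 0 1) := by
  obtain ⟨K, hK⟩ := γ.lipschitz
  exact hK.continuousOn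

theorem Curve.isCompact_image (γ : Curve X) : IsCompact (γ.toFun '' Icc 0 1) :=
  isCompact_Icc.image_of_continuousOn γ.continuousOn

theorem IsUpperGradientOn.increment_le {g : X → ℝ≥0∞} {v : X → ℝ} {U : Set X}
    (h : IsUpperGradientOn g v U) (γ : Curve X) {p q s t : ℝ} (hp : 0 ≤ p) (hq : q ≤ 1)
    (hU : ∀ τ ∈ Icc p q, γ.toFun τ ∈ U) (hps : p ≤ s) (hst : s ≤ t) (htq : t ≤ q) :
    ENNReal.ofReal |v (γ.toFun t) - v (γ.toFun s)| ≤
      ∫⁻ τ in Icc s t, g (γ.toFun τ) * speed γ.toFun τ := by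
  rcases hst.eq_or_lt with rfl | hlt
  · simp
  · refine le_trans ?_ (curveIntegral_sub_le g γ (hp.trans hps) hlt (htq.trans hq))
    have := h (γ.sub s t (hp.trans hps) hst (htq.trans hq)) fun τ hτ =>
      hU _ ⟨by nlinarith [hτ.1, hτ.2], by nlinarith [hτ.1, hτ.2]⟩
    simpa [Curve.sub] using this

/-- Along a curve of finite `g`-length, the derivative of `v` is controlled by its upper
gradient `g` at almost every time spent in the open set where `g` is an upper gradient. -/
theorem IsUpperGradientOn.ae_deriv_le {g : X → ℝ≥0∞} {v : X → ℝ} {U : Set X}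
    (h : IsUpperGradientOn g v U) (hv : LocLipschitzOn v U) (hU : IsOpen U) (γ : Curve X)
    (hfin : ∫⁻ t in Icc (0 : ℝ) 1, U.indicator g (γ.toFun t) * speed γ.toFun t ≠ ⊤) :
    ∀ᵐ t, t ∈ Ioo (0 : ℝ) 1 → γ.toFun t ∈ U →
      DifferentiableAt ℝ (fun s => v (γ.toFun s)) t ∧
      ENNReal.ofReal |deriv (fun s => v (γ.toFun s)) t| ≤ g (γ.toFun t) * speed γ.toFun t := by
  have key : ∀ p q : ℚ, (0 : ℝ) < p → (p : ℝ) < q → (q : ℝ) < 1 →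
      (∀ τ ∈ Icc (p : ℝ) q, γ.toFun τ ∈ U) → ∀ᵐ t, t ∈ Ioo (p : ℝ) q →
      DifferentiableAt ℝ (fun s => v (γ.toFun s)) t ∧
      ENNReal.ofReal |deriv (fun s => v (γ.toFun s)) t| ≤ g (γ.toFun t) * speed γ.toFun t := by
    intro p q hp hpq hq hsub
    have hI : Icc (p : ℝ) q ⊆ Icc 0 1 := Icc_subset_Icc hp.le hq.le
    obtain ⟨K, hK⟩ := γ.lipschitz
    obtain ⟨L, hL⟩ := hv (γ.toFun '' Icc (p : ℝ) q)
      (isCompact_Icc.image_of_continuousOn (γ.continuousOn.mono hI))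
      (by rintro _ ⟨τ, hτ, rfl⟩; exact hsub τ hτ)
    have hlip : LipschitzOnWith (L * K) (fun s => v (γ.toFun s)) (Icc (p : ℝ) q) :=
      hL.comp (hK.mono hI) (mapsTo_image _ _)
    have hdiff := hlip.ae_differentiableWithinAt_of_mem_real
    have hfin' : ∫⁻ t in Icc (p : ℝ) q, g (γ.toFun t) * speed γ.toFun t ≠ ⊤ := by
      refine ne_top_of_le_ne_top hfin ?_
      calc _ = ∫⁻ t in Icc (p : ℝ) q, U.indicator g (γ.toFun t) * speed γ.toFun t :=
            setLIntegral_congr_fun measurableSet_Icc fun t ht => by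
              simp only [indicator_of_mem (hsub t ht)]
        _ ≤ _ := lintegral_mono_set hI
    have hb := ae_deriv_le_of_integral_bound (f := fun s => v (γ.toFun s)) hpq.le hfin'
      fun s t hs hst ht => h.increment_le γ hp.le hq.le hsub hs hst ht
    filter_upwards [hdiff, hb] with t h1 h2 ht
    have hd := (h1 (Ioo_subset_Icc_self ht)).differentiableAt (Icc_mem_nhds ht.1 ht.2)
    exact ⟨hd, h2 ht hd⟩
  have key' : ∀ᵐ t, ∀ p q : ℚ, (0 : ℝ) < p → (p : ℝ) < q → (q : ℝ) < 1 →
      (∀ τ ∈ Icc (p : ℝ) q, γ.toFun τ ∈ U) → t ∈ Ioo (p : ℝ) q →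
      DifferentiableAt ℝ (fun s => v (γ.toFun s)) t ∧
      ENNReal.ofReal |deriv (fun s => v (γ.toFun s)) t| ≤ g (γ.toFun t) * speed γ.toFun t := by
    simp only [ae_all_iff]
    exact fun p q a b c d => key p q a b c d
  filter_upwards [key'] with t ht htI htU
  have hcont : ContinuousAt γ.toFun t := γ.continuousOn.continuousAt (Icc_mem_nhds htI.1 htI.2)
  obtain ⟨ε, hε, hball⟩ := Metric.mem_nhds_iff.1 (Filter.inter_mem (hcont (hU.mem_nhds htU))
    (Ioo_mem_nhds htI.1 htI.2))
  obtain ⟨p, hp1, hp2⟩ := exists_rat_btwn (show t - ε < t by linarith)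
  obtain ⟨q, hq1, hq2⟩ := exists_rat_btwn (show t < t + ε by linarith)
  have hsub : ∀ τ ∈ Icc (p : ℝ) q, τ ∈ ball t ε := fun τ hτ => by
    rw [Real.ball_eq_Ioo]
    exact ⟨hp1.trans_le hτ.1, hτ.2.trans_lt hq2⟩
  refine ht p q ?_ (hp2.trans hq1) ?_ (fun τ hτ => (hball (hsub τ hτ)).1) ⟨hp2, hq1⟩
  · exact (hball (hsub p ⟨le_rfl, (hp2.trans hq1).le⟩)).2.1
  · exact (hball (hsub q ⟨(hp2.trans hq1).le, le_rfl⟩)).2.2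

/-- A pointwise derivative bound along a curve gives the upper gradient inequality. -/
theorem increment_le_of_ae_deriv_le {G : X → ℝ≥0∞} {m : X → ℝ} {Ω : Set X} (γ : Curve X)
    (hγ : γ.In Ω) (hm : LocLipschitzOn m Ω)
    (hd : ∀ᵐ t, t ∈ Ioo (0 : ℝ) 1 → DifferentiableAt ℝ (fun s => m (γ.toFun s)) t →
      ENNReal.ofReal |deriv (fun s => m (γ.toFun s)) t| ≤ G (γ.toFun t) * speed γ.toFun t) :
    ENNReal.ofReal |m (γ.toFun 1) - m (γ.toFun 0)| ≤ curveIntegral G γ := by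
  obtain ⟨K, hK⟩ := γ.lipschitz
  obtain ⟨L, hL⟩ := hm _ γ.isCompact_image (by rintro _ ⟨τ, hτ, rfl⟩; exact hγ τ hτ)
  have hlip : LipschitzOnWith (L * K) (fun s => m (γ.toFun s)) (uIcc (0 : ℝ) 1) := by
    rw [uIcc_of_le zero_le_one]
    exact hL.comp hK (mapsTo_image _ _)
  have hac := hlip.absolutelyContinuousOnInterval
  have hint := hac.integral_deriv_eq_sub
  rw [← hint, ← Real.enorm_eq_ofReal_abs]
  rw [intervalIntegral.integral_of_le zero_le_one]
  refine (enorm_integral_le_lintegral_enorm _).trans ?_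
  rw [restrict_Ioc_eq_restrict_Icc, curveIntegral, ← restrict_Ioo_eq_restrict_Icc]
  refine lintegral_mono_ae ?_
  rw [ae_restrict_iff' measurableSet_Ioo]
  filter_upwards [hd, hac.ae_differentiableAt] with t h1 h2 ht
  rw [Real.enorm_eq_ofReal_abs]
  exact h1 ht (h2 (by rw [uIcc_of_le zero_le_one]; exact Ioo_subset_Icc_self ht))

theorem deriv_comp_le_of_eventually {w : X → ℝ} {γ : ℝ → X} {t c : ℝ} (hγ : ContinuousAt γ t)
    (hw : ∀ᶠ y in 𝓝 (γ t), |w y - w (γ t)| ≤ c * dist y (γ t))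
    (hd : DifferentiableAt ℝ (fun s => w (γ s)) t) (hc : 0 ≤ c) :
    ENNReal.ofReal |deriv (fun s => w (γ s)) t| ≤ ENNReal.ofReal c * speed γ t := by
  have h1 := (hasDerivAt_iff_tendsto_slope_zero.1 hd.hasDerivAt).abs
  have h2 := ENNReal.tendsto_ofReal h1
  rw [← h2.limsup_eq, speed, ← ENNReal.limsup_const_mul_of_ne_top ENNReal.ofReal_ne_top]
  refine limsup_le_limsup ?_
  have hev : ∀ᶠ h in 𝓝 (0 : ℝ), |w (γ (t + h)) - w (γ t)| ≤ c * dist (γ (t + h)) (γ t) := by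
    have : Tendsto (fun h : ℝ => γ (t + h)) (𝓝 0) (𝓝 (γ t)) := by
      refine Tendsto.comp (show Tendsto γ (𝓝 t) (𝓝 (γ t)) from hγ) ?_
      exact (continuous_const_add t).tendsto' 0 t (by simp)
    exact this.eventually hw
  filter_upwards [hev.filter_mono nhdsWithin_le_nhds] with h hh
  rw [← ENNReal.ofReal_mul hc]
  refine ENNReal.ofReal_le_ofReal ?_
  rw [smul_eq_mul, abs_mul, abs_inv, inv_mul_eq_div, ← mul_div_assoc]
  gcongr

/-! ### Upper gradients and approximation of the total variation -/

theorem le_curveIntegral_add (f g : X → ℝ≥0∞) (γ : Curve X) :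
    curveIntegral f γ + curveIntegral g γ ≤ curveIntegral (f + g) γ := by
  refine (le_lintegral_add _ _).trans (lintegral_mono fun t => ?_)
  simp only [Pi.add_apply, add_mul, le_refl]

theorem curveIntegral_mono {f g : X → ℝ≥0∞} (h : ∀ x, f x ≤ g x) (γ : Curve X) :
    curveIntegral f γ ≤ curveIntegral g γ :=
  lintegral_mono fun _ => mul_le_mul_left (h _) _

theorem IsUpperGradientOn.mono {g g' : X → ℝ≥0∞} {u : X → ℝ} {Ω Ω' : Set X}
    (h : IsUpperGradientOn g u Ω) (hg : ∀ x, g x ≤ g' x) (hΩ : Ω' ⊆ Ω) :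
    IsUpperGradientOn g' u Ω' := fun γ hγ =>
  (h γ fun t ht => hΩ (hγ t ht)).trans (curveIntegral_mono hg γ)

theorem IsUpperGradientOn.isWeak {μ : Measure X} {g : X → ℝ≥0∞} {u : X → ℝ} {Ω : Set X}
    (h : IsUpperGradientOn g u Ω) : IsWeakUpperGradientOn μ g u Ω := by
  refine ⟨∅, ?_, fun γ _ hγ => h γ hγ⟩
  refine le_antisymm ?_ bot_le
  refine (iInf_le _ (fun _ => 0)).trans ((iInf_le _ measurable_const).trans
    ((iInf_le _ (by simp)).trans (by simp)))

theorem exists_upperGradient_of_weak {μ : Measure X} {g : X → ℝ≥0∞} {u : X → ℝ} {Ω : Set X}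
    (h : IsWeakUpperGradientOn μ g u Ω) {ε : ℝ≥0∞} (hε : ε ≠ 0) :
    ∃ ρ : X → ℝ≥0∞, Measurable ρ ∧ ∫⁻ x, ρ x ∂μ ≤ ε ∧ IsUpperGradientOn (g + ρ) u Ω := by
  obtain ⟨Γ, hΓ, hu⟩ := h
  obtain ⟨δ, hδ, hsum⟩ := ENNReal.exists_pos_sum_of_countable' hε ℕ
  have hex : ∀ n, ∃ ρ : X → ℝ≥0∞, Measurable ρ ∧ (∀ γ ∈ Γ, 1 ≤ curveIntegral ρ γ) ∧
      ∫⁻ x, ρ x ∂μ < δ n := by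
    intro n
    have := hδ n
    rw [← hΓ, Mod1] at this
    simpa only [iInf_lt_iff, exists_prop] using this
  choose ρ hρm hρ hρi using hex
  refine ⟨fun x => ∑' n, ρ n x, Measurable.tsum hρm, ?_, fun γ hγ => ?_⟩
  · rw [lintegral_tsum fun n => (hρm n).aemeasurable]
    exact (ENNReal.tsum_le_tsum fun n => (hρi n).le).trans hsum.le
  · by_cases hmem : γ ∈ Γ
    · have hfin : ∀ N : ℕ, (N : ℝ≥0∞) ≤ curveIntegral (fun x => ∑ n ∈ Finset.range N, ρ n x) γ := by
        intro N
        induction N with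
        | zero => simp
        | succ k ih =>
          push_cast
          refine (add_le_add ih (hρ k γ hmem)).trans ((le_curveIntegral_add _ _ γ).trans
            (curveIntegral_mono (fun x => ?_) γ))
          simp [Finset.sum_range_succ]
      have htop : curveIntegral (g + fun x => ∑' n, ρ n x) γ = ⊤ := by
        refine ENNReal.eq_top_of_forall_nnreal_le fun r => ?_
        obtain ⟨N, hN⟩ := exists_nat_ge r
        calc (r : ℝ≥0∞) ≤ (N : ℝ≥0∞) := by exact_mod_cast hN
          _ ≤ _ := (hfin N).trans (curveIntegral_mono (fun x =>
              (ENNReal.sum_le_tsum _).trans le_add_self) γ)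
      rw [htop]
      exact le_top
    · exact (hu γ hmem hγ).trans (curveIntegral_mono (fun x => le_self_add) γ)

theorem LocLipschitzOn.mono {u : X → ℝ} {Ω Ω' : Set X} (h : LocLipschitzOn u Ω) (hΩ : Ω' ⊆ Ω) :
    LocLipschitzOn u Ω' := fun K hK hKΩ => h K hK (hKΩ.trans hΩ)

theorem tv_le_of_seq {μ : Measure X} {u : X → ℝ} {Ω : Set X} {v : ℕ → X → ℝ}
    {g : ℕ → X → ℝ≥0∞} (hv : ∀ i, LocLipschitzOn (v i) Ω) (hu : TendstoL1Loc μ v u Ω)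
    (hg : ∀ i, Measurable (g i)) (hgv : ∀ i, IsUpperGradientOn (g i) (v i) Ω) :
    tv μ u Ω ≤ liminf (fun i => ∫⁻ x in Ω, g i x ∂μ) atTop :=
  (iInf_le _ v).trans <| (iInf_le _ hv).trans <| (iInf_le _ hu).trans <| (iInf_le _ g).trans <|
    (iInf_le _ hg).trans <| iInf_le _ fun i => (hgv i).isWeak

/-- Below any number exceeding the total variation there is an approximating sequence with
genuine upper gradients. -/
theorem exists_seq_of_tv_lt {μ : Measure X} {u : X → ℝ} {Ω : Set X} {c : ℝ≥0∞}
    (h : tv μ u Ω < c) :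
    ∃ (v : ℕ → X → ℝ) (g : ℕ → X → ℝ≥0∞), (∀ i, LocLipschitzOn (v i) Ω) ∧
      TendstoL1Loc μ v u Ω ∧ (∀ i, Measurable (g i)) ∧
      (∀ i, IsUpperGradientOn (g i) (v i) Ω) ∧ ∀ i, ∫⁻ x in Ω, g i x ∂μ < c := by
  rw [tv] at h
  simp only [iInf_lt_iff] at h
  obtain ⟨v, hv, hu, g, hg, hgv, hlim⟩ := h
  obtain ⟨φ, hφ, hφc⟩ := extraction_of_frequently_atTop (frequently_lt_of_liminf_lt (by isBoundedDefault) hlim)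
  have hex : ∀ i, ∃ ρ : X → ℝ≥0∞, Measurable ρ ∧ IsUpperGradientOn (g (φ i) + ρ) (v (φ i)) Ω ∧
      ∫⁻ x in Ω, (g (φ i) + ρ) x ∂μ < c := by
    intro i
    obtain ⟨δ, hδ, hlt⟩ := ENNReal.lt_iff_exists_add_pos_lt.1 (hφc i)
    obtain ⟨ρ, hρ, hρi, hUG⟩ := exists_upperGradient_of_weak (hgv (φ i))
      (ε := δ) (by exact_mod_cast hδ.ne')
    refine ⟨ρ, hρ, hUG, lt_of_le_of_lt ?_ hlt⟩
    simp only [Pi.add_apply]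
    rw [lintegral_add_right _ hρ]
    gcongr
    exact (setLIntegral_le_lintegral _ _).trans hρi
  choose ρ hρ hUG hlt using hex
  exact ⟨fun i => v (φ i), fun i => g (φ i) + ρ i, fun i => hv _,
    fun K hK hKΩ => (hu K hK hKΩ).comp hφ.tendsto_atTop, fun i => (hg _).add (hρ i), hUG, hlt⟩

theorem exists_approx_of_tv_le {μ : Measure X} {u : X → ℝ} {Ω : Set X} {c : ℝ≥0∞}
    (h : tv μ u Ω ≤ c) (hc : c ≠ ⊤) {K : Set X} (hK : IsCompact K) (hKΩ : K ⊆ Ω) {ε : ℝ≥0}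
    (hε : 0 < ε) :
    ∃ (v : X → ℝ) (g : X → ℝ≥0∞), LocLipschitzOn v Ω ∧ Measurable g ∧
      IsUpperGradientOn g v Ω ∧ ∫⁻ x in K, ENNReal.ofReal |v x - u x| ∂μ ≤ ε ∧
      ∫⁻ x in Ω, g x ∂μ ≤ c + ε := by
  have hlt : tv μ u Ω < c + ε := h.trans_lt (ENNReal.lt_add_right hc (by exact_mod_cast hε.ne'))
  obtain ⟨v, g, hv, hu, hg, hgv, hb⟩ := exists_seq_of_tv_lt hlt
  obtain ⟨i, hi⟩ := ((hu K hK hKΩ).eventually_lt_const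
    (show (0 : ℝ≥0∞) < ε by exact_mod_cast hε)).exists
  exact ⟨v i, g i, hv i, hg i, hgv i, hi.le, (hb i).le⟩

theorem exists_compact_exhaustion [ProperSpace X] {Ω : Set X} (hΩ : IsOpen Ω) :
    ∃ K : ℕ → Set X, (∀ n, IsCompact (K n)) ∧ (∀ n, K n ⊆ Ω) ∧
      ∀ L, IsCompact L → L ⊆ Ω → ∃ n, ∀ m, n ≤ m → L ⊆ K m := by
  have : LocallyCompactSpace Ω := hΩ.locallyCompactSpace
  let E : CompactExhaustion Ω := default
  refine ⟨fun n => (↑) '' E n, fun n => (E.isCompact n).image continuous_subtype_val,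
    fun n => by rintro _ ⟨y, -, rfl⟩; exact y.2, fun L hL hLΩ => ?_⟩
  have hL' : IsCompact ((↑) ⁻¹' L : Set Ω) :=
    Topology.IsEmbedding.subtypeVal.isCompact_preimage_iff (by simpa using hLΩ) |>.2 hL
  obtain ⟨n, hn⟩ := E.exists_superset_of_isCompact hL'
  exact ⟨n, fun m hm y hy => ⟨⟨y, hLΩ hy⟩, E.subset hm (hn hy), rfl⟩⟩

theorem tv_le_of_approx [ProperSpace X] {μ : Measure X} {u : X → ℝ} {Ω : Set X} {c : ℝ≥0∞}
    (hΩ : IsOpen Ω)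
    (h : ∀ K, IsCompact K → K ⊆ Ω → ∃ M : ℝ≥0, ∀ ε : ℝ≥0, 0 < ε →
      ∃ (v : X → ℝ) (g : X → ℝ≥0∞), LocLipschitzOn v Ω ∧ Measurable g ∧
      IsUpperGradientOn g v Ω ∧ ∫⁻ x in K, ENNReal.ofReal |v x - u x| ∂μ ≤ M * ε ∧
      ∫⁻ x in Ω, g x ∂μ ≤ c + M * ε) :
    tv μ u Ω ≤ c := by
  obtain ⟨K, hK, hKΩ, hex⟩ := exists_compact_exhaustion hΩ
  have hap : ∀ n : ℕ, ∃ (v : X → ℝ) (g : X → ℝ≥0∞), LocLipschitzOn v Ω ∧ Measurable g ∧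
      IsUpperGradientOn g v Ω ∧ ∫⁻ x in K n, ENNReal.ofReal |v x - u x| ∂μ ≤ (n : ℝ≥0∞)⁻¹ ∧
      ∫⁻ x in Ω, g x ∂μ ≤ c + (n : ℝ≥0∞)⁻¹ := by
    intro n
    obtain ⟨M, hM⟩ := h (K n) (hK n) (hKΩ n)
    obtain ⟨v, g, h1, h2, h3, h4, h5⟩ := hM ((M + 1)⁻¹ * ((n : ℝ≥0) + 1)⁻¹) (by positivity)
    have hle : (M : ℝ≥0∞) * ((M + 1)⁻¹ * ((n : ℝ≥0) + 1)⁻¹ : ℝ≥0) ≤ (n : ℝ≥0∞)⁻¹ := by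
      have : M * ((M + 1)⁻¹ * ((n : ℝ≥0) + 1)⁻¹ : ℝ≥0) ≤ ((n : ℝ≥0) + 1)⁻¹ := by
        rw [← mul_assoc]
        refine mul_le_of_le_one_left' ?_
        rw [← div_eq_mul_inv]
        exact div_le_one_of_le₀ (by simp) (by positivity)
      calc (M : ℝ≥0∞) * ((M + 1)⁻¹ * ((n : ℝ≥0) + 1)⁻¹ : ℝ≥0) ≤ (((n : ℝ≥0) + 1)⁻¹ : ℝ≥0) := by
            exact_mod_cast this
        _ = ((n + 1 : ℝ≥0) : ℝ≥0∞)⁻¹ := ENNReal.coe_inv (by positivity)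
        _ ≤ _ := by
            refine ENNReal.inv_le_inv.2 ?_
            push_cast
            exact le_self_add
    exact ⟨v, g, h1, h2, h3, h4.trans hle, h5.trans (by gcongr)⟩
  choose v g h1 h2 h3 h4 h5 using hap
  refine (tv_le_of_seq h1 ?_ h2 h3).trans ?_
  · intro L hL hLΩ
    obtain ⟨n, hn⟩ := hex L hL hLΩ
    refine tendsto_of_tendsto_of_tendsto_of_le_of_le' tendsto_const_nhds
      ENNReal.tendsto_inv_nat_nhds_zero (by simp) ?_
    filter_upwards [eventually_ge_atTop n] with m hm
    exact (lintegral_mono_set (hn m hm)).trans (h4 m)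
  · refine (liminf_le_liminf (Eventually.of_forall h5)).trans ?_
    have : Tendsto (fun n : ℕ => c + (n : ℝ≥0∞)⁻¹) atTop (𝓝 (c + 0)) :=
      tendsto_const_nhds.add ENNReal.tendsto_inv_nat_nhds_zero
    rw [this.liminf_eq, add_zero]

theorem tv_mono {μ : Measure X} {u : X → ℝ} {Ω Ω' : Set X} (h : Ω' ⊆ Ω) :
    tv μ u Ω' ≤ tv μ u Ω := by
  refine le_of_forall_gt_imp_ge_of_dense fun c hc => ?_
  obtain ⟨v, g, h1, h2, h3, h4, h5⟩ := exists_seq_of_tv_lt hc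
  refine (tv_le_of_seq (v := v) (g := g) (fun i => (h1 i).mono h)
    (fun K hK hKΩ => h2 K hK (hKΩ.trans h)) h3
    fun i => (h4 i).mono (fun _ => le_rfl) h).trans ?_
  refine (liminf_le_liminf (Eventually.of_forall fun i =>
    (lintegral_mono_set h).trans (h5 i).le)).trans ?_
  simp

/-! ### Locally Lipschitz functions -/

theorem LocLipschitzOn.comp₂ {u v : X → ℝ} {Ω : Set X} (hu : LocLipschitzOn u Ω)
    (hv : LocLipschitzOn v Ω) {F : ℝ × ℝ → ℝ} (hF : LocallyLipschitz F) :
    LocLipschitzOn (fun y => F (u y, v y)) Ω := by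
  intro K hK hKΩ
  obtain ⟨L, hL⟩ := hu K hK hKΩ
  obtain ⟨L', hL'⟩ := hv K hK hKΩ
  have h := hL.prodMk hL'
  obtain ⟨M, hM⟩ := LocallyLipschitzOn.exists_lipschitzOnWith_of_compact
    (hK.image_of_continuousOn h.continuousOn) (hF.locallyLipschitzOn (s := _))
  exact ⟨_, hM.comp h (mapsTo_image _ _)⟩

theorem LipschitzWith.locLipschitzOn {u : X → ℝ} {L : ℝ≥0} (h : LipschitzWith L u) (Ω : Set X) :
    LocLipschitzOn u Ω := fun _ _ _ => ⟨L, h.lipschitzOnWith⟩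

theorem locLipschitzOn_const (c : ℝ) (Ω : Set X) : LocLipschitzOn (fun _ => c) Ω :=
  LipschitzWith.locLipschitzOn (LipschitzWith.const c) Ω

theorem LocLipschitzOn.add {u v : X → ℝ} {Ω : Set X} (hu : LocLipschitzOn u Ω)
    (hv : LocLipschitzOn v Ω) : LocLipschitzOn (fun y => u y + v y) Ω :=
  hu.comp₂ hv (F := fun p => p.1 + p.2)
    (ContDiff.locallyLipschitz (𝕂 := ℝ) (contDiff_fst.add contDiff_snd))

theorem LocLipschitzOn.mul {u v : X → ℝ} {Ω : Set X} (hu : LocLipschitzOn u Ω)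
    (hv : LocLipschitzOn v Ω) : LocLipschitzOn (fun y => u y * v y) Ω :=
  hu.comp₂ hv (F := fun p => p.1 * p.2)
    (ContDiff.locallyLipschitz (𝕂 := ℝ) (contDiff_fst.mul contDiff_snd))

theorem LocLipschitzOn.inf {u v : X → ℝ} {Ω : Set X} (hu : LocLipschitzOn u Ω)
    (hv : LocLipschitzOn v Ω) : LocLipschitzOn (fun y => min (u y) (v y)) Ω :=
  hu.comp₂ hv (F := fun p => min p.1 p.2)
    (LipschitzWith.prod_fst.locallyLipschitz.min LipschitzWith.prod_snd.locallyLipschitz)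

theorem LocLipschitzOn.sup {u v : X → ℝ} {Ω : Set X} (hu : LocLipschitzOn u Ω)
    (hv : LocLipschitzOn v Ω) : LocLipschitzOn (fun y => max (u y) (v y)) Ω :=
  hu.comp₂ hv (F := fun p => max p.1 p.2)
    (LipschitzWith.prod_fst.locallyLipschitz.max LipschitzWith.prod_snd.locallyLipschitz)

theorem locLipschitzOn_of_local [ProperSpace X] {u : X → ℝ} {Ω : Set X}
    (h : ∀ y ∈ Ω, ∃ U, IsOpen U ∧ y ∈ U ∧ LocLipschitzOn u U) : LocLipschitzOn u Ω := by
  intro K hK hKΩ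
  refine LocallyLipschitzOn.exists_lipschitzOnWith_of_compact hK fun y hy => ?_
  obtain ⟨U, hU, hyU, hu⟩ := h y (hKΩ hy)
  obtain ⟨C, hC, hCy, hCU⟩ := exists_compact_subset hU hyU
  obtain ⟨L, hL⟩ := hu C hC hCU
  exact ⟨L, C, mem_nhdsWithin_of_mem_nhds (mem_interior_iff_mem_nhds.1 hCy), hL⟩

theorem LocLipschitzOn.congr {u v : X → ℝ} {Ω : Set X} (hu : LocLipschitzOn u Ω)
    (h : ∀ y ∈ Ω, v y = u y) : LocLipschitzOn v Ω := fun K hK hKΩ => by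
  obtain ⟨L, hL⟩ := hu K hK hKΩ
  exact ⟨L, fun y hy z hz => by rw [h y (hKΩ hy), h z (hKΩ hz)]; exact hL hy hz⟩

theorem LocLipschitzOn.continuousOn [ProperSpace X] {u : X → ℝ} {Ω : Set X} (hΩ : IsOpen Ω)
    (hu : LocLipschitzOn u Ω) : ContinuousOn u Ω := by
  intro y hy
  obtain ⟨C, hC, hCy, hCU⟩ := exists_compact_subset hΩ hy
  obtain ⟨L, hL⟩ := hu C hC hCU
  exact (hL.continuousOn.continuousAt (mem_interior_iff_mem_nhds.1 hCy)).continuousWithinAt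

theorem LocLipschitzOn.measurable_indicator [ProperSpace X] [BorelSpace X] {u : X → ℝ}
    {Ω S : Set X} (hΩ : IsOpen Ω) (hu : LocLipschitzOn u Ω) (hS : MeasurableSet S) (hSΩ : S ⊆ Ω) :
    Measurable (S.indicator u) := by
  classical
  rw [← piecewise_eq_indicator]
  exact ContinuousOn.measurable_piecewise ((hu.continuousOn hΩ).mono hSΩ)
    continuousOn_const hS

theorem LocLipschitzOn.aemeasurable [ProperSpace X] [BorelSpace X] {u : X → ℝ} {μ : Measure X}
    {Ω S : Set X} (hΩ : IsOpen Ω) (hu : LocLipschitzOn u Ω) (hS : MeasurableSet S) (hSΩ : S ⊆ Ω) :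
    AEMeasurable u (μ.restrict S) :=
  ((hu.continuousOn hΩ).mono hSΩ).aemeasurable hS

/-! ### Basic properties of the total variation -/

theorem tv_congr_ae {μ : Measure X} {u u' : X → ℝ} (h : u =ᵐ[μ] u') (Ω : Set X) :
    tv μ u Ω = tv μ u' Ω := by
  have : ∀ v, TendstoL1Loc μ v u Ω ↔ TendstoL1Loc μ v u' Ω := by
    intro v
    have : ∀ i (K : Set X), ∫⁻ x in K, ENNReal.ofReal |v i x - u x| ∂μ =
        ∫⁻ x in K, ENNReal.ofReal |v i x - u' x| ∂μ := fun i K =>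
      lintegral_congr_ae (ae_restrict_of_ae (h.mono fun x hx => by simp only [hx]))
    simp only [TendstoL1Loc, this]
  simp only [tv, this]

theorem tv_congr_on [BorelSpace X] {μ : Measure X} {u u' : X → ℝ} {Ω : Set X}
    (h : ∀ y ∈ Ω, u y = u' y) : tv μ u Ω = tv μ u' Ω := by
  have : ∀ v, TendstoL1Loc μ v u Ω ↔ TendstoL1Loc μ v u' Ω := by
    intro v
    refine forall₃_congr fun K hK hKΩ => ?_
    have : ∀ i, ∫⁻ x in K, ENNReal.ofReal |v i x - u x| ∂μ =
        ∫⁻ x in K, ENNReal.ofReal |v i x - u' x| ∂μ := fun i =>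
      setLIntegral_congr_fun hK.measurableSet fun x hx => by simp only [h x (hKΩ hx)]
    simp only [this]
  simp only [tv, this]

theorem tv_const {μ : Measure X} (c : ℝ) (Ω : Set X) : tv μ (fun _ => c) Ω = 0 := by
  refine le_antisymm ((tv_le_of_seq (v := fun _ _ => c) (g := fun _ _ => 0)
    (fun _ => locLipschitzOn_const c Ω) (fun K _ _ => by simp) (fun _ => measurable_const)
    fun _ γ _ => by simp).trans (by simp)) bot_le

theorem tv_affine_le {μ : Measure X} {u : X → ℝ} {Ω : Set X} (c d : ℝ) :
    tv μ (fun y => c * u y + d) Ω ≤ ENNReal.ofReal |c| * tv μ u Ω := by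
  rcases eq_or_ne c 0 with rfl | hc
  · simp [tv_const]
  have hc' : ENNReal.ofReal |c| ≠ 0 := by simpa using hc
  rw [← ENNReal.div_le_iff' hc' ENNReal.ofReal_ne_top]
  refine le_of_forall_gt_imp_ge_of_dense fun a ha => ?_
  obtain ⟨v, g, h1, h2, h3, h4, h5⟩ := exists_seq_of_tv_lt ha
  rw [ENNReal.div_le_iff' hc' ENNReal.ofReal_ne_top]
  refine (tv_le_of_seq (v := fun i y => c * v i y + d)
    (g := fun i y => ENNReal.ofReal |c| * g i y)
    (fun i => ((locLipschitzOn_const c Ω).mul (h1 i)).add (locLipschitzOn_const d Ω)) ?_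
    (fun i => (h3 i).const_mul _) ?_).trans ?_
  · intro K hK hKΩ
    have := ENNReal.Tendsto.const_mul (a := ENNReal.ofReal |c|) (h2 K hK hKΩ)
      (Or.inr ENNReal.ofReal_ne_top)
    rw [mul_zero] at this
    refine this.congr fun i => ?_
    rw [← lintegral_const_mul' _ _ ENNReal.ofReal_ne_top]
    refine lintegral_congr fun x => ?_
    rw [← ENNReal.ofReal_mul (abs_nonneg _), ← abs_mul]
    ring_nf
  · intro i γ hγ
    calc _ = ENNReal.ofReal |c| * ENNReal.ofReal |v i (γ.toFun 1) - v i (γ.toFun 0)| := by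
          rw [← ENNReal.ofReal_mul (abs_nonneg _), ← abs_mul]
          ring_nf
      _ ≤ ENNReal.ofReal |c| * curveIntegral (g i) γ := by gcongr; exact h4 i γ hγ
      _ = _ := by
          rw [curveIntegral, curveIntegral, ← lintegral_const_mul' _ _ ENNReal.ofReal_ne_top]
          simp only [mul_assoc]
  · refine (liminf_le_liminf (v := fun _ => ENNReal.ofReal |c| * a)
      (Eventually.of_forall fun i => ?_)).trans (by simp)
    rw [lintegral_const_mul' _ _ ENNReal.ofReal_ne_top]
    gcongr
    exact (h5 i).le

theorem sum_liminf_le {ι : Type*} (s : Finset ι) (f : ι → ℕ → ℝ≥0∞) :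
    ∑ j ∈ s, liminf (f j) atTop ≤ liminf (fun i => ∑ j ∈ s, f j i) atTop := by
  let _ : MeasurableSpace s := ⊤
  have := lintegral_liminf_le' (μ := Measure.count) (f := fun (i : ℕ) (j : s) => f j i)
    (u := atTop) (fun i => (measurable_from_top).aemeasurable)
  simp only [lintegral_count, tsum_fintype] at this
  rw [← Finset.sum_coe_sort]
  refine this.trans_eq (liminf_congr (Eventually.of_forall fun i => ?_))
  exact Finset.sum_coe_sort s fun j => f j i

/-- A family of open sets with overlap at most `N` carries at most `N` times the total
variation of the surrounding set. -/
theorem sum_tv_le [BorelSpace X] {μ : Measure X} {u : X → ℝ} {Ω : Set X} {ι : Type*}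
    (s : Finset ι) (U : ι → Set X) (hU : ∀ j ∈ s, IsOpen (U j)) (hΩ : ∀ j ∈ s, U j ⊆ Ω) (N : ℕ)
    (hN : ∀ y, ∑ j ∈ s, (U j).indicator (fun _ => (1 : ℝ≥0∞)) y ≤ N) :
    ∑ j ∈ s, tv μ u (U j) ≤ N * tv μ u Ω := by
  rcases eq_or_ne N 0 with rfl | hN0
  · have : ∀ j ∈ s, U j ⊆ ∅ := by
      intro j hj y hy
      have h0 := (Finset.single_le_sum (f := fun j => (U j).indicator (fun _ => (1 : ℝ≥0∞)) y)
        (fun _ _ => bot_le) hj).trans (hN y)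
      simp [indicator_of_mem hy] at h0
    refine (Finset.sum_le_sum (g := fun _ => 0) fun j hj => ?_).trans (by simp)
    refine (tv_mono (this j hj)).trans ?_
    rw [tv_congr_on (u' := fun _ => 0) (by simp), tv_const]
  have hN' : (N : ℝ≥0∞) ≠ 0 := by exact_mod_cast hN0
  rw [← ENNReal.div_le_iff' hN' (by simp)]
  refine le_of_forall_gt_imp_ge_of_dense fun a ha => ?_
  rw [ENNReal.div_le_iff' hN' (by simp)]
  obtain ⟨v, g, h1, h2, h3, h4, h5⟩ := exists_seq_of_tv_lt ha
  have step : ∀ j ∈ s, tv μ u (U j) ≤ liminf (fun i => ∫⁻ x in U j, g i x ∂μ) atTop :=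
    fun j hj => tv_le_of_seq (fun i => (h1 i).mono (hΩ j hj))
      (fun K hK hKU => h2 K hK (hKU.trans (hΩ j hj))) h3
      fun i => (h4 i).mono (fun _ => le_rfl) (hΩ j hj)
  refine (Finset.sum_le_sum step).trans ((sum_liminf_le s _).trans ?_)
  refine (liminf_le_liminf (v := fun _ => N * a)
      (Eventually.of_forall fun i => ?_)).trans (by simp)
  calc ∑ j ∈ s, ∫⁻ x in U j, g i x ∂μ
      = ∑ j ∈ s, ∫⁻ x in Ω, (U j).indicator (g i) x ∂μ := Finset.sum_congr rfl fun j hj => by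
        rw [lintegral_indicator (hU j hj).measurableSet, Measure.restrict_restrict
          (hU j hj).measurableSet, inter_eq_self_of_subset_left (hΩ j hj)]
    _ = ∫⁻ x in Ω, ∑ j ∈ s, (U j).indicator (g i) x ∂μ :=
        (lintegral_finsetSum' _ fun j hj =>
          ((h3 i).indicator (hU j hj).measurableSet).aemeasurable).symm
    _ ≤ ∫⁻ x in Ω, N * g i x ∂μ := lintegral_mono fun x => by
        calc _ = (∑ j ∈ s, (U j).indicator (fun _ => (1 : ℝ≥0∞)) x) * g i x := by
              rw [Finset.sum_mul]
              refine Finset.sum_congr rfl fun j _ => ?_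
              by_cases hx : x ∈ U j <;> simp [hx]
          _ ≤ _ := by gcongr; exact hN x
    _ = N * ∫⁻ x in Ω, g i x ∂μ := lintegral_const_mul _ (h3 i)
    _ ≤ _ := by gcongr; exact (h5 i).le

theorem tv_add_tv_le [BorelSpace X] {μ : Measure X} {u : X → ℝ} {Ω U V : Set X}
    (hU : IsOpen U) (hV : IsOpen V) (hUΩ : U ⊆ Ω) (hVΩ : V ⊆ Ω) (h : Disjoint U V) :
    tv μ u U + tv μ u V ≤ tv μ u Ω := by
  have := sum_tv_le (μ := μ) (u := u) (Ω := Ω) Finset.univ (fun b : Bool => cond b U V)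
    (by simp [hU, hV]) (by simp [hUΩ, hVΩ]) 1 (fun y => by
      by_cases hy : y ∈ U
      · simp [hy, disjoint_left.1 h hy]
      · by_cases hy' : y ∈ V <;> simp [hy, hy'])
  simpa using this

theorem tv_le_of_tendsto [ProperSpace X] [BorelSpace X] {μ : Measure X} {u : X → ℝ} {Ω : Set X}
    (hΩ : IsOpen Ω) {w : ℕ → X → ℝ} (hu : AEMeasurable u μ) (hw : ∀ j, AEMeasurable (w j) μ)
    (h : TendstoL1Loc μ w u Ω) {c : ℝ≥0∞} (hc : ∀ j, tv μ (w j) Ω ≤ c) : tv μ u Ω ≤ c := by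
  rcases eq_or_ne c ⊤ with rfl | hc'
  · exact le_top
  refine tv_le_of_approx hΩ fun K hK hKΩ => ⟨2, fun ε hε => ?_⟩
  obtain ⟨j, hj⟩ := ((h K hK hKΩ).eventually_lt_const
    (show (0 : ℝ≥0∞) < ε by exact_mod_cast hε)).exists
  obtain ⟨v, g, h1, h2, h3, h4, h5⟩ := exists_approx_of_tv_le (hc j) hc' hK hKΩ hε
  refine ⟨v, g, h1, h2, h3, ?_, h5.trans ?_⟩
  · calc _ ≤ ∫⁻ x in K, (ENNReal.ofReal |v x - w j x| + ENNReal.ofReal |w j x - u x|) ∂μ := by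
          refine lintegral_mono fun x => ?_
          rw [← ENNReal.ofReal_add (abs_nonneg _) (abs_nonneg _)]
          exact ENNReal.ofReal_le_ofReal (abs_sub_le _ _ _)
      _ = _ := lintegral_add_right' _ (((hw j).sub hu).abs.ennreal_ofReal.restrict)
      _ ≤ ε + ε := add_le_add h4 hj.le
      _ = _ := by push_cast; ring
  · gcongr
    push_cast
    exact le_mul_of_one_le_left bot_le (by norm_num)

/-! ### Lattice operations -/

theorem deriv_eq_of_le_of_eq {f m : ℝ → ℝ} {t : ℝ} (hf : DifferentiableAt ℝ f t)
    (hm : DifferentiableAt ℝ m t) (hle : ∀ s, m s ≤ f s) (heq : m t = f t) :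
    deriv m t = deriv f t := by
  have hmin : IsLocalMin (fun s => f s - m s) t := Eventually.of_forall fun s => by
    simp only [heq, sub_self, sub_nonneg, hle s]
  have := hmin.deriv_eq_zero
  rw [deriv_fun_sub hf hm, sub_eq_zero] at this
  exact this.symm

/-- Two functions with upper gradients, combined so that at each point the combination touches
one of them from one side, have the corresponding combined upper gradient. -/
theorem isUpperGradientOn_of_touch {u w m : X → ℝ} {g h : X → ℝ≥0∞} {Ω S : Set X} {ε : ℝ≥0}
    (hε : 0 < ε) (hΩ : IsOpen Ω) (hu : LocLipschitzOn u Ω) (hw : LocLipschitzOn w Ω)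
    (hg : IsUpperGradientOn g u Ω) (hh : IsUpperGradientOn h w Ω) (hm : LocLipschitzOn m Ω)
    (hSu : ∀ y ∈ Ω, y ∈ S → m y = u y) (hSw : ∀ y ∈ Ω, y ∉ S → m y = w y)
    (hle : ((∀ y, m y ≤ u y) ∧ ∀ y, m y ≤ w y) ∨ ((∀ y, u y ≤ m y) ∧ ∀ y, w y ≤ m y)) :
    IsUpperGradientOn (fun y => S.indicator g y + Sᶜ.indicator h y + ε * (g y + h y)) m Ω := by
  intro γ hγ
  set G : X → ℝ≥0∞ := fun y => S.indicator g y + Sᶜ.indicator h y + ε * (g y + h y) with hG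
  rcases eq_or_ne (curveIntegral G γ) ⊤ with htop | htop
  · rw [htop]; exact le_top
  have hfin : ∀ f : X → ℝ≥0∞, (∀ y, f y ≤ g y + h y) →
      ∫⁻ t in Icc (0 : ℝ) 1, Ω.indicator f (γ.toFun t) * speed γ.toFun t ≠ ⊤ := by
    intro f hf
    refine ne_top_of_le_ne_top (ENNReal.mul_ne_top (ENNReal.inv_ne_top.2
      (show (ε : ℝ≥0∞) ≠ 0 by exact_mod_cast hε.ne')) htop) (?_ : _ ≤ (ε : ℝ≥0∞)⁻¹ * _)
    rw [curveIntegral, ← lintegral_const_mul' _ _ (ENNReal.inv_ne_top.2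
      (by exact_mod_cast hε.ne'))]
    refine lintegral_mono fun t => ?_
    rw [← mul_assoc]
    gcongr
    calc _ ≤ f (γ.toFun t) := indicator_le_self _ _ _
      _ ≤ g (γ.toFun t) + h (γ.toFun t) := hf _
      _ = (ε : ℝ≥0∞)⁻¹ * (ε * (g (γ.toFun t) + h (γ.toFun t))) := by
          rw [← mul_assoc, ENNReal.inv_mul_cancel (by exact_mod_cast hε.ne') (by simp), one_mul]
      _ ≤ _ := by gcongr; exact le_add_self
  refine increment_le_of_ae_deriv_le γ hγ hm ?_
  filter_upwards [hg.ae_deriv_le hu hΩ γ (hfin g fun y => le_self_add),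
    hh.ae_deriv_le hw hΩ γ (hfin h fun y => le_add_self)] with t h1 h2 ht hd
  have htΩ := hγ t (Ioo_subset_Icc_self ht)
  obtain ⟨hdu, hbu⟩ := h1 ht htΩ
  obtain ⟨hdw, hbw⟩ := h2 ht htΩ
  by_cases hS : γ.toFun t ∈ S
  · have : deriv (fun s => m (γ.toFun s)) t = deriv (fun s => u (γ.toFun s)) t := by
      rcases hle with hle | hle
      · exact deriv_eq_of_le_of_eq hdu hd (fun s => hle.1 _) (hSu _ htΩ hS)
      · exact (deriv_eq_of_le_of_eq hd hdu (fun s => hle.1 _) (hSu _ htΩ hS).symm).symm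
    rw [this]
    refine hbu.trans ?_
    gcongr
    simp only [hG, indicator_of_mem hS]
    rw [add_assoc]
    exact le_self_add
  · have : deriv (fun s => m (γ.toFun s)) t = deriv (fun s => w (γ.toFun s)) t := by
      rcases hle with hle | hle
      · exact deriv_eq_of_le_of_eq hdw hd (fun s => hle.2 _) (hSw _ htΩ hS)
      · exact (deriv_eq_of_le_of_eq hd hdw (fun s => hle.2 _) (hSw _ htΩ hS).symm).symm
    rw [this]
    refine hbw.trans ?_
    gcongr
    simp only [hG, indicator_of_notMem hS, indicator_of_mem (mem_compl hS), zero_add]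
    exact le_self_add

theorem TendstoL1Loc.comp₂ [BorelSpace X] {μ : Measure X} {Ω : Set X} {v v' : ℕ → X → ℝ}
    {u u' : X → ℝ} [ProperSpace X] (hΩ : IsOpen Ω)
    (h : TendstoL1Loc μ v u Ω) (h' : TendstoL1Loc μ v' u' Ω) (hu : AEMeasurable u μ)
    (hv : ∀ i, LocLipschitzOn (v i) Ω) {F : ℝ → ℝ → ℝ}
    (hF : ∀ a b c d, |F a b - F c d| ≤ |a - c| + |b - d|) :
    TendstoL1Loc μ (fun i y => F (v i y) (v' i y)) (fun y => F (u y) (u' y)) Ω := by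
  intro K hK hKΩ
  have hsum := (h K hK hKΩ).add (h' K hK hKΩ)
  rw [add_zero] at hsum
  refine tendsto_of_tendsto_of_tendsto_of_le_of_le tendsto_const_nhds hsum
    (fun _ => bot_le) fun i => ?_
  have hm : AEMeasurable (fun y => ENNReal.ofReal |v i y - u y|) (μ.restrict K) :=
    (((hv i).aemeasurable hΩ hK.measurableSet hKΩ).sub hu.restrict).abs.ennreal_ofReal
  simp only
  rw [← lintegral_add_left' hm]
  refine lintegral_mono fun x => ?_
  rw [← ENNReal.ofReal_add (abs_nonneg _) (abs_nonneg _)]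
  exact ENNReal.ofReal_le_ofReal (hF _ _ _ _)

theorem tv_min_add_tv_max_le [ProperSpace X] [BorelSpace X] {μ : Measure X} {u w : X → ℝ}
    {Ω : Set X} (hΩ : IsOpen Ω) (hu : AEMeasurable u μ) :
    tv μ (fun y => min (u y) (w y)) Ω + tv μ (fun y => max (u y) (w y)) Ω ≤
      tv μ u Ω + tv μ w Ω := by
  refine ENNReal.le_of_forall_pos_le_add fun ε hε hlt => ?_
  obtain ⟨hc1, hc2⟩ := ENNReal.add_lt_top.1 hlt
  have hε2 : ((ε / 2 : ℝ≥0) : ℝ≥0∞) ≠ 0 := by exact_mod_cast (half_pos hε).ne'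
  obtain ⟨v, g, hv, hvu, hgm, hg, hgi⟩ := exists_seq_of_tv_lt (ENNReal.lt_add_right hc1.ne hε2)
  obtain ⟨z, h, hz, hzw, hhm, hh, hhi⟩ := exists_seq_of_tv_lt (ENNReal.lt_add_right hc2.ne hε2)
  set c : ℝ≥0∞ := (tv μ u Ω + (ε / 2 : ℝ≥0)) + (tv μ w Ω + (ε / 2 : ℝ≥0)) with hc
  have hcε : c = tv μ u Ω + tv μ w Ω + ε := by
    have : ((ε / 2 : ℝ≥0) : ℝ≥0∞) + (ε / 2 : ℝ≥0) = ε := by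
      rw [← ENNReal.coe_add, add_halves]
    rw [hc, ← this]; ring
  rw [← hcε]
  have hcfin : c ≠ ⊤ := by
    rw [hcε]; exact ENNReal.add_ne_top.2 ⟨hlt.ne, ENNReal.coe_ne_top⟩
  let S : ℕ → Set X := fun i => {y | y ∈ Ω ∧ v i y < z i y}
  have hS : ∀ i, MeasurableSet (S i) := by
    intro i
    have h1 := ((hz i).add ((locLipschitzOn_const (-1) Ω).mul (hv i))).continuousOn hΩ
    have : S i = Ω ∩ (fun y => z i y + -1 * v i y) ⁻¹' Ioi 0 := by
      ext y
      simp only [S, mem_ofPred_eq, mem_inter_iff, mem_preimage, mem_Ioi]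
      constructor <;> rintro ⟨a, b⟩ <;> exact ⟨a, by linarith⟩
    rw [this]
    exact (h1.isOpen_inter_preimage hΩ isOpen_Ioi).measurableSet
  let δ : ℕ → ℝ≥0 := fun i => ((i : ℝ≥0) + 1)⁻¹
  have hδ : ∀ i, 0 < δ i := fun i => by positivity
  let G : ℕ → X → ℝ≥0∞ := fun i y =>
    (S i).indicator (g i) y + (S i)ᶜ.indicator (h i) y + δ i * (g i y + h i y)
  let H : ℕ → X → ℝ≥0∞ := fun i y =>
    (S i)ᶜ.indicator (g i) y + ((S i)ᶜ)ᶜ.indicator (h i) y + δ i * (g i y + h i y)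
  have hGm : ∀ i, Measurable (G i) := fun i =>
    (((hgm i).indicator (hS i)).add ((hhm i).indicator (hS i).compl)).add
      (((hgm i).add (hhm i)).const_mul _)
  have hHm : ∀ i, Measurable (H i) := fun i =>
    (((hgm i).indicator (hS i).compl).add ((hhm i).indicator (hS i).compl.compl)).add
      (((hgm i).add (hhm i)).const_mul _)
  have h1 := tv_le_of_seq (u := fun y => min (u y) (w y)) (fun i => (hv i).inf (hz i))
    (hvu.comp₂ hΩ hzw hu hv (F := min) fun a b c d =>
      (abs_min_sub_min_le_max a b c d).trans (max_le_add_of_nonneg (abs_nonneg _) (abs_nonneg _)))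
    hGm fun i => isUpperGradientOn_of_touch (hδ i) hΩ (hv i) (hz i) (hg i) (hh i)
      ((hv i).inf (hz i)) (fun y hy hyS => min_eq_left hyS.2.le)
      (fun y hy hyS => min_eq_right (not_lt.1 fun hlt => hyS ⟨hy, hlt⟩))
      (Or.inl ⟨fun y => min_le_left _ _, fun y => min_le_right _ _⟩)
  have h2 := tv_le_of_seq (u := fun y => max (u y) (w y)) (fun i => (hv i).sup (hz i))
    (hvu.comp₂ hΩ hzw hu hv (F := max) fun a b c d =>
      (abs_max_sub_max_le_max a b c d).trans (max_le_add_of_nonneg (abs_nonneg _) (abs_nonneg _)))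
    hHm fun i => isUpperGradientOn_of_touch (hδ i) hΩ (hv i) (hz i) (hg i) (hh i)
      ((hv i).sup (hz i))
      (fun y hy hyS => max_eq_left (not_lt.1 fun hlt => hyS ⟨hy, hlt⟩))
      (fun y hy hyS => max_eq_right (by simpa using (not_not.1 hyS).2.le))
      (Or.inr ⟨fun y => le_max_left _ _, fun y => le_max_right _ _⟩)
  refine (add_le_add h1 h2).trans ?_
  have h3 := sum_liminf_le Finset.univ (fun (b : Bool) i =>
    cond b (∫⁻ x in Ω, G i x ∂μ) (∫⁻ x in Ω, H i x ∂μ))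
  simp only [Fintype.univ_bool, Finset.mem_singleton, Bool.true_eq_false, not_false_eq_true,
    Finset.sum_insert, Finset.sum_singleton, cond_true, cond_false] at h3
  refine h3.trans ?_
  have h4 : ∀ i, (∫⁻ x in Ω, G i x ∂μ) + ∫⁻ x in Ω, H i x ∂μ ≤ (1 + 2 * δ i) * c := by
    intro i
    rw [← lintegral_add_left (hGm i)]
    have : ∀ x, G i x + H i x = (1 + 2 * δ i) * (g i x + h i x) := by
      intro x
      by_cases hx : x ∈ S i
      · simp [G, H, hx]; ring
      · simp [G, H, hx]; ring
    simp only [this]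
    rw [lintegral_const_mul _ (by exact (hgm i).add (hhm i)), lintegral_add_left (hgm i)]
    gcongr
    exact add_le_add (hgi i).le (hhi i).le
  refine (liminf_le_liminf (Eventually.of_forall h4)).trans ?_
  have hδ0 : Tendsto (fun i => (δ i : ℝ≥0∞)) atTop (𝓝 0) := by
    rw [← ENNReal.coe_zero, ENNReal.tendsto_coe, ← NNReal.tendsto_coe]
    have := tendsto_one_div_add_atTop_nhds_zero_nat (𝕜 := ℝ)
    simpa [δ] using this
  have h5 : Tendsto (fun i => (1 + 2 * (δ i : ℝ≥0∞)) * c) atTop (𝓝 ((1 + 2 * 0) * c)) :=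
    ENNReal.Tendsto.mul_const (tendsto_const_nhds.add
      (ENNReal.Tendsto.const_mul hδ0 (Or.inr (by simp)))) (Or.inr hcfin)
  rw [h5.liminf_eq]
  simp

/-! ### Gluing -/

/-- The cutoff equal to `1` where `ρ ≤ a` and to `0` where `b ≤ ρ`. -/
def cutoff (ρ : X → ℝ) (a b : ℝ) (y : X) : ℝ := max 0 (min 1 ((b - ρ y) / (b - a)))

theorem cutoff_nonneg (ρ : X → ℝ) (a b : ℝ) (y : X) : 0 ≤ cutoff ρ a b y := le_max_left _ _

theorem cutoff_le_one (ρ : X → ℝ) (a b : ℝ) (y : X) : cutoff ρ a b y ≤ 1 :=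
  max_le zero_le_one (min_le_left _ _)

theorem cutoff_eq_one {ρ : X → ℝ} {a b : ℝ} (hab : a < b) {y : X} (h : ρ y ≤ a) :
    cutoff ρ a b y = 1 := by
  have : 1 ≤ (b - ρ y) / (b - a) := by rw [one_le_div (by linarith)]; linarith
  rw [cutoff, min_eq_left this]; simp

theorem cutoff_eq_zero {ρ : X → ℝ} {a b : ℝ} (hab : a < b) {y : X} (h : b ≤ ρ y) :
    cutoff ρ a b y = 0 := by
  have : (b - ρ y) / (b - a) ≤ 0 := div_nonpos_of_nonpos_of_nonneg (by linarith) (by linarith)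
  rw [cutoff, max_eq_left ((min_le_right _ _).trans this)]

theorem abs_cutoff_sub_le {ρ : X → ℝ} (hρ : LipschitzWith 1 ρ) {a b : ℝ} (hab : a < b) (y z : X) :
    |cutoff ρ a b y - cutoff ρ a b z| ≤ 1 / (b - a) * dist y z := by
  have hba : 0 < b - a := by linarith
  have h1 : |ρ z - ρ y| ≤ dist y z := by
    have := hρ.dist_le_mul z y
    rw [Real.dist_eq, NNReal.coe_one, one_mul, dist_comm] at this
    exact this
  have h2 : |max 0 (min 1 ((b - ρ y) / (b - a))) - max 0 (min 1 ((b - ρ z) / (b - a)))| ≤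
      |(b - ρ y) / (b - a) - (b - ρ z) / (b - a)| := by
    refine (abs_max_sub_max_le_max _ _ _ _).trans (max_le (by simp) ?_)
    exact (abs_min_sub_min_le_max _ _ _ _).trans (max_le (by simp) le_rfl)
  refine h2.trans ?_
  rw [← sub_div, abs_div, abs_of_pos hba, show b - ρ y - (b - ρ z) = ρ z - ρ y by ring,
    one_div, inv_mul_eq_div]
  gcongr

theorem cutoff_locLipschitzOn {ρ : X → ℝ} (hρ : LipschitzWith 1 ρ) {a b : ℝ} (hab : a < b)
    (Ω : Set X) : LocLipschitzOn (cutoff ρ a b) Ω :=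
  LipschitzWith.locLipschitzOn (L := (1 / (b - a)).toNNReal)
    (LipschitzWith.of_dist_le_mul fun y z => by
      rw [Real.dist_eq, Real.coe_toNNReal _ (by have : 0 < b - a := by linarith
                                                positivity)]
      exact abs_cutoff_sub_le hρ hab y z) Ω

/-- Interpolating with a cutoff function between two functions. -/
def glue (ρ : X → ℝ) (a b : ℝ) (u₁ u₂ : X → ℝ) (y : X) : ℝ :=
  cutoff ρ a b y * u₁ y + (1 - cutoff ρ a b y) * u₂ y

theorem glue_of_le {ρ : X → ℝ} {a b : ℝ} (hab : a < b) {u₁ u₂ : X → ℝ} {y : X} (h : ρ y ≤ a) :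
    glue ρ a b u₁ u₂ y = u₁ y := by simp [glue, cutoff_eq_one hab h]

theorem glue_of_ge {ρ : X → ℝ} {a b : ℝ} (hab : a < b) {u₁ u₂ : X → ℝ} {y : X} (h : b ≤ ρ y) :
    glue ρ a b u₁ u₂ y = u₂ y := by simp [glue, cutoff_eq_zero hab h]

theorem glue_self (ρ : X → ℝ) (a b : ℝ) (u : X → ℝ) (y : X) : glue ρ a b u u y = u y := by
  simp only [glue]; ring

theorem glue_locLipschitzOn [ProperSpace X] {ρ : X → ℝ} (hρ : LipschitzWith 1 ρ)
    {a' a b b' : ℝ} (ha : a' < a) (hab : a < b) (hb : b < b') {v₁ v₂ : X → ℝ}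
    (h1 : LocLipschitzOn v₁ {y | ρ y < b'}) (h2 : LocLipschitzOn v₂ {y | a' < ρ y}) :
    LocLipschitzOn (glue ρ a b v₁ v₂) univ := by
  have hc := hρ.continuous
  refine locLipschitzOn_of_local fun y _ => ?_
  rcases lt_or_ge (ρ y) a with hy | hy
  · exact ⟨{y | ρ y < a}, isOpen_lt hc continuous_const, hy,
      (h1.mono fun z (hz : ρ z < a) => show ρ z < b' by linarith).congr
        fun z (hz : ρ z < a) => glue_of_le hab hz.le⟩
  rcases lt_or_ge b (ρ y) with hy' | hy'
  · exact ⟨{y | b < ρ y}, isOpen_lt continuous_const hc, hy',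
      (h2.mono fun z (hz : b < ρ z) => show a' < ρ z by linarith).congr
        fun z (hz : b < ρ z) => glue_of_ge hab hz.le⟩
  refine ⟨{y | a' < ρ y} ∩ {y | ρ y < b'}, (isOpen_lt continuous_const hc).inter
    (isOpen_lt hc continuous_const), ⟨by simpa using ha.trans_le hy, by simpa using hy'.trans_lt hb⟩,
    ?_⟩
  have hη := cutoff_locLipschitzOn hρ hab ({y | a' < ρ y} ∩ {y | ρ y < b'})
  refine ((hη.mul (h1.mono inter_subset_right)).add
    (((locLipschitzOn_const 1 _).add ((locLipschitzOn_const (-1) _).mul hη)).mul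
      (h2.mono inter_subset_left))).congr fun z _ => ?_
  simp only [glue]; ring

theorem glue_isUpperGradientOn [ProperSpace X] {ρ : X → ℝ} (hρ : LipschitzWith 1 ρ)
    {a' a b b' : ℝ} (ha : a' < a) (hab : a < b) (hb : b < b') {v₁ v₂ : X → ℝ} {g₁ g₂ : X → ℝ≥0∞}
    (h1 : LocLipschitzOn v₁ {y | ρ y < b'}) (h2 : LocLipschitzOn v₂ {y | a' < ρ y})
    (hg1 : IsUpperGradientOn g₁ v₁ {y | ρ y < b'}) (hg2 : IsUpperGradientOn g₂ v₂ {y | a' < ρ y}) :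
    IsUpperGradientOn (fun y => ({y | ρ y < b'}.indicator g₁ y + {y | a' < ρ y}.indicator g₂ y) +
      {y | a ≤ ρ y ∧ ρ y ≤ b}.indicator
        (fun y => ENNReal.ofReal (1 / (b - a)) * ENNReal.ofReal |v₁ y - v₂ y|) y)
      (glue ρ a b v₁ v₂) univ := by
  intro γ hγ
  have hc := hρ.continuous
  set G : X → ℝ≥0∞ := fun y => ({y | ρ y < b'}.indicator g₁ y + {y | a' < ρ y}.indicator g₂ y) +
      {y | a ≤ ρ y ∧ ρ y ≤ b}.indicator
        (fun y => ENNReal.ofReal (1 / (b - a)) * ENNReal.ofReal |v₁ y - v₂ y|) y with hG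
  rcases eq_or_ne (curveIntegral G γ) ⊤ with htop | htop
  · rw [htop]; exact le_top
  have hL : 0 ≤ 1 / (b - a) := by have : 0 < b - a := by linarith
                                  positivity
  have hd1 := hg1.ae_deriv_le h1 (isOpen_lt hc continuous_const) γ
    (ne_top_of_le_ne_top htop (curveIntegral_mono (fun y => le_self_add.trans le_self_add) γ))
  have hd2 := hg2.ae_deriv_le h2 (isOpen_lt continuous_const hc) γ
    (ne_top_of_le_ne_top htop (curveIntegral_mono (fun y => le_add_self.trans le_self_add) γ))
  have hηd : ∀ᵐ t, t ∈ Icc (0 : ℝ) 1 →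
      DifferentiableWithinAt ℝ (fun s => cutoff ρ a b (γ.toFun s)) (Icc 0 1) t := by
    obtain ⟨K, hK⟩ := γ.lipschitz
    obtain ⟨L, hL⟩ := cutoff_locLipschitzOn hρ hab univ _ γ.isCompact_image (subset_univ _)
    exact (hL.comp hK (mapsTo_image _ _)).ae_differentiableWithinAt_of_mem_real
  refine increment_le_of_ae_deriv_le γ hγ (glue_locLipschitzOn hρ ha hab hb h1 h2) ?_
  filter_upwards [hd1, hd2, hηd] with t e1 e2 e3 ht hd
  have hct : ContinuousAt γ.toFun t := γ.continuousOn.continuousAt (Icc_mem_nhds ht.1 ht.2)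
  rcases lt_or_ge (ρ (γ.toFun t)) a with hy | hy
  · have hev : ∀ᶠ s in 𝓝 t, glue ρ a b v₁ v₂ (γ.toFun s) = v₁ (γ.toFun s) :=
      (hct.eventually ((isOpen_lt hc continuous_const).mem_nhds hy)).mono
        fun s (hs : ρ (γ.toFun s) < a) => glue_of_le hab hs.le
    have hmem : ρ (γ.toFun t) < b' := by linarith
    rw [EventuallyEq.deriv_eq hev]
    refine (e1 ht hmem).2.trans ?_
    gcongr
    simp only [hG]
    rw [indicator_of_mem (show γ.toFun t ∈ {y | ρ y < b'} from hmem), add_assoc]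
    exact le_self_add
  rcases lt_or_ge b (ρ (γ.toFun t)) with hy' | hy'
  · have hev : ∀ᶠ s in 𝓝 t, glue ρ a b v₁ v₂ (γ.toFun s) = v₂ (γ.toFun s) :=
      (hct.eventually ((isOpen_lt continuous_const hc).mem_nhds hy')).mono
        fun s (hs : b < ρ (γ.toFun s)) => glue_of_ge hab hs.le
    have hmem : a' < ρ (γ.toFun t) := by linarith
    rw [EventuallyEq.deriv_eq hev]
    refine (e2 ht hmem).2.trans ?_
    gcongr
    simp only [hG]
    rw [indicator_of_mem (show γ.toFun t ∈ {y | a' < ρ y} from hmem), add_right_comm]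
    exact le_add_self
  have hm1 : γ.toFun t ∈ {y | ρ y < b'} := show ρ (γ.toFun t) < b' by linarith
  have hm2 : γ.toFun t ∈ {y | a' < ρ y} := show a' < ρ (γ.toFun t) by linarith
  have hm3 : γ.toFun t ∈ {y | a ≤ ρ y ∧ ρ y ≤ b} := ⟨hy, hy'⟩
  obtain ⟨hdv1, hb1⟩ := e1 ht hm1
  obtain ⟨hdv2, hb2⟩ := e2 ht hm2
  have hdη := (e3 (Ioo_subset_Icc_self ht)).differentiableAt (Icc_mem_nhds ht.1 ht.2)
  have hbη := deriv_comp_le_of_eventually hct (Eventually.of_forall fun y =>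
    abs_cutoff_sub_le hρ hab y (γ.toFun t)) hdη hL
  have hderiv : deriv (fun s => glue ρ a b v₁ v₂ (γ.toFun s)) t =
      deriv (fun s => cutoff ρ a b (γ.toFun s)) t * (v₁ (γ.toFun t) - v₂ (γ.toFun t)) +
      cutoff ρ a b (γ.toFun t) * deriv (fun s => v₁ (γ.toFun s)) t +
      (1 - cutoff ρ a b (γ.toFun t)) * deriv (fun s => v₂ (γ.toFun s)) t := by
    have := ((hdη.hasDerivAt.mul hdv1.hasDerivAt).add
      ((hdη.hasDerivAt.const_sub 1).mul hdv2.hasDerivAt)).deriv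
    refine Eq.trans ?_ (this.trans ?_)
    · rfl
    · ring
  rw [hderiv]
  set η := cutoff ρ a b (γ.toFun t)
  have hη0 : 0 ≤ η := cutoff_nonneg _ _ _ _
  have hη1 : η ≤ 1 := cutoff_le_one _ _ _ _
  set D0 := deriv (fun s => cutoff ρ a b (γ.toFun s)) t
  set D1 := deriv (fun s => v₁ (γ.toFun s)) t
  set D2 := deriv (fun s => v₂ (γ.toFun s)) t
  set w := v₁ (γ.toFun t) - v₂ (γ.toFun t) with hw
  have habs : |D0 * w + η * D1 + (1 - η) * D2| ≤ |D1| + |D2| + |D0| * |w| := by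
    have t1 : |η * D1| ≤ |D1| := by
      rw [abs_mul, abs_of_nonneg hη0]; exact mul_le_of_le_one_left (abs_nonneg _) hη1
    have t2 : |(1 - η) * D2| ≤ |D2| := by
      rw [abs_mul, abs_of_nonneg (by linarith)]
      exact mul_le_of_le_one_left (abs_nonneg _) (by linarith)
    have t3 := abs_add_three (D0 * w) (η * D1) ((1 - η) * D2)
    rw [abs_mul D0] at t3
    linarith
  refine (ENNReal.ofReal_le_ofReal habs).trans ?_
  rw [ENNReal.ofReal_add (by positivity) (by positivity),
    ENNReal.ofReal_add (by positivity) (by positivity), ENNReal.ofReal_mul (by positivity)]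
  simp only [hG]
  rw [indicator_of_mem hm1, indicator_of_mem hm2, indicator_of_mem hm3, add_mul, add_mul, ← hw]
  refine add_le_add (add_le_add hb1 hb2) ?_
  calc _ ≤ (ENNReal.ofReal (1 / (b - a)) * speed γ.toFun t) * ENNReal.ofReal |w| := by gcongr
    _ = _ := by ring

theorem tv_glue_le [ProperSpace X] [BorelSpace X] {μ : Measure X} {u₁ u₂ : X → ℝ}
    (hu₁ : AEMeasurable u₁ μ) (hu₂ : AEMeasurable u₂ μ) {ρ : X → ℝ} (hρ : LipschitzWith 1 ρ)
    {a' a b b' : ℝ} (ha : a' < a) (hab : a < b) (hb : b < b')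
    (hT : IsCompact {y | a ≤ ρ y ∧ ρ y ≤ b}) :
    tv μ (glue ρ a b u₁ u₂) univ ≤ tv μ u₁ {y | ρ y < b'} + tv μ u₂ {y | a' < ρ y} +
      ENNReal.ofReal (1 / (b - a)) *
        ∫⁻ y in {y | a ≤ ρ y ∧ ρ y ≤ b}, ENNReal.ofReal |u₁ y - u₂ y| ∂μ := by
  have hc := hρ.continuous
  set U := {y | ρ y < b'} with hU
  set V := {y | a' < ρ y} with hV
  set T := {y | a ≤ ρ y ∧ ρ y ≤ b} with hTdef
  have hUo : IsOpen U := isOpen_lt hc continuous_const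
  have hVo : IsOpen V := isOpen_lt continuous_const hc
  have hTU : T ⊆ U := fun y hy => show ρ y < b' by linarith [hy.2]
  have hTV : T ⊆ V := fun y hy => show a' < ρ y by linarith [hy.1]
  rcases eq_or_ne (tv μ u₁ U) ⊤ with h1 | h1
  · simp [h1]
  rcases eq_or_ne (tv μ u₂ V) ⊤ with h2 | h2
  · simp [h2]
  refine tv_le_of_approx isOpen_univ fun K hK _ => ⟨2 + 2 * (1 / (b - a)).toNNReal, fun ε hε => ?_⟩
  have hK1 : IsCompact ((K ∪ T) ∩ {y | ρ y ≤ b}) :=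
    (hK.union hT).inter_right (isClosed_le hc continuous_const)
  have hK2 : IsCompact ((K ∪ T) ∩ {y | a ≤ ρ y}) :=
    (hK.union hT).inter_right (isClosed_le continuous_const hc)
  have hK1U : (K ∪ T) ∩ {y | ρ y ≤ b} ⊆ U := fun y hy =>
    show ρ y < b' from lt_of_le_of_lt hy.2 hb
  have hK2V : (K ∪ T) ∩ {y | a ≤ ρ y} ⊆ V := fun y hy =>
    show a' < ρ y from lt_of_lt_of_le ha hy.2
  obtain ⟨v₁, g₁, hv₁, hg₁m, hg₁, hi₁, hI₁⟩ := exists_approx_of_tv_le le_rfl h1 hK1 hK1U hε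
  obtain ⟨v₂, g₂, hv₂, hg₂m, hg₂, hi₂, hI₂⟩ := exists_approx_of_tv_le le_rfl h2 hK2 hK2V hε
  refine ⟨_, _, glue_locLipschitzOn hρ ha hab hb hv₁ hv₂, ?_,
    glue_isUpperGradientOn hρ ha hab hb hv₁ hv₂ hg₁ hg₂, ?_, ?_⟩
  · have m1 := hv₁.measurable_indicator hUo hT.measurableSet hTU
    have m2 := hv₂.measurable_indicator hVo hT.measurableSet hTV
    refine ((hg₁m.indicator hUo.measurableSet).add (hg₂m.indicator hVo.measurableSet)).add ?_
    convert (measurable_const (a := ENNReal.ofReal (1 / (b - a)))).mul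
      ((m1.sub m2).abs.ennreal_ofReal) using 1
    ext y
    rw [← hTdef]
    by_cases hy : y ∈ T
    · simp only [Pi.mul_apply, Pi.sub_apply, indicator_of_mem hy]
    · simp only [Pi.mul_apply, Pi.sub_apply, indicator_of_notMem hy, sub_self, abs_zero, ENNReal.ofReal_zero,
        mul_zero]
  · have hm1 : AEMeasurable (((K ∪ T) ∩ {y | ρ y ≤ b}).indicator
        fun y => ENNReal.ofReal |v₁ y - u₁ y|) μ := by
      rw [aemeasurable_indicator_iff hK1.measurableSet]
      exact ((hv₁.aemeasurable hUo hK1.measurableSet hK1U).sub hu₁.restrict).abs.ennreal_ofReal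
    calc _ ≤ ∫⁻ y in K, (((K ∪ T) ∩ {y | ρ y ≤ b}).indicator
            (fun y => ENNReal.ofReal |v₁ y - u₁ y|) y + ((K ∪ T) ∩ {y | a ≤ ρ y}).indicator
            (fun y => ENNReal.ofReal |v₂ y - u₂ y|) y) ∂μ := by
          refine setLIntegral_mono' hK.measurableSet fun y hy => ?_
          rcases lt_or_ge (ρ y) a with hya | hya
          · rw [glue_of_le hab hya.le, glue_of_le hab hya.le, indicator_of_mem]
            · exact le_self_add
            · exact ⟨Or.inl hy, hya.le.trans hab.le⟩
          rcases lt_or_ge b (ρ y) with hyb | hyb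
          · rw [glue_of_ge hab hyb.le, glue_of_ge hab hyb.le, indicator_of_mem (s := _ ∩ {y | a ≤ ρ y})]
            · exact le_add_self
            · exact ⟨Or.inl hy, hya⟩
          rw [indicator_of_mem (show y ∈ _ ∩ {y | ρ y ≤ b} from ⟨Or.inl hy, hyb⟩),
            indicator_of_mem (show y ∈ _ ∩ {y | a ≤ ρ y} from ⟨Or.inl hy, hya⟩),
            ← ENNReal.ofReal_add (abs_nonneg _) (abs_nonneg _)]
          refine ENNReal.ofReal_le_ofReal ?_
          have hη0 := cutoff_nonneg ρ a b y
          have hη1 := cutoff_le_one ρ a b y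
          simp only [glue]
          calc _ = |cutoff ρ a b y * (v₁ y - u₁ y) + (1 - cutoff ρ a b y) * (v₂ y - u₂ y)| := by
                ring_nf
            _ ≤ |cutoff ρ a b y * (v₁ y - u₁ y)| + |(1 - cutoff ρ a b y) * (v₂ y - u₂ y)| :=
                abs_add_le _ _
            _ ≤ _ := by
                rw [abs_mul, abs_mul, abs_of_nonneg hη0, abs_of_nonneg (by linarith : 0 ≤ 1 - cutoff ρ a b y)]
                exact add_le_add (mul_le_of_le_one_left (abs_nonneg _) hη1)
                  (mul_le_of_le_one_left (abs_nonneg _) (by linarith))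
      _ ≤ ∫⁻ y, (((K ∪ T) ∩ {y | ρ y ≤ b}).indicator
            (fun y => ENNReal.ofReal |v₁ y - u₁ y|) y + ((K ∪ T) ∩ {y | a ≤ ρ y}).indicator
            (fun y => ENNReal.ofReal |v₂ y - u₂ y|) y) ∂μ := setLIntegral_le_lintegral _ _
      _ ≤ ε + ε := by
          rw [lintegral_add_left' hm1, lintegral_indicator hK1.measurableSet,
            lintegral_indicator hK2.measurableSet]
          exact add_le_add hi₁ hi₂
      _ ≤ _ := by
          rw [← two_mul]
          gcongr
          push_cast
          exact le_self_add
  · have hm1 : AEMeasurable (fun y => ENNReal.ofReal |v₁ y - u₁ y|) (μ.restrict T) :=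
      ((hv₁.aemeasurable hUo hT.measurableSet hTU).sub hu₁.restrict).abs.ennreal_ofReal
    have hm2 : AEMeasurable (fun y => ENNReal.ofReal |v₂ y - u₂ y|) (μ.restrict T) :=
      ((hv₂.aemeasurable hVo hT.measurableSet hTV).sub hu₂.restrict).abs.ennreal_ofReal
    have hTi : ∫⁻ y in T, ENNReal.ofReal |v₁ y - v₂ y| ∂μ ≤
        ε + ε + ∫⁻ y in T, ENNReal.ofReal |u₁ y - u₂ y| ∂μ := by
      calc _ ≤ ∫⁻ y in T, (ENNReal.ofReal |v₁ y - u₁ y| + ENNReal.ofReal |v₂ y - u₂ y| +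
            ENNReal.ofReal |u₁ y - u₂ y|) ∂μ := by
            refine lintegral_mono fun y => ?_
            rw [← ENNReal.ofReal_add (by positivity) (by positivity),
              ← ENNReal.ofReal_add (by positivity) (by positivity)]
            refine ENNReal.ofReal_le_ofReal ?_
            have := abs_add_three (v₁ y - u₁ y) (-(v₂ y - u₂ y)) (u₁ y - u₂ y)
            rw [abs_neg] at this
            refine le_trans (le_of_eq ?_) this
            ring_nf
        _ ≤ _ := by
            rw [lintegral_add_left' (by exact hm1.add hm2), lintegral_add_left' hm1]
            have hs1 : T ⊆ (K ∪ T) ∩ {y | ρ y ≤ b} := fun y hy => ⟨Or.inr hy, hy.2⟩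
            have hs2 : T ⊆ (K ∪ T) ∩ {y | a ≤ ρ y} := fun y hy => ⟨Or.inr hy, hy.1⟩
            exact add_le_add (add_le_add ((lintegral_mono_set hs1).trans hi₁)
              ((lintegral_mono_set hs2).trans hi₂)) le_rfl
    have hm3 : Measurable fun y => {y | ρ y < b'}.indicator g₁ y + {y | a' < ρ y}.indicator g₂ y :=
      (hg₁m.indicator hUo.measurableSet).add (hg₂m.indicator hVo.measurableSet)
    rw [Measure.restrict_univ, lintegral_add_left hm3,
      lintegral_add_left (hg₁m.indicator hUo.measurableSet),
      lintegral_indicator hUo.measurableSet, lintegral_indicator hVo.measurableSet,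
      lintegral_indicator hT.measurableSet, lintegral_const_mul' _ _ ENNReal.ofReal_ne_top]
    calc _ ≤ (tv μ u₁ U + ε) + (tv μ u₂ V + ε) + ENNReal.ofReal (1 / (b - a)) *
          (ε + ε + ∫⁻ y in T, ENNReal.ofReal |u₁ y - u₂ y| ∂μ) := by gcongr
      _ = _ := by
          push_cast
          rw [← ENNReal.ofReal]
          ring

section Doubling

variable [BorelSpace X] {μ : Measure X} {Cd CP lam : ℝ}

theorem MMS.ball_pos (hX : MMS μ Cd CP lam) (x : X) {r : ℝ} (hr : 0 < r) :
    0 < μ (ball x r) := by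
  have := (hX.doubling x (r / 2) (by linarith)).1
  rwa [show 2 * (r / 2) = r by ring] at this

theorem MMS.ball_lt_top (hX : MMS μ Cd CP lam) (x : X) (r : ℝ) : μ (ball x r) < ⊤ := by
  rcases le_or_gt r 0 with hr | hr
  · simp [ball_eq_empty.2 hr]
  · exact (hX.doubling x r hr).2.2

theorem MMS.ball_two_pow_le (hX : MMS μ Cd CP lam) (x : X) {r : ℝ} (hr : 0 < r) (n : ℕ) :
    μ (ball x (2 ^ n * r)) ≤ ENNReal.ofReal Cd ^ n * μ (ball x r) := by
  induction n with
  | zero => simp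
  | succ n ih =>
    calc μ (ball x (2 ^ (n + 1) * r)) = μ (ball x (2 * (2 ^ n * r))) := by ring_nf
      _ ≤ ENNReal.ofReal Cd * μ (ball x (2 ^ n * r)) := (hX.doubling x _ (by positivity)).2.1
      _ ≤ ENNReal.ofReal Cd * (ENNReal.ofReal Cd ^ n * μ (ball x r)) := by gcongr
      _ = _ := by ring

theorem MMS.ball_le_of_dist (hX : MMS μ Cd CP lam) {x y : X} {R r : ℝ} (hr : 0 < r) {n : ℕ}
    (h : R + dist x y ≤ 2 ^ n * r) :
    μ (ball x R) ≤ ENNReal.ofReal Cd ^ n * μ (ball y r) :=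
  (measure_mono (ball_subset_ball' h)).trans (hX.ball_two_pow_le y hr n)

theorem MMS.card_le_of_separated (hX : MMS μ Cd CP lam) {x : X} {R ρ : ℝ} (hR : 0 < R)
    (hρ : 0 < ρ) {n : ℕ} (hn : 4 * R + 2 * ρ ≤ 2 ^ n * ρ) {s : Finset X}
    (hs : ∀ y ∈ s, y ∈ ball x R) (hsep : (s : Set X).Pairwise fun y z => ρ < dist y z) :
    (s.card : ℝ) ≤ Cd ^ n := by
  have hdisj : (s : Set X).PairwiseDisjoint fun y => ball y (ρ / 2) := fun y hy z hz hyz =>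
    ball_disjoint_ball (by linarith [hsep hy hz hyz])
  have hpos := hX.ball_pos x (r := R + ρ) (by linarith)
  have hfin := hX.ball_lt_top x (R + ρ)
  have h1 : (s.card : ℝ≥0∞) * μ (ball x (R + ρ)) ≤ ENNReal.ofReal Cd ^ n * μ (ball x (R + ρ)) := by
    calc (s.card : ℝ≥0∞) * μ (ball x (R + ρ)) = ∑ _y ∈ s, μ (ball x (R + ρ)) := by simp
      _ ≤ ∑ y ∈ s, ENNReal.ofReal Cd ^ n * μ (ball y (ρ / 2)) := by
          refine Finset.sum_le_sum fun y hy => hX.ball_le_of_dist (by linarith) ?_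
          have := mem_ball'.1 (hs y hy)
          linarith
      _ = ENNReal.ofReal Cd ^ n * μ (⋃ y ∈ s, ball y (ρ / 2)) := by
          rw [← Finset.mul_sum, measure_biUnion_finset hdisj fun _ _ => measurableSet_ball]
      _ ≤ _ := by
          gcongr
          refine iUnion₂_subset fun y hy => ball_subset_ball' ?_
          have := mem_ball.1 (hs y hy)
          linarith
  have h2 := (ENNReal.mul_le_mul_iff_left hpos.ne' hfin.ne).1 h1
  rw [← ENNReal.ofReal_pow (by linarith [hX.hCd]), ← ENNReal.ofReal_natCast] at h2
  exact (ENNReal.ofReal_le_ofReal_iff (pow_nonneg (by linarith [hX.hCd]) _)).1 h2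

theorem MMS.exists_net (hX : MMS μ Cd CP lam) (x : X) {R ρ : ℝ} (hR : 0 < R) (hρ : 0 < ρ) :
    ∃ s : Finset X, (∀ y ∈ s, y ∈ ball x R) ∧
      ((s : Set X).Pairwise fun y z => ρ < dist y z) ∧ ∀ y ∈ ball x R, ∃ z ∈ s, dist y z ≤ ρ := by
  classical
  obtain ⟨n, hn⟩ := pow_unbounded_of_one_lt ((4 * R + 2 * ρ) / ρ) (one_lt_two (α := ℝ))
  obtain ⟨N, hN⟩ := exists_nat_ge (Cd ^ n)
  let P : ℕ → Prop := fun k => ∃ s : Finset X, (∀ y ∈ s, y ∈ ball x R) ∧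
      ((s : Set X).Pairwise fun y z => ρ < dist y z) ∧ s.card = k
  have h0 : P 0 := ⟨∅, by simp, by simp, rfl⟩
  have hle : ∀ k, P k → k ≤ N := by
    rintro k ⟨s, h1, h2, rfl⟩
    exact_mod_cast (hX.card_le_of_separated hR hρ ((div_le_iff₀ hρ).1 hn.le) h1 h2).trans hN
  obtain ⟨s, h1, h2, h3⟩ : P (Nat.findGreatest P N) := Nat.findGreatest_spec (Nat.zero_le _) h0
  refine ⟨s, h1, h2, fun y hy => ?_⟩
  by_contra! hcon
  have hys : y ∉ s := fun h => by simpa using (hcon y h).trans' hρ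
  have hP : P (s.card + 1) := by
    refine ⟨insert y s, ?_, ?_, Finset.card_insert_of_notMem hys⟩
    · intro z hz
      rcases Finset.mem_insert.1 hz with rfl | hz
      exacts [hy, h1 z hz]
    · rw [Finset.coe_insert, Set.pairwise_insert]
      exact ⟨h2, fun z hz _ => ⟨hcon z hz, by rw [dist_comm]; exact hcon z hz⟩⟩
  have := Nat.le_findGreatest (hle _ hP) hP
  omega

theorem MMS.properSpace (hX : MMS μ Cd CP lam) : ProperSpace X := by
  have := hX.complete
  refine ⟨fun x r => isCompact_iff_totallyBounded_isComplete.2 ⟨?_, isClosed_closedBall.isComplete⟩⟩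
  refine TotallyBounded.subset (closedBall_subset_ball (lt_add_one r)) ?_
  rcases le_or_gt (r + 1) 0 with hr | hr
  · simp [ball_eq_empty.2 hr]
  rw [Metric.totallyBounded_iff]
  intro ε hε
  obtain ⟨s, -, -, hs⟩ := hX.exists_net x hr (half_pos hε)
  refine ⟨s, s.finite_toSet, fun y hy => ?_⟩
  obtain ⟨z, hz, hyz⟩ := hs y hy
  exact mem_iUnion₂.2 ⟨z, hz, mem_ball.2 (by linarith)⟩

theorem MMS.isFiniteMeasureOnCompacts (hX : MMS μ Cd CP lam) : IsFiniteMeasureOnCompacts μ := by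
  refine ⟨fun K hK => ?_⟩
  obtain ⟨x⟩ := hX.nontrivial.to_nonempty
  obtain ⟨r, hr⟩ := hK.isBounded.subset_ball x
  exact (measure_mono hr).trans_lt (hX.ball_lt_top x r)

theorem MMS.sum_indicator_ball_le (hX : MMS μ Cd CP lam) {ρ k : ℝ} (hk : 0 < k) (hρ : 0 < ρ)
    {n : ℕ} (hn : 4 * k + 2 ≤ 2 ^ n) {N : ℕ} (hN : Cd ^ n ≤ N) {s : Finset X}
    (hsep : (s : Set X).Pairwise fun y z => ρ < dist y z) (y : X) :
    ∑ z ∈ s, (ball z (k * ρ)).indicator (fun _ => (1 : ℝ≥0∞)) y ≤ N := by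
  classical
  have h1 : ∑ z ∈ s, (ball z (k * ρ)).indicator (fun _ => (1 : ℝ≥0∞)) y =
      ((s.filter fun z => y ∈ ball z (k * ρ)).card : ℝ≥0∞) := by
    simp [indicator_apply]
  rw [h1]
  have h2 := hX.card_le_of_separated (x := y) (R := k * ρ) (by positivity) hρ (n := n)
    (by nlinarith) (s := s.filter fun z => y ∈ ball z (k * ρ))
    (fun z hz => mem_ball_comm.1 (Finset.mem_filter.1 hz).2)
    (hsep.mono fun z hz => (Finset.mem_filter.1 hz).1)
  exact_mod_cast h2.trans hN

theorem MMS.exists_mem_annulus (hX : MMS μ Cd CP lam) {x z : X} {a b : ℝ} (ha : 0 < a)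
    (hab : a < b) (hz : z ∉ ball x b) : ∃ y, a ≤ dist y x ∧ dist y x < b := by
  by_contra! hcon
  have := hX.properSpace
  have := hX.isFiniteMeasureOnCompacts
  have hsub : ∀ y, dist y x < b → dist y x < a := fun y hy => by
    by_contra! h
    exact absurd hy (not_lt.2 (hcon y h))
  set u : X → ℝ := (ball x a).indicator fun _ => 1 with hu
  have hug : IsUpperGradientOn (fun _ => 0) u univ := by
    intro γ _
    have hpre : IsPreconnected (γ.toFun '' Icc 0 1) := isPreconnected_Icc.image _ γ.continuousOn
    have hop : IsOpen {y | (a + b) / 2 < dist y x} := isOpen_lt continuous_const (by fun_prop)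
    have hcov : γ.toFun '' Icc 0 1 ⊆ ball x a ∪ {y | (a + b) / 2 < dist y x} := by
      intro y _
      rcases lt_or_ge (dist y x) a with h | h
      · exact Or.inl h
      · exact Or.inr (show (a + b) / 2 < dist y x by linarith [hcon y h])
    have hdj : Disjoint (ball x a) {y | (a + b) / 2 < dist y x} :=
      Set.disjoint_left.2 fun y hy hy' => by
        have h1 : dist y x < a := hy
        have h2 : (a + b) / 2 < dist y x := hy'
        linarith
    have m0 : γ.toFun 0 ∈ γ.toFun '' Icc 0 1 := ⟨0, by simp, rfl⟩
    have m1 : γ.toFun 1 ∈ γ.toFun '' Icc 0 1 := ⟨1, by simp, rfl⟩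
    have : u (γ.toFun 1) = u (γ.toFun 0) := by
      rcases hpre.subset_or_subset isOpen_ball hop hdj hcov with h | h
      · rw [hu, indicator_of_mem (h m0), indicator_of_mem (h m1)]
      · rw [hu, indicator_of_notMem fun h' => Set.disjoint_left.1 hdj h' (h m0),
          indicator_of_notMem fun h' => Set.disjoint_left.1 hdj h' (h m1)]
    simp [this]
  have hum : Measurable u := measurable_const.indicator measurableSet_ball
  have hul : LocallyIntegrable u μ := by
    refine Integrable.locallyIntegrable ?_
    rw [hu, integrable_indicator_iff measurableSet_ball]
    exact integrableOn_const (hX.ball_lt_top x a).ne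
  have hP := hX.poincare x (dist z x + 1) (by positivity) u hul _ measurable_const hug
  simp only [lintegral_zero, mul_zero, nonpos_iff_eq_zero] at hP
  set c := ⨍ z in ball x (dist z x + 1), u z ∂μ
  rw [lintegral_eq_zero_iff (by fun_prop)] at hP
  have hzb : b ≤ dist z x := not_lt.1 hz
  have key : ∀ S : Set X, S ⊆ ball x (dist z x + 1) → MeasurableSet S → μ S ≠ 0 → ∀ d : ℝ,
      (∀ y ∈ S, u y = d) → d = c := by
    intro S hS hSm hS0 d hd
    by_contra hne
    refine hS0 ?_
    have h1 := ae_restrict_of_ae_restrict_of_subset hS hP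
    replace h1 := (ae_restrict_iff' hSm).1 h1
    refine measure_mono_null (fun y hy => ?_) h1
    simp only [mem_compl_iff, mem_ofPred_eq, not_forall]
    refine ⟨hy, ?_⟩
    simpa [hd y hy, sub_eq_zero] using hne
  have k1 := key (ball x a) (ball_subset_ball (by linarith)) measurableSet_ball
    (hX.ball_pos x ha).ne' 1 fun y hy => by rw [hu, indicator_of_mem hy]
  have k2 := key (ball z (min 1 (b - a))) (ball_subset_ball' (by
      have := min_le_left 1 (b - a); linarith)) measurableSet_ball
    (hX.ball_pos z (lt_min one_pos (by linarith))).ne' 0 fun y hy => by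
      rw [hu, indicator_of_notMem]
      intro hy'
      have h1 := (mem_ball.1 hy).trans_le (min_le_right _ _)
      have h2 := mem_ball.1 hy'
      have := dist_triangle_left z x y
      linarith
  linarith

end Doubling

section Poincare

/-- A function with an upper gradient on `Ω`, cut off outside a closed set `F ⊆ Ω`, has the upper
gradient that is infinite outside `F`. -/
theorem IsUpperGradientOn.indicator_of_isClosed {g : X → ℝ≥0∞} {v : X → ℝ} {Ω F : Set X}
    (h : IsUpperGradientOn g v Ω) (hF : IsClosed F) (hFΩ : F ⊆ Ω) :
    IsUpperGradientOn (fun y => F.indicator g y + Fᶜ.indicator (fun _ => ⊤) y) (F.indicator v)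
      univ := by
  classical
  rcases F.eq_empty_or_nonempty with rfl | hne
  · intro γ _; simp
  intro γ _
  set G : X → ℝ≥0∞ := fun y => F.indicator g y + Fᶜ.indicator (fun _ => ⊤) y with hG
  by_cases hfin : curveIntegral G γ = ⊤
  · rw [hfin]; exact le_top
  set H : X → ℝ≥0∞ := Fᶜ.indicator fun _ => 1 with hH
  have hρ : LipschitzWith 1 fun y => infDist y F := lipschitz_infDist_pt F
  have hHug : IsUpperGradientOn H (fun y => infDist y F) univ := by
    intro γ hγ
    refine increment_le_of_ae_deriv_le γ hγ (LipschitzWith.locLipschitzOn hρ _) (ae_of_all _ fun t ht hd => ?_)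
    have hct : ContinuousAt γ.toFun t :=
      γ.continuousOn.continuousAt (Icc_mem_nhds ht.1 ht.2)
    by_cases hy : γ.toFun t ∈ F
    · have hmin : IsLocalMin (fun s => infDist (γ.toFun s) F) t := by
        refine Eventually.of_forall fun s => ?_
        simp only [infDist_zero_of_mem hy]
        exact infDist_nonneg
      rw [hmin.deriv_eq_zero]
      simp
    · have := deriv_comp_le_of_eventually (w := fun y => infDist y F) (c := 1) hct
        (Eventually.of_forall fun y => by
          simpa [Real.dist_eq] using hρ.dist_le_mul y (γ.toFun t)) hd zero_le_one
      simpa [hH, indicator_of_mem (show γ.toFun t ∈ Fᶜ from hy)] using this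
  have hH0 : curveIntegral H γ = 0 := by
    by_contra hne
    refine hfin (ENNReal.eq_top_of_forall_nnreal_le fun n => ?_)
    have : ∀ n : ℝ≥0, n * curveIntegral H γ ≤ curveIntegral G γ := by
      intro n
      rw [curveIntegral, ← lintegral_const_mul' _ _ ENNReal.coe_ne_top]
      refine lintegral_mono fun t => ?_
      rw [← mul_assoc]
      gcongr
      by_cases hy : γ.toFun t ∈ F <;> simp [hG, hH, hy]
    rcases eq_or_ne (curveIntegral H γ) ⊤ with ht | ht
    · have := this 1
      rw [ht] at this
      exact le_top.trans (by simpa using this)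
    · have := this (n / (curveIntegral H γ).toNNReal)
      refine le_trans (le_of_eq ?_) this
      have h0 : (curveIntegral H γ).toNNReal ≠ 0 := by
        rw [Ne, ENNReal.toNNReal_eq_zero_iff]; tauto
      rw [ENNReal.coe_div h0, ENNReal.coe_toNNReal ht, ENNReal.div_mul_cancel hne ht]
  have hconst : ∀ t ∈ Icc (0 : ℝ) 1, infDist (γ.toFun t) F = infDist (γ.toFun 0) F := by
    intro t ht
    have h1 := hHug.increment_le γ le_rfl le_rfl (fun _ _ => mem_univ _) le_rfl ht.1 ht.2
    have h2 : ∫⁻ s in Icc 0 t, H (γ.toFun s) * speed γ.toFun s ≤ 0 := by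
      rw [← hH0, curveIntegral]
      exact lintegral_mono_set (Icc_subset_Icc_right ht.2)
    have h3 := h1.trans h2
    simp only [nonpos_iff_eq_zero, ENNReal.ofReal_eq_zero] at h3
    have := abs_nonpos_iff.1 h3
    linarith
  have hmem : ∀ y, y ∈ F ↔ infDist y F = 0 := fun y => hF.mem_iff_infDist_zero hne
  by_cases h0 : γ.toFun 0 ∈ F
  · have hall : ∀ t ∈ Icc (0 : ℝ) 1, γ.toFun t ∈ F := fun t ht => by
      rw [hmem, hconst t ht, ← hmem]; exact h0
    rw [indicator_of_mem h0, indicator_of_mem (hall 1 (by simp))]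
    refine (h γ fun t ht => hFΩ (hall t ht)).trans ?_
    refine setLIntegral_mono' measurableSet_Icc fun t ht => ?_
    simp [hG, hall t ht]
  · have h1 : γ.toFun 1 ∉ F := fun h1 => h0 <| by
      rw [hmem, ← hconst 1 (by simp), ← hmem]; exact h1
    rw [indicator_of_notMem h0, indicator_of_notMem h1]
    simp

variable [BorelSpace X] {μ : Measure X} {Cd CP lam : ℝ}

theorem MMS.exists_lintegral_sub_le (hX : MMS μ Cd CP lam) {u : X → ℝ} (hu : AEMeasurable u μ)
    {y : X} {r : ℝ} (hr : 0 < r) {Ω : Set X} (hΩ : IsOpen Ω)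
    (hsub : closedBall y (lam * r) ⊆ Ω) (hfin : tv μ u Ω ≠ ⊤) {ε : ℝ≥0} (hε : 0 < ε) :
    ∃ c : ℝ, ∫⁻ z in ball y r, ENNReal.ofReal |u z - c| ∂μ ≤
      ε + ENNReal.ofReal (CP * r) * (tv μ u Ω + ε) := by
  have := hX.properSpace
  have := hX.isFiniteMeasureOnCompacts
  set F := closedBall y (lam * r) with hF
  have hFc : IsCompact F := isCompact_closedBall _ _
  have hBF : ball y r ⊆ F := ball_subset_closedBall.trans
    (closedBall_subset_closedBall (by nlinarith [hX.hlam]))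
  obtain ⟨v, g, hv, hgm, hg, hi, hI⟩ := exists_approx_of_tv_le le_rfl hfin hFc hsub hε
  have hvm : Measurable (F.indicator v) :=
    hv.measurable_indicator hΩ hFc.measurableSet hsub
  have hvi : LocallyIntegrable (F.indicator v) μ := by
    refine Integrable.locallyIntegrable ?_
    rw [integrable_indicator_iff hFc.measurableSet]
    exact ((hv.continuousOn hΩ).mono hsub).integrableOn_compact hFc
  have hGm : Measurable fun y => F.indicator g y + Fᶜ.indicator (fun _ => (⊤ : ℝ≥0∞)) y :=
    (hgm.indicator hFc.measurableSet).add (measurable_const.indicator hFc.measurableSet.compl)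
  have hP := hX.poincare y r hr _ hvi _ hGm (hg.indicator_of_isClosed hFc.isClosed hsub)
  set c := ⨍ z in ball y r, F.indicator v z ∂μ
  refine ⟨c, ?_⟩
  have hm : AEMeasurable (fun z => ENNReal.ofReal |v z - u z|) (μ.restrict (ball y r)) :=
    ((hv.aemeasurable hΩ measurableSet_ball (hBF.trans hsub)).sub hu.restrict).abs.ennreal_ofReal
  calc ∫⁻ z in ball y r, ENNReal.ofReal |u z - c| ∂μ
      ≤ ∫⁻ z in ball y r, (ENNReal.ofReal |v z - u z| + ENNReal.ofReal |F.indicator v z - c|) ∂μ := by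
        refine setLIntegral_mono' measurableSet_ball fun z hz => ?_
        rw [indicator_of_mem (hBF hz), ← ENNReal.ofReal_add (abs_nonneg _) (abs_nonneg _),
          abs_sub_comm (v z)]
        exact ENNReal.ofReal_le_ofReal (abs_sub_le _ _ _)
    _ = (∫⁻ z in ball y r, ENNReal.ofReal |v z - u z| ∂μ) +
          ∫⁻ z in ball y r, ENNReal.ofReal |F.indicator v z - c| ∂μ := lintegral_add_left' hm _
    _ ≤ ε + ENNReal.ofReal (CP * r) * (tv μ u Ω + ε) := by
        refine add_le_add ((lintegral_mono_set hBF).trans hi) (hP.trans ?_)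
        have h1 : μ (ball y r) / μ (ball y (lam * r)) ≤ 1 :=
          ENNReal.div_le_of_le_mul (by
            rw [one_mul]; exact measure_mono (ball_subset_ball (by nlinarith [hX.hlam])))
        have h2 : ∫⁻ z in ball y (lam * r),
            (F.indicator g z + Fᶜ.indicator (fun _ => (⊤ : ℝ≥0∞)) z) ∂μ ≤ ∫⁻ z in Ω, g z ∂μ := by
          refine le_trans (le_of_eq ?_) (lintegral_mono_set (ball_subset_closedBall.trans hsub))
          refine setLIntegral_congr_fun measurableSet_ball fun z hz => ?_
          have hz' : z ∈ F := ball_subset_closedBall hz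
          simp [hz']
        calc _ ≤ ENNReal.ofReal (CP * r) * 1 * ∫⁻ z in Ω, g z ∂μ := by gcongr
          _ ≤ _ := by rw [mul_one]; gcongr

/-- Poincaré inequality for BV functions vanishing on a large portion of a ball. -/
theorem MMS.lintegral_le_tv (hX : MMS μ Cd CP lam) {u : X → ℝ} (hu : AEMeasurable u μ)
    {y : X} {r : ℝ} (hr : 0 < r) {Ω : Set X} (hΩ : IsOpen Ω)
    (hsub : closedBall y (lam * r) ⊆ Ω) {Z : Set X} (hZm : MeasurableSet Z) (hZ : Z ⊆ ball y r)
    (hZu : ∀ z ∈ Z, u z = 0) {M : ℝ} (hM : 0 ≤ M)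
    (hMZ : μ (ball y r) ≤ ENNReal.ofReal M * μ Z) :
    ∫⁻ z in ball y r, ENNReal.ofReal |u z| ∂μ ≤
      ENNReal.ofReal ((1 + M) * (CP * r)) * tv μ u Ω := by
  have hCPr : 0 < CP * r := mul_pos hX.hCP hr
  rcases eq_or_ne (tv μ u Ω) ⊤ with ht | ht
  · rw [ht, ENNReal.mul_top]
    · exact le_top
    · simp only [ne_eq, ENNReal.ofReal_eq_zero, not_le]; positivity
  have key : ∀ ε : ℝ≥0, 0 < ε → ∫⁻ z in ball y r, ENNReal.ofReal |u z| ∂μ ≤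
      ENNReal.ofReal (1 + M) * (ε + ENNReal.ofReal (CP * r) * (tv μ u Ω + ε)) := by
    intro ε hε
    obtain ⟨c, hc⟩ := hX.exists_lintegral_sub_le hu hr hΩ hsub ht hε
    have hcZ : ENNReal.ofReal |c| * μ Z ≤ ∫⁻ z in ball y r, ENNReal.ofReal |u z - c| ∂μ := by
      calc _ = ∫⁻ _ in Z, ENNReal.ofReal |c| ∂μ := by simp
        _ = ∫⁻ z in Z, ENNReal.ofReal |u z - c| ∂μ :=
            setLIntegral_congr_fun hZm fun z hz => by simp [hZu z hz]
        _ ≤ _ := lintegral_mono_set hZ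
    calc _ ≤ ∫⁻ z in ball y r, (ENNReal.ofReal |u z - c| + ENNReal.ofReal |c|) ∂μ := by
          refine lintegral_mono fun z => ?_
          rw [← ENNReal.ofReal_add (abs_nonneg _) (abs_nonneg _)]
          refine ENNReal.ofReal_le_ofReal ?_
          have := abs_add_le (u z - c) c
          simpa using this
      _ = (∫⁻ z in ball y r, ENNReal.ofReal |u z - c| ∂μ) +
            ENNReal.ofReal |c| * μ (ball y r) := by
          rw [lintegral_add_right' _ (by fun_prop)]; simp
      _ ≤ (∫⁻ z in ball y r, ENNReal.ofReal |u z - c| ∂μ) + ENNReal.ofReal M *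
            ∫⁻ z in ball y r, ENNReal.ofReal |u z - c| ∂μ := by
          refine add_le_add le_rfl ?_
          calc _ ≤ ENNReal.ofReal |c| * (ENNReal.ofReal M * μ Z) := by gcongr
            _ = ENNReal.ofReal M * (ENNReal.ofReal |c| * μ Z) := by ring
            _ ≤ _ := by gcongr
      _ = ENNReal.ofReal (1 + M) * ∫⁻ z in ball y r, ENNReal.ofReal |u z - c| ∂μ := by
          rw [ENNReal.ofReal_add zero_le_one hM, ENNReal.ofReal_one]; ring
      _ ≤ _ := by gcongr
  set T := (tv μ u Ω).toNNReal with hT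
  have hTe : tv μ u Ω = T := (ENNReal.coe_toNNReal ht).symm
  rw [hTe] at key ⊢
  refine ge_of_tendsto (f := fun ε : ℝ≥0 => ENNReal.ofReal (1 + M) *
    (ε + ENNReal.ofReal (CP * r) * (T + ε) : ℝ≥0∞)) (x := 𝓝[>] 0) ?_
    (eventually_mem_nhdsWithin.mono fun ε hε => key ε hε)
  have hcont : Continuous fun ε : ℝ≥0 => (((1 + M).toNNReal * (ε + (CP * r).toNNReal * (T + ε)) :
      ℝ≥0) : ℝ≥0∞) := by fun_prop
  have h0 := (hcont.tendsto 0).mono_left (nhdsWithin_le_nhds (s := Ioi 0))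
  rw [ENNReal.ofReal_mul (by linarith : (0 : ℝ) ≤ 1 + M)]
  simp only [zero_add, add_zero] at h0
  push_cast at h0
  rwa [← mul_assoc] at h0

end Poincare

section Chain

/-- The cost of chains of steps shorter than `δ`, ending in `C`, with weight `c` at the starting
point of each step. -/
inductive ChainCost (c : X → ℝ) (C : Set X) (δ : ℝ) : X → ℝ → Prop
  | base {y : X} (hy : y ∈ C) : ChainCost c C δ y 0
  | step {y z : X} {a : ℝ} (hyz : dist y z < δ) (hz : ChainCost c C δ z a) :
      ChainCost c C δ y (c y * dist y z + a)

theorem ChainCost.nonneg {c : X → ℝ} {C : Set X} {δ : ℝ} (hc : ∀ y, 0 ≤ c y) {y : X} {a : ℝ}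
    (h : ChainCost c C δ y a) : 0 ≤ a := by
  induction h with
  | base _ => exact le_rfl
  | step _ _ ih => exact add_nonneg (mul_nonneg (hc _) dist_nonneg) ih

theorem ChainCost.exists_le {c c' : X → ℝ} {C : Set X} {δ δ' : ℝ} (hcc : ∀ y, c y ≤ c' y)
    (hδ : δ' ≤ δ) {y : X} {a : ℝ} (h : ChainCost c' C δ' y a) :
    ∃ a' ≤ a, ChainCost c C δ y a' := by
  induction h with
  | base hy => exact ⟨0, le_rfl, .base hy⟩
  | step hyz _ ih =>
    obtain ⟨a', ha', h'⟩ := ih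
    exact ⟨_, add_le_add (mul_le_mul_of_nonneg_right (hcc _) dist_nonneg) ha',
      .step (hyz.trans_le hδ) h'⟩

/-- A chain gives rise to a piecewise constant path that is almost `1`-Lipschitz. -/
theorem ChainCost.exists_path [BorelSpace X] {c : X → ℝ} {C : Set X} {δ ε : ℝ} (hδ : 0 < δ)
    (hε : 0 ≤ ε) (hc : ∀ y, ε ≤ c y) {y : X} {a : ℝ} (h : ChainCost c C δ y a) :
    ∃ (γ : ℝ → X) (T : ℝ), 0 ≤ T ∧ ε * T ≤ a ∧ γ 0 = y ∧ (∀ t, T ≤ t → γ t ∈ C) ∧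
      (∀ t, 0 ≤ t → dist y (γ t) ≤ t) ∧
      (∀ s t, 0 ≤ s → s ≤ t → dist (γ s) (γ t) ≤ t - s + δ) ∧
      Measurable (fun t => ENNReal.ofReal (c (γ t))) ∧
      ∫⁻ t in Ico 0 T, ENNReal.ofReal (c (γ t)) ≤ ENNReal.ofReal a := by
  induction h with
  | base hy =>
    exact ⟨fun _ => _, 0, le_rfl, by simp, rfl, fun _ _ => hy, fun t ht => by simpa using ht,
      fun s t _ hst => by simp; linarith, measurable_const, by simp⟩
  | @step y z a hyz hz ih =>
    obtain ⟨γ, T, hT, hTa, h0, hC, hd, hL, hm, hI⟩ := ih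
    set d := dist y z with hddef
    have hd0 : 0 ≤ d := dist_nonneg
    refine ⟨fun t => if t < d then y else γ (t - d), d + T, by positivity, ?_, ?_, ?_, ?_, ?_, ?_,
      ?_⟩
    · nlinarith [hc y]
    · by_cases h : 0 < d
      · simp [h]
      · have : d = 0 := le_antisymm (not_lt.1 h) hd0
        simp [this, h0, (dist_eq_zero.1 this)]
    · intro t ht
      simp only [if_neg (by linarith : ¬ t < d)]
      exact hC _ (by linarith)
    · intro t ht
      by_cases h : t < d
      · simpa [h] using ht
      · simp only [if_neg h]
        have := dist_triangle y z (γ (t - d))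
        have := hd (t - d) (by linarith)
        linarith
    · intro s t hs hst
      by_cases h : t < d
      · simp only [if_pos h, if_pos (hst.trans_lt h), dist_self]
        linarith
      by_cases h' : s < d
      · simp only [if_neg h, if_pos h']
        have := dist_triangle y z (γ (t - d))
        have := hd (t - d) (by linarith)
        linarith
      · simp only [if_neg h, if_neg h']
        have := hL (s - d) (t - d) (by linarith) (by linarith)
        linarith
    · have : (fun t => ENNReal.ofReal (c (if t < d then y else γ (t - d)))) =
          fun t => if t < d then ENNReal.ofReal (c y) else ENNReal.ofReal (c (γ (t - d))) := by
        ext t; split_ifs <;> rfl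
      rw [this]
      exact Measurable.ite measurableSet_Iio measurable_const
        (hm.comp (measurable_id.sub_const d))
    · have hun : Ico 0 (d + T) = Ico 0 d ∪ Ico d (d + T) :=
        (Ico_union_Ico_eq_Ico hd0 (by linarith)).symm
      rw [hun, lintegral_union measurableSet_Ico (Ico_disjoint_Ico_same)]
      have h1 : ∫⁻ t in Ico 0 d, ENNReal.ofReal (c (if t < d then y else γ (t - d))) =
          ENNReal.ofReal (c y) * ENNReal.ofReal d := by
        rw [setLIntegral_congr_fun (g := fun _ => ENNReal.ofReal (c y)) measurableSet_Ico
          fun t ht => by simp [ht.2]]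
        simp
      have h2 : ∫⁻ t in Ico d (d + T), ENNReal.ofReal (c (if t < d then y else γ (t - d))) =
          ∫⁻ t in Ico 0 T, ENNReal.ofReal (c (γ t)) := by
        rw [setLIntegral_congr_fun (g := fun t => ENNReal.ofReal (c (γ (t - d)))) measurableSet_Ico
          fun t ht => by simp [not_lt.2 ht.1]]
        have := (measurePreserving_sub_right volume d).setLIntegral_comp_preimage
          (measurableSet_Ico (a := 0) (b := T)) hm
        rw [← this]
        congr 2
        ext t
        simp [add_comm]
      rw [h1, h2]
      have hcy := hε.trans (hc y)
      rw [← ENNReal.ofReal_mul hcy, ENNReal.ofReal_add (by positivity)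
        (hz.nonneg fun y => hε.trans (hc y))]
      gcongr

end Chain

section ChainLimit

/-- Almost `1`-Lipschitz paths issuing from a common point subconverge to a `1`-Lipschitz path. -/
theorem exists_limit_path [ProperSpace X] {y : X} {γ : ℕ → ℝ → X} {T δ : ℕ → ℝ} {T₀ : ℝ}
    (hT : ∀ k, T k ∈ Icc 0 T₀) (hδ : Tendsto δ atTop (𝓝 0))
    (hd : ∀ k t, 0 ≤ t → dist y (γ k t) ≤ t)
    (hL : ∀ k s t, 0 ≤ s → s ≤ t → dist (γ k s) (γ k t) ≤ t - s + δ k) :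
    ∃ (φ : ℕ → ℕ) (Γ : ℝ → X) (S : ℝ), StrictMono φ ∧ Tendsto (T ∘ φ) atTop (𝓝 S) ∧
      S ∈ Icc 0 T₀ ∧ (∀ t, 0 ≤ t → Tendsto (fun k => γ (φ k) t) atTop (𝓝 (Γ t))) ∧
      ∀ s t, 0 ≤ s → s ≤ t → dist (Γ s) (Γ t) ≤ t - s := by
  have hK : IsCompact ((Set.univ.pi fun q : ℚ => closedBall y |(q : ℝ)|) ×ˢ Icc 0 T₀) :=
    (isCompact_univ_pi fun q => isCompact_closedBall _ _).prod isCompact_Icc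
  obtain ⟨⟨f, S⟩, hfS, φ, hφ, hlim⟩ := hK.tendsto_subseq
    (x := fun k => ((fun q : ℚ => γ k |(q : ℝ)|), T k)) fun k =>
      ⟨fun q _ => by rw [mem_closedBall, dist_comm]; exact hd k _ (abs_nonneg _), hT k⟩
  have hfst : ∀ q : ℚ, Tendsto (fun k => γ (φ k) |(q : ℝ)|) atTop (𝓝 (f q)) := fun q =>
    (tendsto_pi_nhds.1 ((continuous_fst.tendsto _).comp hlim)) q
  have hδφ := hδ.comp hφ.tendsto_atTop
  have hcau : ∀ t, 0 ≤ t → ∃ p, Tendsto (fun k => γ (φ k) t) atTop (𝓝 p) := by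
    intro t ht
    refine cauchySeq_tendsto_of_complete (Metric.cauchySeq_iff.2 fun ε hε => ?_)
    obtain ⟨q, hq1, hq2⟩ := exists_rat_btwn (show t < t + ε / 8 by linarith)
    have hq0 : |(q : ℝ)| = q := abs_of_nonneg (by linarith)
    obtain ⟨N₁, hN₁⟩ := Metric.cauchySeq_iff.1 (hfst q).cauchySeq (ε / 8) (by linarith)
    obtain ⟨N₂, hN₂⟩ := eventually_atTop.1 (hδφ.eventually_lt_const (show 0 < ε / 8 by linarith))
    refine ⟨max N₁ N₂, fun m hm n hn => ?_⟩
    have h1 := hN₁ m ((le_max_left _ _).trans hm) n ((le_max_left _ _).trans hn)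
    have h2 := hN₂ m ((le_max_right _ _).trans hm)
    have h3 := hN₂ n ((le_max_right _ _).trans hn)
    have h4 := hL (φ m) t q ht hq1.le
    have h5 := hL (φ n) t q ht hq1.le
    have h6 := dist_triangle4 (γ (φ m) t) (γ (φ m) q) (γ (φ n) q) (γ (φ n) t)
    rw [dist_comm (γ (φ n) q)] at h6
    simp only [hq0] at h1
    simp only [Function.comp] at h2 h3
    linarith
  have : Nonempty X := ⟨y⟩
  choose! Γ hΓ using hcau
  refine ⟨φ, Γ, S, hφ, (continuous_snd.tendsto _).comp hlim, hfS.2, hΓ, fun s t hs hst => ?_⟩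
  refine le_of_tendsto_of_tendsto ((hΓ s hs).dist (hΓ t (hs.trans hst)))
    (by simpa using tendsto_const_nhds.add hδφ : Tendsto (fun k => t - s + δ (φ k)) atTop (𝓝 _))
    (Eventually.of_forall fun k => hL _ _ _ hs hst)

theorem speed_le_of_lipschitzOn {γ : ℝ → X} (h : ∀ s t, 0 ≤ s → s ≤ t → dist (γ s) (γ t) ≤ t - s)
    {t : ℝ} (ht : 0 < t) : speed γ t ≤ 1 := by
  refine limsup_le_of_le (by isBoundedDefault) ?_
  have : ∀ᶠ x : ℝ in 𝓝[≠] 0, -t < x :=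
    nhdsWithin_le_nhds (lt_mem_nhds (by linarith))
  filter_upwards [this, eventually_mem_nhdsWithin] with x hx hx0
  rw [← ENNReal.ofReal_one]
  refine ENNReal.ofReal_le_ofReal (div_le_one_of_le₀ ?_ (abs_nonneg _))
  rcases le_total 0 x with h0 | h0
  · rw [dist_comm, abs_of_nonneg h0]
    exact (h t (t + x) ht.le (by linarith)).trans (by linarith)
  · rw [abs_of_nonpos h0]
    exact (h (t + x) t (by linarith) (by linarith)).trans (by linarith)

/-- If `v` has a lower semicontinuous upper gradient `g`, vanishes on the closed set `C` and is at
least `1` at `y`, then no paths of `g`-length less than one connect `y` to `C`, not even in an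
approximate sense. -/
theorem false_of_chains [ProperSpace X] [BorelSpace X] {g : X → ℝ≥0∞}
    {v : X → ℝ} (hg : IsUpperGradientOn g v univ) {C : Set X} (hC : IsClosed C)
    (hvC : ∀ z ∈ C, v z = 0) {c : ℕ → X → ℝ} {δ : ℕ → ℝ} {ε θ : ℝ} (hε : 0 < ε)
    (hδ0 : ∀ k, 0 < δ k) (hδ : Tendsto δ atTop (𝓝 0)) (hc : ∀ k y, ε ≤ c k y)
    (hlim : ∀ (p : ℕ → X) (φ : ℕ → ℕ) (z : X), StrictMono φ → Tendsto p atTop (𝓝 z) →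
      g z ≤ liminf (fun k => ENNReal.ofReal (c (φ k) (p k))) atTop)
    (hθ : θ < 1) {y : X} (hy : 1 ≤ v y)
    (hch : ∀ k, ∃ a ≤ θ, ChainCost (c k) C (δ k) y a) : False := by
  choose a haθ hchain using hch
  choose γ T hT0 hεT h0 hγC hd hL hm hI using fun k =>
    (hchain k).exists_path (hδ0 k) hε.le (hc k)
  obtain ⟨φ, Γ, S, hφ, hS, hS0, hΓ, hΓL⟩ := exists_limit_path (T₀ := θ / ε)
    (fun k => ⟨hT0 k, (le_div_iff₀' hε).2 ((hεT k).trans (haθ k))⟩) hδ hd hL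
  have hδφ := hδ.comp hφ.tendsto_atTop
  have hΓ0 : Γ 0 = y := tendsto_nhds_unique (hΓ 0 le_rfl) (by simp [h0])
  have hΓS : Γ S ∈ C := by
    have hlim2 : Tendsto (fun k => γ (φ k) (max (T (φ k)) S)) atTop (𝓝 (Γ S)) := by
      refine tendsto_iff_dist_tendsto_zero.2 ?_
      have hb : Tendsto (fun k => (max (T (φ k)) S - S + δ (φ k)) + dist (γ (φ k) S) (Γ S)) atTop
          (𝓝 ((max S S - S + 0) + 0)) :=
        (((hS.max tendsto_const_nhds).sub_const S).add hδφ).add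
          (tendsto_iff_dist_tendsto_zero.1 (hΓ S hS0.1))
      simp only [max_self, sub_self, add_zero] at hb
      refine squeeze_zero (fun _ => dist_nonneg) (fun k => ?_) hb
      have h1 := hL (φ k) S (max (T (φ k)) S) hS0.1 (le_max_right _ _)
      rw [dist_comm] at h1
      exact (dist_triangle _ (γ (φ k) S) _).trans (by linarith)
    exact hC.mem_of_tendsto hlim2 (Eventually.of_forall fun k => hγC _ _ (le_max_left _ _))
  have hint : ∫⁻ t in Ico 0 S, g (Γ t) ≤ ENNReal.ofReal θ := by
    calc ∫⁻ t in Ico 0 S, g (Γ t) ≤ ∫⁻ t, liminf (fun k => (Ico 0 (T (φ k))).indicator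
            (fun t => ENNReal.ofReal (c (φ k) (γ (φ k) t))) t) atTop := by
          rw [← lintegral_indicator measurableSet_Ico]
          refine lintegral_mono fun t => ?_
          by_cases ht : t ∈ Ico 0 S
          · rw [indicator_of_mem ht]
            refine (hlim _ φ _ hφ (hΓ t ht.1)).trans (le_of_eq (liminf_congr ?_))
            filter_upwards [hS.eventually_const_lt ht.2] with k hk
            rw [indicator_of_mem (show t ∈ Ico 0 (T (φ k)) from ⟨ht.1, hk⟩)]
          · rw [indicator_of_notMem ht]; exact zero_le
      _ ≤ liminf (fun k => ∫⁻ t, (Ico 0 (T (φ k))).indicator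
            (fun t => ENNReal.ofReal (c (φ k) (γ (φ k) t))) t) atTop :=
          lintegral_liminf_le fun k => (hm _).indicator measurableSet_Ico
      _ ≤ ENNReal.ofReal θ := by
          refine liminf_le_of_le (by isBoundedDefault) fun b hb => ?_
          obtain ⟨k, hk⟩ := hb.exists
          rw [lintegral_indicator measurableSet_Ico] at hk
          exact hk.trans ((hI _).trans (ENNReal.ofReal_le_ofReal (haθ _)))
  rcases hS0.1.eq_or_lt with hS00 | hSpos
  · rw [← hS00, hΓ0] at hΓS
    linarith [hvC y hΓS]
  have hcurve : LipschitzOnWith S.toNNReal (fun t => Γ (0 + (S - 0) * t)) (Icc 0 1) := by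
    have key : ∀ s t : ℝ, 0 ≤ s → s ≤ t → dist (Γ (0 + (S - 0) * s)) (Γ (0 + (S - 0) * t)) ≤
        S * (t - s) := fun s t hs hst =>
      (hΓL _ _ (by simp; positivity) (by simp; gcongr)).trans (by linarith)
    refine LipschitzOnWith.of_dist_le_mul fun s hs t ht => ?_
    rw [Real.coe_toNNReal _ hSpos.le, Real.dist_eq]
    rcases le_total s t with hst | hst
    · rw [abs_sub_comm, abs_of_nonneg (by linarith)]
      exact key s t hs.1 hst
    · rw [dist_comm, abs_of_nonneg (by linarith)]
      exact key t s ht.1 hst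
  have h1 := hg ⟨_, _, hcurve⟩ fun _ _ => mem_univ _
  have h2 := lintegral_comp_affine_le g Γ hSpos
  have h3 : ∫⁻ t in Icc 0 S, g (Γ t) * speed Γ t ≤ ENNReal.ofReal θ := by
    rw [setLIntegral_congr (Ioo_ae_eq_Icc (a := (0 : ℝ)) (b := S)).symm]
    refine le_trans (setLIntegral_mono' measurableSet_Ioo fun t ht => ?_)
      ((lintegral_mono_set Ioo_subset_Ico_self).trans hint)
    exact mul_le_of_le_one_right' (speed_le_of_lipschitzOn hΓL ht.1)
  have h4 := h1.trans (h2.trans h3)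
  simp only [mul_one, mul_zero, zero_add, sub_zero, hΓ0, hvC _ hΓS, zero_sub, abs_neg] at h4
  have h5 : 1 ≤ ENNReal.ofReal |v y| := by
    rw [← ENNReal.ofReal_one]
    exact ENNReal.ofReal_le_ofReal (hy.trans (le_abs_self _))
  have h6 : ENNReal.ofReal θ < 1 := by
    rw [← ENNReal.ofReal_one]
    exact (ENNReal.ofReal_lt_ofReal_iff one_pos).2 hθ
  exact absurd (h5.trans h4) (not_le.2 h6)

end ChainLimit

section ChainFunction

/-- A continuous-type lower approximation of the weight `g + ε`. -/
def chainWeight (g : X → ℝ≥0∞) (ε : ℝ) (k : ℕ) (p : X) : ℝ :=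
  (⨅ q ∈ ball p (1 / (k + 1 : ℝ)), min (g q) k).toReal + ε

theorem chainWeight_aux_le (g : X → ℝ≥0∞) {k : ℕ} {p q : X}
    (h : dist p q < 1 / (k + 1 : ℝ)) :
    (⨅ q ∈ ball p (1 / (k + 1 : ℝ)), min (g q) k) ≤ min (g q) k :=
  iInf₂_le q (mem_ball'.2 h)

theorem min_natCast_ne_top (a : ℝ≥0∞) (k : ℕ) : min a (k : ℝ≥0∞) ≠ ⊤ :=
  ((min_le_right _ _).trans_lt (ENNReal.natCast_lt_top k)).ne

theorem le_chainWeight (g : X → ℝ≥0∞) (ε : ℝ) (k : ℕ) (p : X) : ε ≤ chainWeight g ε k p :=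
  le_add_of_nonneg_left ENNReal.toReal_nonneg

theorem chainWeight_le (g : X → ℝ≥0∞) (ε : ℝ) {k : ℕ} {p q : X}
    (h : dist p q < 1 / (k + 1 : ℝ)) :
    chainWeight g ε k p ≤ (min (g q) k).toReal + ε :=
  add_le_add_left (ENNReal.toReal_mono (min_natCast_ne_top _ _) (chainWeight_aux_le g h)) _

theorem chainWeight_mono (g : X → ℝ≥0∞) (ε : ℝ) {k l : ℕ} (hkl : k ≤ l) (p : X) :
    chainWeight g ε k p ≤ chainWeight g ε l p := by
  have hp : (0 : ℝ) < 1 / (l + 1) := by positivity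
  refine add_le_add_left (ENNReal.toReal_mono ?_ ?_) _
  · exact ((chainWeight_aux_le g (by rwa [dist_self])).trans_lt
      (min_natCast_ne_top (g p) l).lt_top).ne
  · refine le_iInf₂ fun q hq => ?_
    refine (iInf₂_le q (ball_subset_ball ?_ hq)).trans ?_
    · gcongr
    · gcongr

theorem le_liminf_chainWeight {g : X → ℝ≥0∞} (hg : LowerSemicontinuous g) {ε : ℝ} (hε : 0 ≤ ε)
    {p : ℕ → X} {φ : ℕ → ℕ} {z : X} (hφ : StrictMono φ) (hp : Tendsto p atTop (𝓝 z)) :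
    g z ≤ liminf (fun k => ENNReal.ofReal (chainWeight g ε (φ k) (p k))) atTop := by
  refine le_of_forall_lt fun t ht => ?_
  obtain ⟨t', htt', ht'⟩ := exists_between ht
  refine htt'.trans_le (le_liminf_of_le (by isBoundedDefault) ?_)
  obtain ⟨r, hr, hball⟩ := Metric.eventually_nhds_iff_ball.1 (hg z t' ht')
  obtain ⟨n, hn⟩ := ENNReal.exists_nat_gt ht'.ne_top
  have h1 : ∀ᶠ k in atTop, dist (p k) z < r / 2 := hp.eventually (ball_mem_nhds z (half_pos hr))
  have h2 : ∀ᶠ k in atTop, 1 / ((φ k : ℝ) + 1) < r / 2 :=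
    (tendsto_one_div_add_atTop_nhds_zero_nat.comp hφ.tendsto_atTop).eventually_lt_const
      (half_pos hr)
  filter_upwards [h1, h2, eventually_ge_atTop n] with k hk1 hk2 hk3
  have hfin : (⨅ q ∈ ball (p k) (1 / (φ k + 1 : ℝ)), min (g q) (φ k)) ≠ ⊤ :=
    ((chainWeight_aux_le g (by rw [dist_self]; positivity)).trans_lt
      (min_natCast_ne_top (g (p k)) (φ k)).lt_top).ne
  calc t' ≤ ⨅ q ∈ ball (p k) (1 / (φ k + 1 : ℝ)), min (g q) (φ k) := by
        refine le_iInf₂ fun q hq => le_min (hball q ?_).le (hn.le.trans ?_)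
        · have := mem_ball.1 hq
          have := dist_triangle q (p k) z
          exact mem_ball.2 (by linarith)
        · exact_mod_cast hk3.trans (hφ.id_le k)
    _ = ENNReal.ofReal (⨅ q ∈ ball (p k) (1 / (φ k + 1 : ℝ)), min (g q) (φ k)).toReal :=
        (ENNReal.ofReal_toReal hfin).symm
    _ ≤ _ := ENNReal.ofReal_le_ofReal (le_add_of_nonneg_right hε)

/-- The truncated minimal cost of a chain from `y` to `C`. -/
def chainFun (g : X → ℝ≥0∞) (ε : ℝ) (C : Set X) (k : ℕ) (y : X) : ℝ :=
  sInf (insert 1 {a | ChainCost (chainWeight g ε k) C (1 / (k + 1 : ℝ)) y a})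

variable {g : X → ℝ≥0∞} {ε : ℝ} {C : Set X}

theorem chainFun_set_nonneg (hε : 0 ≤ ε) {k : ℕ} {y : X} :
    ∀ a ∈ insert (1 : ℝ) {a | ChainCost (chainWeight g ε k) C (1 / (k + 1 : ℝ)) y a}, 0 ≤ a := by
  rintro a (rfl | ha)
  · exact zero_le_one
  · exact ChainCost.nonneg (fun y => hε.trans (le_chainWeight g ε k y)) ha

theorem chainFun_nonneg (hε : 0 ≤ ε) (k : ℕ) (y : X) : 0 ≤ chainFun g ε C k y :=
  Real.sInf_nonneg (chainFun_set_nonneg hε)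

theorem chainFun_le_one (hε : 0 ≤ ε) (k : ℕ) (y : X) : chainFun g ε C k y ≤ 1 :=
  csInf_le ⟨0, fun _ h => chainFun_set_nonneg hε _ h⟩ (mem_insert _ _)

theorem chainFun_le (hε : 0 ≤ ε) {k : ℕ} {y : X} {a : ℝ}
    (h : ChainCost (chainWeight g ε k) C (1 / (k + 1 : ℝ)) y a) : chainFun g ε C k y ≤ a :=
  csInf_le ⟨0, fun _ h => chainFun_set_nonneg hε _ h⟩ (mem_insert_of_mem _ h)

theorem exists_chain_of_chainFun_lt {k : ℕ} {y : X} {θ : ℝ} (hθ : θ ≤ 1)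
    (h : chainFun g ε C k y < θ) :
    ∃ a ≤ θ, ChainCost (chainWeight g ε k) C (1 / (k + 1 : ℝ)) y a := by
  obtain ⟨a, ha, haθ⟩ := exists_lt_of_csInf_lt (insert_nonempty _ _) h
  rcases ha with rfl | ha
  · exact absurd haθ (not_lt.2 hθ)
  · exact ⟨a, haθ.le, ha⟩

theorem chainFun_eq_zero (hε : 0 ≤ ε) (k : ℕ) {y : X} (hy : y ∈ C) : chainFun g ε C k y = 0 :=
  le_antisymm (chainFun_le hε (.base hy)) (chainFun_nonneg hε _ _)

theorem chainFun_le_add (hε : 0 ≤ ε) {k : ℕ} {y z : X} (h : dist y z < 1 / (k + 1 : ℝ)) :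
    chainFun g ε C k y ≤ chainWeight g ε k y * dist y z + chainFun g ε C k z := by
  have hcd : 0 ≤ chainWeight g ε k y * dist y z :=
    mul_nonneg (hε.trans (le_chainWeight g ε k y)) dist_nonneg
  rw [← sub_le_iff_le_add']
  refine le_csInf (insert_nonempty _ _) ?_
  rintro a (rfl | ha)
  · linarith [chainFun_le_one (g := g) (C := C) hε k y]
  · linarith [chainFun_le hε (ChainCost.step h ha)]

theorem chainFun_mono (hε : 0 ≤ ε) {k l : ℕ} (hkl : k ≤ l) (y : X) :
    chainFun g ε C k y ≤ chainFun g ε C l y := by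
  refine le_csInf (insert_nonempty _ _) ?_
  rintro a (rfl | ha)
  · exact chainFun_le_one hε k y
  · obtain ⟨a', ha', h⟩ := ChainCost.exists_le (δ := 1 / (k + 1 : ℝ)) (chainWeight_mono g ε hkl)
      (by gcongr) ha
    exact (chainFun_le hε h).trans ha'

theorem abs_chainFun_sub_le (hε : 0 ≤ ε) {k : ℕ} {p y : X} (h : dist y p < 1 / (k + 1 : ℝ)) :
    |chainFun g ε C k y - chainFun g ε C k p| ≤ ((min (g p) k).toReal + ε) * dist y p := by
  have hp : (0 : ℝ) < 1 / (k + 1) := by positivity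
  have h1 := chainFun_le_add (g := g) (C := C) hε h
  have h2 := chainFun_le_add (g := g) (C := C) hε (by rwa [dist_comm] : dist p y < _)
  have h3 := mul_le_mul_of_nonneg_right (chainWeight_le g ε h) (dist_nonneg (x := y) (y := p))
  have h4 := mul_le_mul_of_nonneg_right
    (chainWeight_le g ε (by rwa [dist_self] : dist p p < 1 / (k + 1 : ℝ)))
    (dist_nonneg (x := y) (y := p))
  rw [dist_comm p y] at h2
  rw [abs_le]
  constructor <;> linarith

theorem lipschitzWith_chainFun (hε : 0 ≤ ε) (k : ℕ) :
    LipschitzWith (k + 1 + ε.toNNReal) (chainFun g ε C k) := by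
  refine LipschitzWith.of_dist_le_mul fun y p => ?_
  push_cast
  rw [Real.dist_eq, Real.coe_toNNReal _ hε]
  rcases lt_or_ge (dist y p) (1 / (k + 1 : ℝ)) with h | h
  · refine (abs_chainFun_sub_le hε h).trans ?_
    gcongr
    have : (min (g p) k).toReal ≤ k := by
      simpa using ENNReal.toReal_mono (ENNReal.natCast_ne_top k) (min_le_right (g p) k)
    linarith
  · have h1 := chainFun_nonneg (g := g) (C := C) hε k y
    have h2 := chainFun_le_one (g := g) (C := C) hε k y
    have h3 := chainFun_nonneg (g := g) (C := C) hε k p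
    have h4 := chainFun_le_one (g := g) (C := C) hε k p
    rw [div_le_iff₀ (by positivity)] at h
    rw [abs_le]
    constructor <;> nlinarith [dist_nonneg (x := y) (y := p)]

theorem chainFun_isUpperGradientOn (hε : 0 ≤ ε) (k : ℕ) :
    IsUpperGradientOn (Cᶜ.indicator fun y => g y + ENNReal.ofReal ε) (chainFun g ε C k) univ := by
  intro γ hγ
  refine increment_le_of_ae_deriv_le γ hγ
    (LipschitzWith.locLipschitzOn (lipschitzWith_chainFun hε k) _)
    (ae_of_all _ fun t ht hd => ?_)
  have hct : ContinuousAt γ.toFun t := γ.continuousOn.continuousAt (Icc_mem_nhds ht.1 ht.2)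
  by_cases hy : γ.toFun t ∈ C
  · have hmin : IsLocalMin (fun s => chainFun g ε C k (γ.toFun s)) t := by
      refine Eventually.of_forall fun s => ?_
      simp only [chainFun_eq_zero hε k hy]
      exact chainFun_nonneg hε _ _
    rw [hmin.deriv_eq_zero]
    simp
  · have hev : ∀ᶠ y in 𝓝 (γ.toFun t), |chainFun g ε C k y - chainFun g ε C k (γ.toFun t)| ≤
        ((min (g (γ.toFun t)) k).toReal + ε) * dist y (γ.toFun t) :=
      eventually_of_mem (ball_mem_nhds _ (by positivity : (0 : ℝ) < 1 / (k + 1)))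
        fun y hy => abs_chainFun_sub_le hε hy
    refine (deriv_comp_le_of_eventually hct hev hd (by positivity)).trans ?_
    rw [indicator_of_mem (show γ.toFun t ∈ Cᶜ from hy)]
    gcongr
    rw [ENNReal.ofReal_add ENNReal.toReal_nonneg hε,
      ENNReal.ofReal_toReal (min_natCast_ne_top _ _)]
    gcongr
    exact min_le_left _ _

theorem tendstoL1Loc_of_tendsto [BorelSpace X] {μ : Measure X} [IsFiniteMeasureOnCompacts μ]
    {w : ℕ → X → ℝ} {u : X → ℝ} {Ω : Set X} (hw : ∀ k, Measurable (w k)) (hu : Measurable u)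
    (hw0 : ∀ k y, 0 ≤ w k y) (hw1 : ∀ k y, w k y ≤ 1) (h0 : ∀ y, 0 ≤ u y) (h1 : ∀ y, u y ≤ 1)
    (hlim : ∀ y, Tendsto (fun k => w k y) atTop (𝓝 (u y))) : TendstoL1Loc μ w u Ω := by
  intro K hK _
  have := tendsto_lintegral_of_dominated_convergence (μ := μ.restrict K) (F := fun k y =>
    ENNReal.ofReal |w k y - u y|) (f := fun _ => 0)
    (fun _ => 1) (fun k => ((hw k).sub hu).abs.ennreal_ofReal)
    (fun k => ae_of_all _ fun y => ?_) (by simpa using hK.measure_lt_top.ne)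
    (ae_of_all _ fun y => ?_)
  · simpa using this
  · rw [← ENNReal.ofReal_one]
    refine ENNReal.ofReal_le_ofReal (abs_le.2 ?_)
    have := hw0 k y
    have := hw1 k y
    have := h0 y
    have := h1 y
    constructor <;> linarith
  · have h0 := ((hlim y).sub_const (u y)).abs
    rw [sub_self, abs_zero] at h0
    simpa using ENNReal.tendsto_ofReal h0

/-- A function with an integrable lower semicontinuous upper gradient that vanishes outside an
open set can be replaced by a lower semicontinuous one. -/
theorem exists_lowerSemicontinuous_of_upperGradient [ProperSpace X] [BorelSpace X]
    {μ : Measure X} [IsFiniteMeasureOnCompacts μ] (hg : LowerSemicontinuous g) {v : X → ℝ}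
    (hgv : IsUpperGradientOn g v univ) (hC : IsClosed C) (hvC : ∀ z ∈ C, v z = 0) (hε : 0 < ε) :
    ∃ w : X → ℝ, LowerSemicontinuous w ∧ (∀ y, 0 ≤ w y) ∧ (∀ y, w y ≤ 1) ∧
      (∀ y, 1 ≤ v y → w y = 1) ∧ (∀ y ∈ C, w y = 0) ∧
      tv μ w univ ≤ ∫⁻ y in Cᶜ, (g y + ENNReal.ofReal ε) ∂μ := by
  have hbdd : ∀ y, BddAbove (range fun k => chainFun g ε C k y) := fun y =>
    ⟨1, by rintro _ ⟨k, rfl⟩; exact chainFun_le_one hε.le k y⟩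
  have hlim : ∀ y, Tendsto (fun k => chainFun g ε C k y) atTop
      (𝓝 (⨆ k, chainFun g ε C k y)) := fun y =>
    tendsto_atTop_ciSup (fun k l hkl => chainFun_mono hε.le hkl y) (hbdd y)
  have hw0 : ∀ y, 0 ≤ ⨆ k, chainFun g ε C k y := fun y =>
    (chainFun_nonneg hε.le 0 y).trans (le_ciSup (hbdd y) 0)
  have hw1 : ∀ y, ⨆ k, chainFun g ε C k y ≤ 1 := fun y =>
    ciSup_le fun k => chainFun_le_one hε.le k y
  refine ⟨fun y => ⨆ k, chainFun g ε C k y, ?_, hw0, hw1, ?_, ?_, ?_⟩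
  · exact lowerSemicontinuous_ciSup hbdd fun k =>
      (lipschitzWith_chainFun hε.le k).continuous.lowerSemicontinuous
  · intro y hy
    refine le_antisymm (hw1 y) ?_
    by_contra! hlt
    obtain ⟨θ, hθ1, hθ2⟩ := exists_between hlt
    refine false_of_chains hgv hC hvC (c := chainWeight g ε) (δ := fun k => 1 / ((k : ℝ) + 1)) hε
      (fun k => by positivity) tendsto_one_div_add_atTop_nhds_zero_nat
      (fun k p => le_chainWeight g ε k p)
      (fun p φ z hφ hp => le_liminf_chainWeight hg hε.le hφ hp) hθ2 hy fun k => ?_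
    exact exists_chain_of_chainFun_lt hθ2.le ((le_ciSup (hbdd y) k).trans_lt hθ1)
  · intro y hy
    simp [chainFun_eq_zero hε.le _ hy]
  · refine (tv_le_of_seq (v := fun k => chainFun g ε C k)
      (g := fun _ => Cᶜ.indicator fun y => g y + ENNReal.ofReal ε)
      (fun k => LipschitzWith.locLipschitzOn (lipschitzWith_chainFun hε.le k) _) ?_
      (fun _ => (hg.measurable.add_const _).indicator hC.measurableSet.compl)
      (fun k => chainFun_isUpperGradientOn hε.le k)).trans ?_
    · have hm : ∀ k, Measurable (chainFun g ε C k) := fun k =>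
        (lipschitzWith_chainFun hε.le k).continuous.measurable
      exact tendstoL1Loc_of_tendsto hm (Measurable.iSup hm) (chainFun_nonneg hε.le)
        (chainFun_le_one hε.le) hw0 hw1 hlim
    · simp [lintegral_indicator hC.measurableSet.compl]

end ChainFunction

theorem exists_lowerSemicontinuous_of_vcap1_lt [ProperSpace X] [BorelSpace X] {μ : Measure X}
    [IsFiniteMeasureOnCompacts μ] {A : Set X} {x : X} {r : ℝ} {δ : ℝ≥0∞}
    (h : vcap1 μ A (ball x r) < δ) :
    ∃ w : X → ℝ, LowerSemicontinuous w ∧ (∀ y, 0 ≤ w y) ∧ (∀ y, w y ≤ 1) ∧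
      (∀ y ∈ A, w y = 1) ∧ (∀ y, y ∉ ball x r → w y = 0) ∧ tv μ w univ ≤ δ := by
  obtain ⟨d, hd1, hd2⟩ := exists_between h
  simp only [vcap1, iInf_lt_iff] at hd1
  obtain ⟨v, -, hvA, hvC, g, hgm, hg, hgd⟩ := hd1
  set e := (d - ∫⁻ y, g y ∂μ) / 3 with he
  have hd0 : d - ∫⁻ y, g y ∂μ ≠ 0 := (tsub_pos_of_lt hgd).ne'
  have he0 : e ≠ 0 := ENNReal.div_ne_zero.2 ⟨hd0, by simp⟩
  have he3 : (∫⁻ y, g y ∂μ) + e + e + e = d := by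
    have : e + e + e = d - ∫⁻ y, g y ∂μ := by
      rw [he]; exact ENNReal.add_thirds _
    rw [add_assoc, add_assoc, ← add_assoc e, this, add_tsub_cancel_of_le hgd.le]
  obtain ⟨ρ, hρm, hρ, hug⟩ := exists_upperGradient_of_weak hg he0
  obtain ⟨G, hG1, hG2, hG3⟩ := exists_le_lowerSemicontinuous_lintegral_ge μ (g + ρ) (hgm.add hρm) he0
  have hμB : μ (ball x r) ≠ ⊤ :=
    ((measure_mono ball_subset_closedBall).trans_lt
      (isCompact_closedBall x r).measure_lt_top).ne
  obtain ⟨ε, hε0, hε⟩ := ENNReal.exists_nnreal_pos_mul_lt hμB he0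
  obtain ⟨w, hw1, hw2, hw3, hw4, hw5, hw6⟩ := exists_lowerSemicontinuous_of_upperGradient
    (C := (ball x r)ᶜ) (ε := ε) (μ := μ) hG2
    (hug.mono (fun y => hG1 y) subset_rfl) isOpen_ball.isClosed_compl hvC hε0
  refine ⟨w, hw1, hw2, hw3, fun y hy => hw4 y (hvA y hy), hw5, hw6.trans (le_trans ?_ hd2.le)⟩
  rw [compl_compl, lintegral_add_right _ measurable_const, ← he3]
  refine add_le_add ?_ ?_
  · refine (setLIntegral_le_lintegral _ _).trans (hG3.trans ?_)
    gcongr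
    simp only [Pi.add_apply]
    rw [lintegral_add_left hgm]
    gcongr
  · simpa using hε.le

section Minimizer

/-- The competitors of the obstacle problem: measurable functions with values in `[0,1]` that are
`1` on `S` and vanish outside `Q`. -/
structure IsAdmissible (S Q : Set X) (u : X → ℝ) : Prop where
  measurable : Measurable u
  nonneg : ∀ y, 0 ≤ u y
  le_one : ∀ y, u y ≤ 1
  eq_one : ∀ y ∈ S, u y = 1
  eq_zero : ∀ y, y ∉ Q → u y = 0

variable {S Q : Set X} {u w : X → ℝ}

theorem IsAdmissible.min (hu : IsAdmissible S Q u) (hw : IsAdmissible S Q w) :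
    IsAdmissible S Q fun y => min (u y) (w y) where
  measurable := hu.measurable.min hw.measurable
  nonneg y := le_min (hu.nonneg y) (hw.nonneg y)
  le_one y := (min_le_left _ _).trans (hu.le_one y)
  eq_one y hy := by simp [hu.eq_one y hy, hw.eq_one y hy]
  eq_zero y hy := by simp [hu.eq_zero y hy, hw.eq_zero y hy]

theorem IsAdmissible.max (hu : IsAdmissible S Q u) (hw : IsAdmissible S Q w) :
    IsAdmissible S Q fun y => max (u y) (w y) where
  measurable := hu.measurable.max hw.measurable
  nonneg y := (hu.nonneg y).trans (le_max_left _ _)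
  le_one y := max_le (hu.le_one y) (hw.le_one y)
  eq_one y hy := by simp [hu.eq_one y hy, hw.eq_one y hy]
  eq_zero y hy := by simp [hu.eq_zero y hy, hw.eq_zero y hy]

theorem IsAdmissible.of_tendsto {f : ℕ → X → ℝ} (hf : ∀ n, IsAdmissible S Q (f n))
    (h : ∀ y, Tendsto (fun n => f n y) atTop (𝓝 (u y))) : IsAdmissible S Q u where
  measurable := measurable_of_tendsto_metrizable (fun n => (hf n).measurable)
    (tendsto_pi_nhds.2 h)
  nonneg y := ge_of_tendsto' (h y) fun n => (hf n).nonneg y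
  le_one y := le_of_tendsto' (h y) fun n => (hf n).le_one y
  eq_one y hy := tendsto_nhds_unique (h y) (by simp [(hf _).eq_one y hy])
  eq_zero y hy := tendsto_nhds_unique (h y) (by simp [(hf _).eq_zero y hy])

theorem IsAdmissible.truncate (hu : IsAdmissible S Q u) :
    IsAdmissible S Q fun y => Max.max (2 * u y) 1 - 1 where
  measurable := ((hu.measurable.const_mul 2).max measurable_const).sub_const 1
  nonneg y := sub_nonneg.2 (le_max_right _ _)
  le_one y := by
    have := max_le (show 2 * u y ≤ 2 by linarith [hu.le_one y]) (one_le_two)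
    linarith
  eq_one y hy := by simp [hu.eq_one y hy]; norm_num
  eq_zero y hy := by simp [hu.eq_zero y hy]

theorem IsAdmissible.min_two_mul (hu : IsAdmissible S Q u) :
    IsAdmissible S Q fun y => Min.min (2 * u y) 1 where
  measurable := (hu.measurable.const_mul 2).min measurable_const
  nonneg y := le_min (by linarith [hu.nonneg y]) zero_le_one
  le_one y := min_le_right _ _
  eq_one y hy := by simp [hu.eq_one y hy]
  eq_zero y hy := by simp [hu.eq_zero y hy]

variable [ProperSpace X] [BorelSpace X] {μ : Measure X} [IsFiniteMeasureOnCompacts μ]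

theorem IsAdmissible.tv_le_of_tendsto {f : ℕ → X → ℝ} (hf : ∀ n, IsAdmissible S Q (f n))
    (h : ∀ y, Tendsto (fun n => f n y) atTop (𝓝 (u y))) {c : ℝ≥0∞}
    (hc : ∀ n, tv μ (f n) univ ≤ c) : tv μ u univ ≤ c := by
  have hu := IsAdmissible.of_tendsto hf h
  exact MetricBV.tv_le_of_tendsto isOpen_univ hu.measurable.aemeasurable
    (fun j => (hf j).measurable.aemeasurable)
    (tendstoL1Loc_of_tendsto (fun k => (hf k).measurable) hu.measurable (fun k => (hf k).nonneg)
      (fun k => (hf k).le_one) hu.nonneg hu.le_one h) hc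

theorem IsAdmissible.exists_minimizer (hw : IsAdmissible S Q w) (hfin : tv μ w univ ≠ ⊤) :
    ∃ u, IsAdmissible S Q u ∧ ∀ v, IsAdmissible S Q v → tv μ u univ ≤ tv μ v univ := by
  set m : ℝ≥0∞ := ⨅ (v : X → ℝ) (_ : IsAdmissible S Q v), tv μ v univ with hm
  have hmle : ∀ v, IsAdmissible S Q v → m ≤ tv μ v univ := fun v hv => iInf₂_le v hv
  have hmtop : m ≠ ⊤ := ((hmle w hw).trans_lt hfin.lt_top).ne
  have hpow0 : ∀ j : ℕ, (2⁻¹ : ℝ≥0∞) ^ j ≠ 0 := fun j => by simp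
  have hex : ∀ j : ℕ, ∃ v, IsAdmissible S Q v ∧ tv μ v univ ≤ m + 2⁻¹ ^ j := by
    intro j
    have := ENNReal.lt_add_right hmtop (hpow0 j)
    simp only [hm, iInf_lt_iff] at this
    obtain ⟨v, hv, hlt⟩ := this
    exact ⟨v, hv, hlt.le⟩
  choose v hv hvm using hex
  let f : ℕ → ℕ → X → ℝ := fun k n => Nat.rec (v k) (fun n f y => Min.min (f y) (v (k + n + 1) y)) n
  have hf0 : ∀ k, f k 0 = v k := fun k => rfl
  have hfs : ∀ k n, f k (n + 1) = fun y => Min.min (f k n y) (v (k + n + 1) y) := fun k n => rfl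
  have hfa : ∀ k n, IsAdmissible S Q (f k n) := by
    intro k n
    induction n with
    | zero => exact hv k
    | succ n ih => rw [hfs]; exact ih.min (hv _)
  have hftv : ∀ k n, tv μ (f k n) univ + 2⁻¹ ^ (k + n) ≤ m + 2 * 2⁻¹ ^ k := by
    intro k n
    induction n with
    | zero =>
      rw [hf0, add_zero, two_mul, ← add_assoc]
      exact add_le_add_left (hvm k) _
    | succ n ih =>
      have h1 := tv_min_add_tv_max_le (μ := μ) isOpen_univ (w := v (k + n + 1))
        (hfa k n).measurable.aemeasurable
      have h2 := hmle _ ((hfa k n).max (hv (k + n + 1)))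
      rw [hfs]
      have hhalf : (2⁻¹ : ℝ≥0∞) ^ (k + n) = 2⁻¹ ^ (k + n + 1) + 2⁻¹ ^ (k + n + 1) := by
        rw [pow_succ, ← mul_add, ENNReal.inv_two_add_inv_two, mul_one]
      refine (ENNReal.add_le_add_iff_right hmtop).1 ?_
      calc _ = tv μ (fun y => Min.min (f k n y) (v (k + n + 1) y)) univ + m +
            2⁻¹ ^ (k + n + 1) := by rw [← add_assoc k]; ring
        _ ≤ (tv μ (f k n) univ + tv μ (v (k + n + 1)) univ) + 2⁻¹ ^ (k + n + 1) := by
            exact add_le_add_left ((add_le_add_right h2 _).trans h1) _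
        _ ≤ (tv μ (f k n) univ + (m + 2⁻¹ ^ (k + n + 1))) + 2⁻¹ ^ (k + n + 1) := by
            gcongr
            exact hvm _
        _ = (tv μ (f k n) univ + 2⁻¹ ^ (k + n)) + m := by rw [hhalf]; ring
        _ ≤ _ := add_le_add_left ih _
  have hanti : ∀ k y, Antitone fun n => f k n y := fun k y => antitone_nat_of_succ_le fun n => by
    rw [hfs]; exact min_le_left _ _
  have hbdd : ∀ k y, BddBelow (range fun n => f k n y) := fun k y =>
    ⟨0, by rintro _ ⟨n, rfl⟩; exact (hfa k n).nonneg y⟩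
  set F : ℕ → X → ℝ := fun k y => ⨅ n, f k n y with hF
  have hFlim : ∀ k y, Tendsto (fun n => f k n y) atTop (𝓝 (F k y)) := fun k y =>
    tendsto_atTop_ciInf (hanti k y) (hbdd k y)
  have hFa : ∀ k, IsAdmissible S Q (F k) := fun k => .of_tendsto (hfa k) (hFlim k)
  have hFtv : ∀ k, tv μ (F k) univ ≤ m + 2 * 2⁻¹ ^ k := fun k =>
    IsAdmissible.tv_le_of_tendsto (hfa k) (hFlim k) fun n => le_self_add.trans (hftv k n)
  have hshift : ∀ k n y, f k (n + 1) y ≤ f (k + 1) n y := by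
    intro k n y
    induction n with
    | zero => rw [hfs, hf0, hf0]; exact min_le_right _ _
    | succ n ih =>
      rw [hfs k (n + 1), hfs (k + 1) n]
      refine min_le_min ih (le_of_eq ?_)
      congr 1
      ring_nf
  have hFmono : ∀ y, Monotone fun k => F k y := fun y => monotone_nat_of_le_succ fun k =>
    le_ciInf fun n => (ciInf_le (hbdd k y) (n + 1)).trans (hshift k n y)
  have hFbdd : ∀ y, BddAbove (range fun k => F k y) := fun y =>
    ⟨1, by rintro _ ⟨n, rfl⟩; exact (hFa n).le_one y⟩
  have hlim : ∀ y, Tendsto (fun k => F k y) atTop (𝓝 (⨆ k, F k y)) := fun y =>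
    tendsto_atTop_ciSup (hFmono y) (hFbdd y)
  refine ⟨fun y => ⨆ k, F k y, .of_tendsto hFa hlim, fun v hv => le_trans ?_ (hmle v hv)⟩
  have hK : ∀ K : ℕ, tv μ (fun y => ⨆ k, F k y) univ ≤ m + 2 * 2⁻¹ ^ K := fun K =>
    IsAdmissible.tv_le_of_tendsto (f := fun k => F (k + K)) (fun k => hFa _)
      (fun y => (hlim y).comp (tendsto_add_atTop_nat K)) fun k => (hFtv _).trans <| by
        gcongr m + 2 * ?_
        exact pow_le_pow_right_of_le_one' (by simp) (Nat.le_add_left _ _)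
  have hz : Tendsto (fun K : ℕ => m + 2 * (2⁻¹ : ℝ≥0∞) ^ K) atTop (𝓝 (m + 2 * 0)) :=
    tendsto_const_nhds.add (ENNReal.Tendsto.const_mul
      (ENNReal.tendsto_pow_atTop_nhds_zero_of_lt_one (by simp)) (Or.inr (by simp)))
  simpa using ge_of_tendsto' hz hK

theorem IsAdmissible.tv_truncate_le (hu : IsAdmissible S Q u) (hfin : tv μ u univ ≠ ⊤)
    (hmin : ∀ v, IsAdmissible S Q v → tv μ u univ ≤ tv μ v univ) :
    tv μ (fun y => Max.max (2 * u y) 1 - 1) univ ≤ tv μ u univ := by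
  have h1 := tv_min_add_tv_max_le (μ := μ) isOpen_univ (u := fun y => 2 * u y) (w := fun _ => 1)
    (hu.measurable.const_mul 2).aemeasurable
  have h2 := hmin _ hu.min_two_mul
  have h3 : tv μ (fun y => 2 * u y) univ ≤ 2 * tv μ u univ := by
    simpa using tv_affine_le (μ := μ) (u := u) (Ω := univ) 2 0
  have h4 : tv μ (fun y => Max.max (2 * u y) 1 - 1) univ ≤
      tv μ (fun y => Max.max (2 * u y) 1) univ := by
    simpa [sub_eq_add_neg] using
      tv_affine_le (μ := μ) (u := fun y => Max.max (2 * u y) 1) (Ω := univ) 1 (-1)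
  rw [tv_const, add_zero] at h1
  refine (ENNReal.add_le_add_iff_left hfin).1 ?_
  calc _ ≤ tv μ (fun y => Min.min (2 * u y) 1) univ + tv μ (fun y => Max.max (2 * u y) 1) univ :=
        add_le_add h2 h4
    _ ≤ 2 * tv μ u univ := h1.trans h3
    _ = _ := two_mul _

theorem IsAdmissible.exists_minimizer_set (hw : IsAdmissible S Q w) (hfin : tv μ w univ ≠ ⊤) :
    ∃ E : Set X, IsAdmissible S Q (chi E) ∧ MeasurableSet E ∧
      ∀ v, IsAdmissible S Q v → tv μ (chi E) univ ≤ tv μ v univ := by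
  obtain ⟨u, hu, hmin⟩ := hw.exists_minimizer hfin
  have hufin : tv μ u univ ≠ ⊤ := ((hmin w hw).trans_lt hfin.lt_top).ne
  let f : ℕ → X → ℝ := fun n y => Max.max (1 - 2 ^ n * (1 - u y)) 0
  have hfs : ∀ n, f (n + 1) = fun y => Max.max (2 * f n y) 1 - 1 := by
    intro n
    ext y
    simp only [f, pow_succ]
    rcases le_total (1 - 2 ^ n * (1 - u y)) 0 with h | h
    · rw [max_eq_right h, max_eq_right, max_eq_right]
      · ring
      · norm_num
      · linarith
    · rw [max_eq_left h]
      rcases le_total (1 - 2 ^ n * 2 * (1 - u y)) 0 with h' | h'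
      · rw [max_eq_right h', max_eq_right]
        · ring
        · linarith
      · rw [max_eq_left h', max_eq_left]
        · ring
        · linarith
  have hf : ∀ n, IsAdmissible S Q (f n) ∧ tv μ (f n) univ ≤ tv μ u univ := by
    intro n
    induction n with
    | zero =>
      have : f 0 = u := by ext y; simp [f, hu.nonneg y]
      rw [this]
      exact ⟨hu, le_rfl⟩
    | succ n ih =>
      have heq : tv μ (f n) univ = tv μ u univ := le_antisymm ih.2 (hmin _ ih.1)
      rw [hfs]
      exact ⟨ih.1.truncate, (ih.1.tv_truncate_le (heq ▸ hufin)
        (fun v hv => heq ▸ hmin v hv)).trans ih.2⟩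
  have hlim : ∀ y, Tendsto (fun n => f n y) atTop (𝓝 (chi {y | u y = 1} y)) := by
    intro y
    rcases (hu.le_one y).eq_or_lt with h | h
    · have : ∀ n, f n y = 1 := fun n => by simp [f, h]
      simp [this, chi, h]
    · rw [chi, indicator_of_notMem (show y ∉ {y | u y = 1} from h.ne)]
      refine tendsto_const_nhds.congr' ?_
      obtain ⟨N, hN⟩ := pow_unbounded_of_one_lt (1 / (1 - u y)) (one_lt_two (α := ℝ))
      filter_upwards [eventually_ge_atTop N] with n hn
      have h1 : (2 : ℝ) ^ N ≤ 2 ^ n := pow_le_pow_right₀ one_le_two hn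
      have h2 := (div_le_iff₀ (by linarith)).1 (hN.le.trans h1)
      exact (max_eq_right (by linarith)).symm
  refine ⟨{y | u y = 1}, .of_tendsto (fun n => (hf n).1) hlim,
    hu.measurable (measurableSet_singleton 1), fun v hv => le_trans ?_ (hmin v hv)⟩
  exact IsAdmissible.tv_le_of_tendsto (fun n => (hf n).1) hlim fun n => (hf n).2

end Minimizer

section Localization

theorem sum_indicator_shells_le {t h : ℝ} (hh : 0 < h) (N : ℕ) :
    ∑ j ∈ Finset.range N, ((if t < (j + 1) * h then (1 : ℝ≥0∞) else 0) +
      if j * h < t then 1 else 0) ≤ N + 1 := by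
  calc _ ≤ ∑ j ∈ Finset.range N, (1 + if j = ⌊t / h⌋₊ then (1 : ℝ≥0∞) else 0) := by
        refine Finset.sum_le_sum fun j _ => ?_
        by_cases h1 : t < (j + 1) * h <;> by_cases h2 : j * h < t
        · have h0 : 0 ≤ t / h := div_nonneg ((by positivity : 0 ≤ j * h).trans h2.le) hh.le
          have : j = ⌊t / h⌋₊ :=
            ((Nat.floor_eq_iff h0).2 ⟨(le_div_iff₀ hh).2 h2.le, (div_lt_iff₀ hh).2 h1⟩).symm
          simp [h1, h2, this.symm]
        · simp [h1, h2]
        · simp [h1, h2]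
        · simp [h1, h2]
    _ ≤ N + 1 := by
        rw [Finset.sum_add_distrib, Finset.sum_ite_eq']
        refine add_le_add (by simp) ?_
        split_ifs <;> simp

variable [ProperSpace X] [BorelSpace X] {μ : Measure X} [IsFiniteMeasureOnCompacts μ]
  {u v : X → ℝ} {K : Set X}

theorem tv_univ_le_of_eq_off (hK : IsCompact K) (hne : K.Nonempty) (hu : AEMeasurable u μ)
    (hv : AEMeasurable v μ) (heq : ∀ y, y ∉ K → v y = u y) {s t : ℝ} (hs : 0 ≤ s) (hst : s < t) :
    tv μ v univ ≤ tv μ v {y | infDist y K < t} + tv μ u {y | s < infDist y K} := by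
  have hab : (2 * s + t) / 3 < (s + 2 * t) / 3 := by linarith
  have hpos : ∀ y, (2 * s + t) / 3 ≤ infDist y K → v y = u y := fun y hy =>
    heq y fun hyK => by rw [infDist_zero_of_mem hyK] at hy; linarith
  have hcpt : IsCompact {y | (2 * s + t) / 3 ≤ infDist y K ∧ infDist y K ≤ (s + 2 * t) / 3} := by
    refine (isCompact_of_isClosed_isBounded isClosed_cthickening
      (hK.isBounded.cthickening (δ := (s + 2 * t) / 3))).of_isClosed_subset ?_ ?_
    · exact (isClosed_le continuous_const (continuous_infDist_pt K)).inter
        (isClosed_le (continuous_infDist_pt K) continuous_const)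
    · intro y hy
      rw [cthickening_eq_preimage_infEDist, mem_preimage, mem_Iic, ← ENNReal.ofReal_toReal
        (infEDist_ne_top hne)]
      exact ENNReal.ofReal_le_ofReal hy.2
  have key := tv_glue_le hv hu (lipschitz_infDist_pt K) (show s < (2 * s + t) / 3 by linarith) hab
    (show (s + 2 * t) / 3 < t by linarith) hcpt
  have hg : glue (fun y => infDist y K) ((2 * s + t) / 3) ((s + 2 * t) / 3) v u = v := by
    ext y
    rcases le_total (infDist y K) ((2 * s + t) / 3) with h | h
    · exact glue_of_le hab h
    · have := glue_self (fun y => infDist y K) ((2 * s + t) / 3) ((s + 2 * t) / 3) v y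
      simpa [glue, hpos y h] using this
  have h0 : ∫⁻ y in {y | (2 * s + t) / 3 ≤ infDist y K ∧ infDist y K ≤ (s + 2 * t) / 3},
      ENNReal.ofReal |v y - u y| ∂μ = 0 := by
    rw [setLIntegral_congr_fun hcpt.measurableSet (g := fun _ => 0)
      (fun y hy => by simp [hpos y hy.1])]
    simp
  rwa [h0, mul_zero, add_zero, hg] at key

theorem tvs_le_tvs_of_tv_le (hK : IsCompact K) (hu : AEMeasurable u μ)
    (hv : AEMeasurable v μ) (heq : ∀ y, y ∉ K → v y = u y) (hfin : tv μ u univ ≠ ⊤)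
    (hle : tv μ u univ ≤ tv μ v univ) : tvs μ u K ≤ tvs μ v K := by
  rcases K.eq_empty_or_nonempty with rfl | hne
  · rw [show v = u from funext fun y => heq y (notMem_empty y)]
  refine le_iInf fun U => le_iInf fun hU => le_iInf fun hKU => ?_
  obtain ⟨δ, hδ, hδU⟩ := hK.exists_thickening_subset_open hU hKU
  have hsub : ∀ t ≤ δ, {y | infDist y K < t} ⊆ U := fun t ht y hy =>
    hδU (by rw [thickening_eq_preimage_infEDist, mem_preimage, mem_Iio, ← ENNReal.ofReal_toReal
      (infEDist_ne_top hne)]; exact (ENNReal.ofReal_lt_ofReal_iff hδ).2 (lt_of_lt_of_le hy ht))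
  have hopen : ∀ t, IsOpen {y | infDist y K < t} := fun t =>
    isOpen_lt (continuous_infDist_pt K) continuous_const
  have hopen' : ∀ t, IsOpen {y | t < infDist y K} := fun t =>
    isOpen_lt continuous_const (continuous_infDist_pt K)
  have hN : ∀ N : ℕ, (N : ℝ≥0∞) * tvs μ u K ≤ N * tv μ v U + tv μ u univ := by
    intro N
    have hh : 0 < δ / (N + 1) := by positivity
    set h := δ / (N + 1) with hhdef
    have hjle : ∀ j ∈ Finset.range N, (j + 1) * h ≤ δ := by
      intro j hj
      rw [hhdef, mul_div_assoc', div_le_iff₀ (by positivity)]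
      have : (j : ℝ) + 1 ≤ N := by exact_mod_cast Finset.mem_range.1 hj
      nlinarith
    have h1 : ∑ j ∈ Finset.range N, (tv μ u {y | infDist y K < (j + 1) * h} +
        tv μ u {y | j * h < infDist y K}) ≤ (N + 1 : ℕ) * tv μ u univ := by
      have := sum_tv_le (μ := μ) (u := u) (Ω := univ) (Finset.range N ×ˢ (Finset.univ : Finset Bool))
        (fun p => cond p.2 {y | infDist y K < (p.1 + 1) * h} {y | p.1 * h < infDist y K})
        (fun p _ => by rcases p with ⟨j, _ | _⟩ <;> simp [hopen, hopen'])
        (fun _ _ => subset_univ _) (N + 1) (fun y => by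
          rw [Finset.sum_product]
          simpa [indicator_apply] using sum_indicator_shells_le (t := infDist y K) hh N)
      rw [Finset.sum_product] at this
      simpa using this
    have h2 : (N : ℝ≥0∞) * tv μ u univ ≤
        N * tv μ v U + ∑ j ∈ Finset.range N, tv μ u {y | j * h < infDist y K} := by
      have : ∑ j ∈ Finset.range N, tv μ u univ ≤ ∑ j ∈ Finset.range N,
          (tv μ v U + tv μ u {y | j * h < infDist y K}) := by
        refine Finset.sum_le_sum fun j hj => hle.trans ?_
        refine (tv_univ_le_of_eq_off hK hne hu hv heq (s := j * h) (t := (j + 1) * h)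
          (by positivity) (by linarith)).trans ?_
        exact add_le_add_left (tv_mono (hsub _ (hjle j hj))) _
      simpa [Finset.sum_add_distrib] using this
    have h3 : (N : ℝ≥0∞) * tvs μ u K ≤
        ∑ j ∈ Finset.range N, tv μ u {y | infDist y K < (j + 1) * h} := by
      have : ∑ j ∈ Finset.range N, tvs μ u K ≤
          ∑ j ∈ Finset.range N, tv μ u {y | infDist y K < (j + 1) * h} := by
        refine Finset.sum_le_sum fun j hj => iInf_le_of_le _ (iInf₂_le (hopen _) fun y hy => ?_)
        rw [mem_ofPred_eq, infDist_zero_of_mem hy]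
        positivity
      simpa using this
    refine (ENNReal.add_le_add_iff_right (ENNReal.mul_ne_top (ENNReal.natCast_ne_top N) hfin)).1 ?_
    calc _ ≤ N * tvs μ u K + (N * tv μ v U +
            ∑ j ∈ Finset.range N, tv μ u {y | j * h < infDist y K}) := add_le_add_right h2 _
      _ ≤ ∑ j ∈ Finset.range N, tv μ u {y | infDist y K < (j + 1) * h} + (N * tv μ v U +
            ∑ j ∈ Finset.range N, tv μ u {y | j * h < infDist y K}) := add_le_add_left h3 _
      _ = N * tv μ v U + ∑ j ∈ Finset.range N, (tv μ u {y | infDist y K < (j + 1) * h} +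
            tv μ u {y | j * h < infDist y K}) := by rw [Finset.sum_add_distrib]; ring
      _ ≤ N * tv μ v U + (N + 1 : ℕ) * tv μ u univ := add_le_add_right h1 _
      _ = _ := by push_cast; ring
  by_contra! hlt
  have hKfin : tvs μ u K ≠ ⊤ := ne_top_of_le_ne_top hfin
    (iInf_le_of_le univ (iInf₂_le isOpen_univ (subset_univ _)))
  have hvfin : tv μ v U ≠ ⊤ := hlt.ne_top
  have hlt' := (ENNReal.toReal_lt_toReal hvfin hKfin).2 hlt
  obtain ⟨N, hN'⟩ := exists_nat_gt ((tv μ u univ).toReal / ((tvs μ u K).toReal - (tv μ v U).toReal))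
  have h4 := ENNReal.toReal_mono (ENNReal.add_ne_top.2
    ⟨ENNReal.mul_ne_top (ENNReal.natCast_ne_top N) hvfin, hfin⟩) (hN N)
  rw [ENNReal.toReal_add (ENNReal.mul_ne_top (ENNReal.natCast_ne_top N) hvfin) hfin,
    ENNReal.toReal_mul, ENNReal.toReal_mul, ENNReal.toReal_natCast] at h4
  rw [div_lt_iff₀ (sub_pos.2 hlt')] at hN'
  linarith

end Localization

section Superminimizer

variable {S Q : Set X} {μ : Measure X} {u : X → ℝ}

theorem IsAdmissible.integrable (hu : IsAdmissible S Q u) (hQ : MeasurableSet Q)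
    (hQfin : μ Q ≠ ⊤) : Integrable u μ := by
  have h1 : Integrable (Q.indicator fun _ => (1 : ℝ)) μ :=
    (integrable_indicator_iff hQ).2 (integrableOn_const hQfin)
  refine h1.mono' hu.measurable.aestronglyMeasurable (Eventually.of_forall fun y => ?_)
  rw [Real.norm_eq_abs, abs_of_nonneg (hu.nonneg y)]
  by_cases hy : y ∈ Q
  · simpa [hy] using hu.le_one y
  · simp [hy, hu.eq_zero y hy]

theorem MemBV.memBVloc (hu : MemBV μ u univ) {Ω : Set X} (hΩ : IsOpen Ω) : MemBVloc μ u Ω :=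
  fun _ _ hKΩ => ⟨Ω, hΩ, hKΩ, subset_rfl, hu.1.mono_set (subset_univ Ω),
    (tv_mono (subset_univ Ω)).trans_lt hu.2⟩

variable [ProperSpace X] [BorelSpace X] [IsFiniteMeasureOnCompacts μ]

theorem IsAdmissible.tv_le_tv_add (hu : IsAdmissible S Q u)
    (hmin : ∀ v, IsAdmissible S Q v → tv μ u univ ≤ tv μ v univ) {φ : X → ℝ}
    (hφ : AEMeasurable φ μ) (hφ0 : ∀ y, 0 ≤ φ y) (hsupp : tsupport φ ⊆ Q) :
    tv μ u univ ≤ tv μ (fun y => u y + φ y) univ := by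
  let w : X → ℝ := (tsupport φ).indicator fun y => Max.max (hφ.mk φ y) 0
  have hwm : Measurable w :=
    (hφ.measurable_mk.max measurable_const).indicator (isClosed_tsupport φ).measurableSet
  have hw0 : ∀ y, 0 ≤ w y := fun y => indicator_nonneg (fun _ _ => le_max_right _ _) y
  have hφw : (fun y => u y + φ y) =ᵐ[μ] fun y => u y + w y := by
    filter_upwards [hφ.ae_eq_mk] with y hy
    by_cases h : y ∈ tsupport φ
    · simp only [w, indicator_of_mem h, ← hy, max_eq_left (hφ0 y)]
    · simp only [w, indicator_of_notMem h, image_eq_zero_of_notMem_tsupport h]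
  have hadm : IsAdmissible S Q fun y => Min.min (u y + w y) 1 := by
    refine ⟨(hu.measurable.add hwm).min measurable_const,
      fun y => le_min (add_nonneg (hu.nonneg y) (hw0 y)) zero_le_one, fun y => min_le_right _ _,
      fun y hy => ?_, fun y hy => ?_⟩
    · rw [hu.eq_one y hy]
      exact min_eq_right (le_add_of_nonneg_right (hw0 y))
    · rw [hu.eq_zero y hy, show w y = 0 from indicator_of_notMem (fun h => hy (hsupp h)) _]
      simp
  calc tv μ u univ ≤ tv μ (fun y => Min.min (u y + w y) 1) univ := hmin _ hadm
    _ ≤ tv μ (fun y => u y + w y) univ + tv μ (fun _ => (1 : ℝ)) univ :=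
        le_self_add.trans (tv_min_add_tv_max_le isOpen_univ
          (hu.measurable.add hwm).aemeasurable)
    _ = tv μ (fun y => u y + φ y) univ := by rw [tv_const, add_zero, tv_congr_ae hφw]

theorem IsAdmissible.isSuperminimizer (hu : IsAdmissible S Q u)
    (hmin : ∀ v, IsAdmissible S Q v → tv μ u univ ≤ tv μ v univ) (hBV : MemBV μ u univ)
    {Ω : Set X} (hΩ : IsOpen Ω) (hΩQ : Ω ⊆ Q) : IsSuperminimizer μ u Ω := by
  refine ⟨hBV.memBVloc hΩ, fun φ hφ hφ0 => ?_⟩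
  have hφm : AEMeasurable φ μ := by
    have h := (aemeasurable_indicator_iff hΩ.measurableSet).2 hφ.1.1.aemeasurable
    rwa [indicator_eq_self.2 ((subset_tsupport φ).trans hφ.2.2)] at h
  refine tvs_le_tvs_of_tv_le hφ.2.1 hu.measurable.aemeasurable
    (hu.measurable.aemeasurable.add hφm)
    (fun y hy => ?_) hBV.2.ne (hu.tv_le_tv_add hmin hφm hφ0 (hφ.2.2.trans hΩQ))
  rw [image_eq_zero_of_notMem_tsupport hy, add_zero]

end Superminimizer

section Decay

variable [BorelSpace X] {μ : Measure X} {Cd CP lam : ℝ}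

theorem MMS.lintegral_le_tv_univ (hX : MMS μ Cd CP lam) {f : X → ℝ} (hf : AEMeasurable f μ)
    {x z : X} {r : ℝ} (hr : 0 < r) (hz : z ∉ ball x (3 * r)) (h0 : ∀ y, y ∉ ball x r → f y = 0) :
    ∫⁻ y, ENNReal.ofReal |f y| ∂μ ≤
      ENNReal.ofReal ((1 + Cd ^ 3) * (CP * 4) * r) * tv μ f univ := by
  have hCd := hX.hCd
  obtain ⟨y, hy1, hy2⟩ := hX.exists_mem_annulus (x := x) (z := z) (a := 2 * r) (b := 3 * r)
    (by linarith) (by linarith) hz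
  have h1 := hX.lintegral_le_tv hf (y := x) (r := 4 * r) (by linarith) isOpen_univ (subset_univ _)
    (Z := ball y r) measurableSet_ball (ball_subset_ball' (by linarith))
    (fun w hw => h0 w fun hwx => by
      have := dist_triangle_left y x w
      rw [mem_ball] at hw hwx
      linarith) (M := Cd ^ 3) (by positivity)
    (by
      rw [ENNReal.ofReal_pow (by linarith)]
      refine hX.ball_le_of_dist hr ?_
      rw [dist_comm]
      linarith)
  rw [← lintegral_indicator measurableSet_ball, indicator_eq_self.2 ?_] at h1
  · convert h1 using 3
    ring
  · intro w hw
    by_contra hwx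
    exact hw (by simp [h0 w fun h => hwx (ball_subset_ball (by linarith) h)])

theorem lintegral_abs_chi {E : Set X} (hE : MeasurableSet E) (B : Set X) :
    ∫⁻ y in B, ENNReal.ofReal |chi E y| ∂μ = μ (E ∩ B) := by
  have : (fun y => ENNReal.ofReal |chi E y|) = E.indicator fun _ => 1 := by
    ext y
    by_cases hy : y ∈ E <;> simp [chi, hy]
  rw [this, lintegral_indicator hE, setLIntegral_one, Measure.restrict_apply hE]

/-- If `E` has density at most one half in all balls of radius `2σ` centred in `B(x,s/4)`, its
measure in `B(x,s/4)` is controlled by `σ` times its perimeter in `B(x,s/2)`. -/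
theorem MMS.measure_inter_le_perim (hX : MMS μ Cd CP lam) {E : Set X} (hE : MeasurableSet E)
    {x : X} {s σ : ℝ} (hs : 0 < s) (hσ : 0 < σ) (hσs : 4 * lam * σ ≤ s / 4)
    (hdens : ∀ z ∈ ball x (s / 4), 2 * μ (E ∩ ball z (2 * σ)) ≤ μ (ball z (2 * σ)))
    {n N : ℕ} (hn : 4 * (4 * lam) + 2 ≤ 2 ^ n) (hN : Cd ^ n ≤ N) :
    μ (E ∩ ball x (s / 4)) ≤
      ENNReal.ofReal (6 * CP * N * σ) * tv μ (chi E) (ball x (s / 2)) := by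
  have hlam := hX.hlam
  have hCP := hX.hCP
  have hEm : Measurable (chi E) := measurable_const.indicator hE
  obtain ⟨t, ht1, ht2, ht3⟩ := hX.exists_net x (R := s / 4) (by linarith) hσ
  have hsmall : ∀ z ∈ ball x (s / 4), μ (E ∩ ball z (2 * σ)) ≤
      ENNReal.ofReal (6 * CP * σ) * tv μ (chi E) (ball z (4 * lam * σ)) := by
    intro z hz
    have hfin := hX.ball_lt_top z (2 * σ)
    have h1 := hX.lintegral_le_tv (u := chi E) hEm.aemeasurable (y := z) (r := 2 * σ) (by linarith)
      (Ω := ball z (4 * lam * σ)) isOpen_ball (closedBall_subset_ball (by nlinarith))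
      (Z := ball z (2 * σ) \ E) (measurableSet_ball.diff hE) sdiff_subset
      (fun w hw => indicator_of_notMem hw.2 _) (M := 2) zero_le_two
      (by
        have h2 := measure_inter_add_sdiff (μ := μ) (ball z (2 * σ)) hE
        have h3 := hdens z hz
        have hI : μ (ball z (2 * σ) ∩ E) ≠ ⊤ := measure_ne_top_of_subset inter_subset_left hfin.ne
        rw [ENNReal.ofReal_ofNat]
        rw [← h2, two_mul (μ (E ∩ _)), inter_comm E] at h3
        have h4 := (ENNReal.add_le_add_iff_left hI).1 h3
        rw [← h2, two_mul (μ (ball z (2 * σ) \ E))]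
        exact add_le_add_left h4 _)
    rw [lintegral_abs_chi hE] at h1
    convert h1 using 3
    ring
  calc μ (E ∩ ball x (s / 4)) ≤ μ (⋃ z ∈ t, E ∩ ball z (2 * σ)) := by
        refine measure_mono fun y hy => ?_
        obtain ⟨z, hz, hyz⟩ := ht3 y hy.2
        exact mem_biUnion hz ⟨hy.1, by rw [mem_ball]; linarith⟩
    _ ≤ ∑ z ∈ t, μ (E ∩ ball z (2 * σ)) := measure_biUnion_finset_le _ _
    _ ≤ ∑ z ∈ t, ENNReal.ofReal (6 * CP * σ) * tv μ (chi E) (ball z (4 * lam * σ)) :=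
        Finset.sum_le_sum fun z hz => hsmall z (ht1 z hz)
    _ = ENNReal.ofReal (6 * CP * σ) * ∑ z ∈ t, tv μ (chi E) (ball z (4 * lam * σ)) :=
        (Finset.mul_sum _ _ _).symm
    _ ≤ ENNReal.ofReal (6 * CP * σ) * (N * tv μ (chi E) (ball x (s / 2))) := by
        refine mul_le_mul_right (sum_tv_le t _ (fun _ _ => isOpen_ball) (fun z hz => ?_) N
          (hX.sum_indicator_ball_le (by linarith) hσ hn hN ht2)) _
        have := mem_ball.1 (ht1 z hz)
        exact ball_subset_ball' (by linarith)
    _ = _ := by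
        rw [← mul_assoc, ← ENNReal.ofReal_natCast, ← ENNReal.ofReal_mul (by positivity)]
        congr 2
        ring

end Decay

section Caccioppoli

variable [ProperSpace X] [BorelSpace X] {μ : Measure X} [IsFiniteMeasureOnCompacts μ]
  {S Q : Set X} {u v : X → ℝ} {x : X} {s : ℝ}

theorem IsAdmissible.tv_ball_le (hu : IsAdmissible S Q u)
    (hmin : ∀ v, IsAdmissible S Q v → tv μ u univ ≤ tv μ v univ) (hfin : tv μ u univ ≠ ⊤)
    (hs : 0 < s) (hQ : ball x s ⊆ Q) {Q' : Set X} (hv : IsAdmissible (S ∩ ball x s) Q' v) :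
    tv μ u (ball x (s / 2)) ≤ tv μ v univ +
      ENNReal.ofReal (4 / s) * ∫⁻ y in ball x s, ENNReal.ofReal |v y - u y| ∂μ := by
  have hab : 5 * s / 8 < 7 * s / 8 := by linarith
  have hρ : LipschitzWith 1 fun y => dist y x := LipschitzWith.dist_left x
  have hT : {y | 5 * s / 8 ≤ dist y x ∧ dist y x ≤ 7 * s / 8} ⊆ ball x s := fun y hy => by
    rw [mem_ball]; linarith [hy.2]
  have hcpt : IsCompact {y | 5 * s / 8 ≤ dist y x ∧ dist y x ≤ 7 * s / 8} :=
    (isCompact_closedBall x (7 * s / 8)).of_isClosed_subset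
      ((isClosed_le continuous_const hρ.continuous).inter
        (isClosed_le hρ.continuous continuous_const)) fun y hy => hy.2
  have hcut : Measurable (cutoff (fun y => dist y x) (5 * s / 8) (7 * s / 8)) := by
    unfold cutoff; fun_prop
  have hc0 : ∀ y, 0 ≤ cutoff (fun y => dist y x) (5 * s / 8) (7 * s / 8) y := fun y =>
    cutoff_nonneg _ _ _ y
  have hc1 : ∀ y, cutoff (fun y => dist y x) (5 * s / 8) (7 * s / 8) y ≤ 1 := fun y =>
    cutoff_le_one _ _ _ y
  have hadm : IsAdmissible S Q (glue (fun y => dist y x) (5 * s / 8) (7 * s / 8) v u) := by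
    refine ⟨?_, fun y => ?_, fun y => ?_, fun y hy => ?_, fun y hy => ?_⟩
    · exact (hcut.mul hv.measurable).add ((measurable_const.sub hcut).mul hu.measurable)
    · exact add_nonneg (mul_nonneg (hc0 y) (hv.nonneg y))
        (mul_nonneg (sub_nonneg.2 (hc1 y)) (hu.nonneg y))
    · simp only [glue]
      nlinarith [hc0 y, hc1 y, hv.le_one y, hu.le_one y]
    · by_cases hys : y ∈ ball x s
      · simp only [glue, hu.eq_one y hy, hv.eq_one y ⟨hy, hys⟩]
        ring
      · rw [glue_of_ge hab (by rw [mem_ball] at hys; linarith), hu.eq_one y hy]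
    · rw [glue_of_ge hab (by linarith [not_lt.1 fun h => hy (hQ (mem_ball.2 h))]),
        hu.eq_zero y hy]
  have h1 := (hmin _ hadm).trans (tv_glue_le hv.measurable.aemeasurable hu.measurable.aemeasurable
    hρ (show s / 2 < 5 * s / 8 by linarith) hab (show 7 * s / 8 < s by linarith) hcpt)
  have h2 : tv μ u (ball x (s / 2)) + tv μ u {y | s / 2 < dist y x} ≤ tv μ u univ :=
    tv_add_tv_le isOpen_ball (isOpen_lt continuous_const hρ.continuous) (subset_univ _)
      (subset_univ _) (disjoint_left.2 fun y hy hy' => (mem_ball.1 hy).not_gt hy')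
  have h3 : tv μ u {y | s / 2 < dist y x} ≠ ⊤ := ne_top_of_le_ne_top hfin (tv_mono (subset_univ _))
  refine (ENNReal.add_le_add_iff_right h3).1 ((h2.trans h1).trans ?_)
  rw [add_right_comm, show 1 / (7 * s / 8 - 5 * s / 8) = 4 / s by field_simp; norm_num]
  exact add_le_add_left (add_le_add (tv_mono (subset_univ _))
    (mul_le_mul_right (lintegral_mono_set hT) _)) _

variable {Cd CP lam : ℝ}

theorem MMS.exists_decay (hX : MMS μ Cd CP lam) :
    ∃ d C : ℝ, 0 < d ∧ 0 < C ∧ ∀ {E S Q : Set X} {x z : X} {s e D : ℝ} {v : X → ℝ},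
      IsAdmissible S Q (chi E) → MeasurableSet E →
      (∀ v, IsAdmissible S Q v → tv μ (chi E) univ ≤ tv μ v univ) → tv μ (chi E) univ ≠ ⊤ →
      0 < s → ball x s ⊆ Q → IsAdmissible (S ∩ ball x s) (ball x (4 * s)) v →
      z ∉ ball x (12 * s) → 0 ≤ e → 0 ≤ D → D ≤ d →
      tv μ v univ ≤ ENNReal.ofReal (e / s) * μ (ball x s) →
      μ (E ∩ ball x s) ≤ ENNReal.ofReal D * μ (ball x s) →
      μ (E ∩ ball x (s / 4)) ≤ ENNReal.ofReal (C * e + D / 4) * μ (ball x (s / 4)) := by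
  have hCd := hX.hCd
  have hCP := hX.hCP
  have hlam := hX.hlam
  obtain ⟨n, hn⟩ := pow_unbounded_of_one_lt (4 * (4 * lam) + 2) (one_lt_two (α := ℝ))
  obtain ⟨N, hN⟩ := exists_nat_ge (Cd ^ n)
  obtain ⟨m, hm⟩ := pow_unbounded_of_one_lt (max (16 * lam) (96 * CP * N * Cd ^ 2))
    (one_lt_two (α := ℝ))
  have hm1 := (le_max_left _ _).trans hm.le
  have hm2 := (le_max_right _ _).trans hm.le
  set K : ℝ := (1 + Cd ^ 3) * (CP * 4) with hK
  have hK0 : 0 < K := by positivity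
  refine ⟨1 / (2 * Cd ^ m), 1 + 16 * K, by positivity, by positivity, ?_⟩
  intro E S Q x z s e D v hE hEm hmin hfin hs hQ hv hz he hD hDd hvtv hDE
  have hpow : (0 : ℝ) < 2 ^ m := by positivity
  set σ : ℝ := s / 2 ^ m with hσ
  have hσ0 : 0 < σ := by positivity
  have hσm : 2 ^ m * σ = s := by rw [hσ]; field_simp
  have hσs : 4 * lam * σ ≤ s / 4 := by nlinarith
  have hσ4 : σ ≤ s / 16 := by nlinarith
  have hP := hX.measure_inter_le_perim hEm (x := x) hs hσ0 hσs (fun y hy => ?_) hn.le hN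
  swap
  · have hB : μ (ball x s) ≤ ENNReal.ofReal Cd ^ m * μ (ball y (2 * σ)) := by
      refine hX.ball_le_of_dist (by linarith) ?_
      rw [mem_ball, dist_comm] at hy
      linarith
    have hsub : ball y (2 * σ) ⊆ ball x s := by
      rw [mem_ball] at hy
      exact ball_subset_ball' (by linarith)
    calc 2 * μ (E ∩ ball y (2 * σ)) ≤ 2 * (ENNReal.ofReal (1 / (2 * Cd ^ m)) *
          (ENNReal.ofReal Cd ^ m * μ (ball y (2 * σ)))) :=
          mul_le_mul_right ((measure_mono (inter_subset_inter_right _ hsub)).trans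
            (hDE.trans (mul_le_mul' (ENNReal.ofReal_le_ofReal hDd) hB))) _
      _ = ENNReal.ofReal (2 * (1 / (2 * Cd ^ m)) * Cd ^ m) * μ (ball y (2 * σ)) := by
          rw [ENNReal.ofReal_mul (by positivity), ENNReal.ofReal_mul (by positivity),
            ENNReal.ofReal_ofNat, ENNReal.ofReal_pow (by linarith)]
          ring
      _ = μ (ball y (2 * σ)) := by
          rw [show 2 * (1 / (2 * Cd ^ m)) * Cd ^ m = 1 by field_simp]
          simp
  have hint : ∫⁻ y in ball x s, ENNReal.ofReal |v y - chi E y| ∂μ ≤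
      ENNReal.ofReal (4 * K * s) * tv μ v univ + μ (E ∩ ball x s) := by
    calc _ ≤ ∫⁻ y in ball x s, (ENNReal.ofReal |v y| + ENNReal.ofReal |chi E y|) ∂μ := by
          refine lintegral_mono fun y => ?_
          rw [← ENNReal.ofReal_add (abs_nonneg _) (abs_nonneg _)]
          exact ENNReal.ofReal_le_ofReal (abs_sub _ _)
      _ = ∫⁻ y in ball x s, ENNReal.ofReal |v y| ∂μ + μ (E ∩ ball x s) := by
          rw [lintegral_add_left (by have := hv.measurable; fun_prop), lintegral_abs_chi hEm]
      _ ≤ _ := by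
          refine add_le_add_left ((setLIntegral_le_lintegral _ _).trans ?_) _
          have := hX.lintegral_le_tv_univ hv.measurable.aemeasurable (x := x) (z := z)
            (r := 4 * s) (by linarith) (by rwa [show 3 * (4 * s) = 12 * s by ring]) hv.eq_zero
          rwa [show K * (4 * s) = 4 * K * s by ring] at this
  have hB2 : μ (ball x s) ≤ ENNReal.ofReal Cd ^ 2 * μ (ball x (s / 4)) :=
    hX.ball_le_of_dist (by linarith) (by simp; linarith)
  calc μ (E ∩ ball x (s / 4))
      ≤ ENNReal.ofReal (6 * CP * N * σ) * (tv μ v univ + ENNReal.ofReal (4 / s) *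
        (ENNReal.ofReal (4 * K * s) * tv μ v univ + μ (E ∩ ball x s))) :=
        hP.trans (mul_le_mul_right ((hE.tv_ball_le hmin hfin hs hQ hv).trans
          (add_le_add_right (mul_le_mul_right hint _) _)) _)
    _ ≤ ENNReal.ofReal (6 * CP * N * σ) * (ENNReal.ofReal (e / s) * μ (ball x s) +
        ENNReal.ofReal (4 / s) * (ENNReal.ofReal (4 * K * s) *
          (ENNReal.ofReal (e / s) * μ (ball x s)) + ENNReal.ofReal D * μ (ball x s))) := by
        gcongr
    _ = ENNReal.ofReal (6 * CP * N * σ * (e / s + 4 / s * (4 * K * s * (e / s) + D))) *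
        μ (ball x s) := by
        rw [ENNReal.ofReal_mul (p := 6 * CP * N * σ) (by positivity),
          ENNReal.ofReal_add (p := e / s) (by positivity) (by positivity),
          ENNReal.ofReal_mul (p := 4 / s) (by positivity),
          ENNReal.ofReal_add (p := 4 * K * s * (e / s)) (by positivity) (by positivity),
          ENNReal.ofReal_mul (p := 4 * K * s) (by positivity)]
        ring
    _ ≤ ENNReal.ofReal (6 * CP * N * σ * (e / s + 4 / s * (4 * K * s * (e / s) + D))) *
        (ENNReal.ofReal Cd ^ 2 * μ (ball x (s / 4))) := mul_le_mul_right hB2 _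
    _ = ENNReal.ofReal (6 * CP * N * Cd ^ 2 / 2 ^ m * ((1 + 16 * K) * e + 4 * D)) *
        μ (ball x (s / 4)) := by
        rw [← mul_assoc, ← ENNReal.ofReal_pow (by linarith), ← ENNReal.ofReal_mul (by positivity)]
        congr 2
        rw [hσ]
        field_simp
        ring
    _ ≤ _ := by
        refine mul_le_mul_left (ENNReal.ofReal_le_ofReal ?_) _
        have h16 : 6 * CP * N * Cd ^ 2 / 2 ^ m ≤ 1 / 16 := by
          rw [div_le_iff₀ hpow]
          linarith
        have h0 : 0 ≤ (1 + 16 * K) * e := by positivity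
        nlinarith

end Caccioppoli

section Density

theorem tendsto_zero_of_le_add_quarter {a b : ℕ → ℝ} (ha : ∀ i, 0 ≤ a i)
    (hab : ∀ i, a (i + 1) ≤ b i + a i / 4) (hb : Tendsto b atTop (𝓝 0)) :
    Tendsto a atTop (𝓝 0) := by
  refine (tendsto_order.2 ⟨fun c hc => Eventually.of_forall fun i => hc.trans_le (ha i),
    fun ε hε => ?_⟩)
  obtain ⟨N, hN⟩ := eventually_atTop.1 (hb.eventually (gt_mem_nhds (show 0 < ε / 4 by linarith)))
  have hind : ∀ k, a (N + k) ≤ ε / 3 + a N / 4 ^ k := by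
    intro k
    induction k with
    | zero => simp; linarith
    | succ k ih =>
      have h1 := hab (N + k)
      have h2 := hN (N + k) (by lia)
      rw [← add_assoc, pow_succ, ← div_div]
      linarith
  have hlim : Tendsto (fun k : ℕ => ε / 3 + a N / 4 ^ k) atTop (𝓝 (ε / 3 + 0)) :=
    tendsto_const_nhds.add (tendsto_const_nhds.div_atTop
      (tendsto_pow_atTop_atTop_of_one_lt (by norm_num)))
  obtain ⟨M, hM⟩ := eventually_atTop.1
    (hlim.eventually (gt_mem_nhds (show ε / 3 + 0 < ε by linarith)))
  filter_upwards [eventually_ge_atTop (N + M)] with i hi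
  obtain ⟨k, rfl⟩ := Nat.exists_eq_add_of_le (show N ≤ i by lia)
  exact (hind k).trans_lt (hM k (by lia))

variable [BorelSpace X] {μ : Measure X} {Cd CP lam : ℝ} {E : Set X} {x : X}

theorem MMS.tendsto_density (hX : MMS μ Cd CP lam) {R : ℝ} (hR : 0 < R) {D : ℕ → ℝ}
    (hD : Tendsto D atTop (𝓝 0))
    (h : ∀ i, μ (E ∩ ball x (R / 4 ^ i)) ≤ ENNReal.ofReal (D i) * μ (ball x (R / 4 ^ i))) :
    Tendsto (fun r => μ (E ∩ ball x r) / μ (ball x r)) (𝓝[>] 0) (𝓝 0) := by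
  have hCd := hX.hCd
  have hs : Tendsto (fun i : ℕ => R / 4 ^ i) atTop (𝓝 0) :=
    tendsto_const_nhds.div_atTop (tendsto_pow_atTop_atTop_of_one_lt (by norm_num))
  have hlim : Tendsto (fun i => ENNReal.ofReal (D i * Cd ^ 2)) atTop (𝓝 0) := by
    simpa using ENNReal.tendsto_ofReal (hD.mul_const (Cd ^ 2))
  refine ENNReal.tendsto_nhds_zero.2 fun ε hε => ?_
  obtain ⟨I, hI⟩ := eventually_atTop.1 (ENNReal.tendsto_nhds_zero.1 hlim ε hε)
  filter_upwards [Ioo_mem_nhdsGT (show 0 < R / 4 ^ I by positivity)] with r hr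
  have hex : ∃ j : ℕ, R / 4 ^ j ≤ r := ((hs.eventually (gt_mem_nhds hr.1)).exists).imp
    fun _ h => h.le
  classical
  have hj := Nat.find_spec hex
  have hjm : ∀ k < Nat.find hex, r < R / 4 ^ k := fun k hk => not_le.1 (Nat.find_min hex hk)
  have hIj : I < Nat.find hex := by
    by_contra! hle
    have : R / 4 ^ I ≤ R / 4 ^ Nat.find hex :=
      div_le_div_of_nonneg_left hR.le (by positivity) (pow_le_pow_right₀ (by norm_num) hle)
    linarith [hr.2]
  obtain ⟨i, hi⟩ : ∃ i, Nat.find hex = i + 1 := ⟨_, (Nat.succ_pred_eq_of_pos (by lia)).symm⟩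
  rw [hi] at hj hjm hIj
  refine ENNReal.div_le_of_le_mul ?_
  calc μ (E ∩ ball x r) ≤ μ (E ∩ ball x (R / 4 ^ i)) :=
        measure_mono (inter_subset_inter_right _ (ball_subset_ball (hjm i (by lia)).le))
    _ ≤ ENNReal.ofReal (D i) * μ (ball x (R / 4 ^ i)) := h i
    _ ≤ ENNReal.ofReal (D i) * (ENNReal.ofReal Cd ^ 2 * μ (ball x r)) := by
        refine mul_le_mul_right (hX.ball_le_of_dist hr.1 ?_) _
        rw [pow_succ, ← div_div] at hj
        rw [dist_self]
        linarith
    _ = ENNReal.ofReal (D i * Cd ^ 2) * μ (ball x r) := by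
        rw [ENNReal.ofReal_mul' (by positivity), ENNReal.ofReal_pow (by linarith), mul_assoc]
    _ ≤ ε * μ (ball x r) := mul_le_mul_left (hI i (by lia)) _

theorem MMS.not_tendsto_measure_ball_div (hX : MMS μ Cd CP lam) (x : X) {F : Set X}
    (hF : F ∈ 𝓝 x) :
    ¬ Tendsto (fun r => μ (F ∩ ball x r) / μ (ball x r)) (𝓝[>] 0) (𝓝 0) := by
  intro h
  obtain ⟨δ, hδ, hsub⟩ := Metric.mem_nhds_iff.1 hF
  have h1 : (fun r => μ (F ∩ ball x r) / μ (ball x r)) =ᶠ[𝓝[>] 0] fun _ => 1 := by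
    filter_upwards [Ioo_mem_nhdsGT hδ] with r hr
    rw [inter_eq_right.2 ((ball_subset_ball hr.2.le).trans hsub)]
    exact ENNReal.div_self (hX.ball_pos x hr.1).ne' (hX.ball_lt_top x r).ne
  exact one_ne_zero (tendsto_nhds_unique (tendsto_const_nhds.congr' h1.symm) h)

theorem MMS.upperApprox_chi_eq_zero (hX : MMS μ Cd CP lam)
    (h : Tendsto (fun r => μ (E ∩ ball x r) / μ (ball x r)) (𝓝[>] 0) (𝓝 0)) :
    upperApprox μ (chi E) x = 0 := by
  refine le_antisymm (sInf_le ⟨0, ?_, rfl⟩) (le_sInf ?_)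
  · have : {y | 0 < chi E y} = E := by
      ext y
      by_cases hy : y ∈ E <;> simp [chi, hy]
    rwa [mem_ofPred_eq, this]
  · rintro _ ⟨t, ht, rfl⟩
    by_contra! hlt
    have ht0 : t < 0 := by exact_mod_cast hlt
    refine hX.not_tendsto_measure_ball_div x (F := {y | t < chi E y}) ?_ ht
    rw [show {y | t < chi E y} = univ from eq_univ_of_forall fun y =>
      ht0.trans_le (indicator_nonneg (fun _ _ => zero_le_one) y)]
    exact univ_mem

theorem MMS.lowerApprox_chi_eq_one (hX : MMS μ Cd CP lam) (h : E ∈ 𝓝 x) :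
    lowerApprox μ (chi E) x = 1 := by
  refine le_antisymm (sSup_le ?_) (le_sSup ⟨1, ?_, rfl⟩)
  · rintro _ ⟨t, ht, rfl⟩
    by_contra! hlt
    have ht1 : 1 < t := by exact_mod_cast hlt
    refine hX.not_tendsto_measure_ball_div x (F := {y | chi E y < t}) ?_ ht
    rw [show {y | chi E y < t} = univ from eq_univ_of_forall fun y =>
      (indicator_le_self' (fun _ _ => zero_le_one) y).trans_lt ht1]
    exact univ_mem
  · obtain ⟨δ, hδ, hsub⟩ := Metric.mem_nhds_iff.1 h
    refine tendsto_const_nhds.congr' ?_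
    filter_upwards [Ioo_mem_nhdsGT hδ] with r hr
    have : {y | chi E y < 1} ∩ ball x r = ∅ := by
      refine eq_empty_of_forall_notMem fun y hy => LT.lt.ne (show chi E y < 1 from hy.1) ?_
      exact indicator_of_mem (hsub (ball_subset_ball hr.2.le hy.2)) _
    rw [this, measure_empty, ENNReal.zero_div]

end Density

section Obstacle

variable {A : Set X} {x : X} {R : ℝ} {w : ℕ → X → ℝ}

/-- The points `y` with `w i y > 1/2` whenever `y ∈ B(x, R/4^i)`. -/
def coreSet (x : X) (R : ℝ) (w : ℕ → X → ℝ) : Set X :=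
  {y | ∀ i : ℕ, dist y x < R / 4 ^ i → 1 / 2 < w i y}

theorem coreSet_mem_nhds (hx : x ∉ A) (hR : 0 < R) (hw : ∀ i, LowerSemicontinuous (w i))
    (hwA : ∀ i, ∀ y ∈ A ∩ ball x (2 * (R / 4 ^ i)), w i y = 1) {y : X} (hy : y ∈ A) :
    coreSet x R w ∈ 𝓝 y := by
  have hpos : 0 < dist y x := dist_pos.2 fun h => hx (h ▸ hy)
  have hs : Tendsto (fun i : ℕ => R / 4 ^ i) atTop (𝓝 0) :=
    tendsto_const_nhds.div_atTop (tendsto_pow_atTop_atTop_of_one_lt (by norm_num))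
  obtain ⟨I, hI⟩ := eventually_atTop.1 (hs.eventually (gt_mem_nhds (half_pos hpos)))
  have hcont : Continuous fun z => dist z x := continuous_id.dist continuous_const
  have h1 : ∀ i ∈ Finset.range I, ∀ᶠ z in 𝓝 y, dist z x < R / 4 ^ i → 1 / 2 < w i z := by
    intro i _
    have hsi : 0 < R / 4 ^ i := by positivity
    rcases lt_or_ge (dist y x) (2 * (R / 4 ^ i)) with h | h
    · filter_upwards [hw i y (1 / 2) (show 1 / 2 < w i y by rw [hwA i y ⟨hy, h⟩]; norm_num)] with z hz _ using hz
    · filter_upwards [hcont.continuousAt.eventually (lt_mem_nhds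
        (show R / 4 ^ i < dist y x by linarith))] with z hz hz'
      exact absurd hz' hz.not_gt
  filter_upwards [(Finset.eventually_all _).2 h1,
    hcont.continuousAt.eventually (lt_mem_nhds (half_lt_self hpos))] with z hz hz' i hi
  rcases lt_or_ge i I with h | h
  · exact hz i (Finset.mem_range.2 h) hi
  · linarith [hI i h]

variable [ProperSpace X] [BorelSpace X] {μ : Measure X} [IsFiniteMeasureOnCompacts μ]

theorem tv_min_two_mul_le {u : X → ℝ} (hu : AEMeasurable u μ) {Ω : Set X} (hΩ : IsOpen Ω) :
    tv μ (fun y => min (2 * u y) 1) Ω ≤ 2 * tv μ u Ω := by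
  have h1 := tv_min_add_tv_max_le (w := fun _ => (1 : ℝ)) hΩ (hu.const_mul 2)
  have h2 := tv_affine_le (μ := μ) (u := u) (Ω := Ω) 2 0
  rw [tv_const, add_zero] at h1
  refine le_self_add.trans (h1.trans ?_)
  simpa using h2

variable {Cd CP lam : ℝ}

theorem MMS.exists_obstacles (hX : MMS μ Cd CP lam) (hthin : IsThinAt μ A x) {ε : ℝ}
    (hε : 0 < ε) : ∃ R₀ > 0, ∀ R, 0 < R → R < R₀ → ∃ (w : ℕ → X → ℝ) (e : ℕ → ℝ),
      Tendsto e atTop (𝓝 0) ∧ ∀ i, 0 ≤ e i ∧ e i ≤ ε ∧ LowerSemicontinuous (w i) ∧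
        (∀ y, 0 ≤ w i y) ∧ (∀ y ∈ A ∩ ball x (2 * (R / 4 ^ i)), w i y = 1) ∧
        (∀ y, y ∉ ball x (4 * (R / 4 ^ i)) → w i y = 0) ∧
        2 * tv μ (w i) univ ≤ ENNReal.ofReal (e i / (R / 4 ^ i)) * μ (ball x (R / 4 ^ i)) := by
  have hCd := hX.hCd
  have hη : 0 < ε / (2 * Cd) := by positivity
  set η := ε / (2 * Cd) with hηdef
  obtain ⟨R₁, hR₁, hτ⟩ := mem_nhdsGT_iff_exists_Ioo_subset.1
    (hthin.eventually (gt_mem_nhds (ENNReal.ofReal_pos.2 hη)))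
  refine ⟨R₁ / 2, half_pos hR₁, fun R hR hRR => ?_⟩
  have hs : Tendsto (fun i : ℕ => R / 4 ^ i) atTop (𝓝 0) :=
    tendsto_const_nhds.div_atTop (tendsto_pow_atTop_atTop_of_one_lt (by norm_num))
  have hspos : ∀ i : ℕ, 0 < R / 4 ^ i := fun i => by positivity
  have hsR : ∀ i : ℕ, R / 4 ^ i ≤ R := fun i => div_le_self hR.le (one_le_pow₀ (by norm_num))
  let τ : ℕ → ℝ≥0∞ := fun i => ENNReal.ofReal (2 * (R / 4 ^ i)) *
    vcap1 μ (A ∩ ball x (2 * (R / 4 ^ i))) (ball x (2 * (2 * (R / 4 ^ i)))) /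
      μ (ball x (2 * (R / 4 ^ i)))
  have hτη : ∀ i, τ i < ENNReal.ofReal η := fun i =>
    hτ ⟨by linarith [hspos i], by linarith [hsR i]⟩
  have hτ0 : Tendsto τ atTop (𝓝 0) := hthin.comp (tendsto_nhdsWithin_iff.2
    ⟨by simpa using hs.const_mul 2, Eventually.of_forall fun i => by
      have := hspos i; rw [mem_Ioi]; linarith⟩)
  let t : ℕ → ℝ := fun i => (τ i).toReal + η / (i + 1)
  have ht0 : Tendsto t atTop (𝓝 0) := by
    have h1 : Tendsto (fun i => (τ i).toReal) atTop (𝓝 0) := by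
      simpa [Function.comp_def] using (ENNReal.tendsto_toReal ENNReal.zero_ne_top).comp hτ0
    have h2 : Tendsto (fun i : ℕ => η / ((i : ℝ) + 1)) atTop (𝓝 0) :=
      tendsto_const_nhds.div_atTop (tendsto_atTop_add_const_right _ _ tendsto_natCast_atTop_atTop)
    simpa using h1.add h2
  have htpos : ∀ i, 0 < t i := fun i => by positivity
  have htη : ∀ i, t i ≤ 2 * η := fun i => by
    have h1 : (τ i).toReal ≤ η := ENNReal.toReal_le_of_le_ofReal hη.le (hτη i).le
    have h2 : η / ((i : ℝ) + 1) ≤ η := div_le_self hη.le (by linarith [i.cast_nonneg (α := ℝ)])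
    simp only [t]
    linarith
  have hτt : ∀ i, τ i < ENNReal.ofReal (t i) := fun i => by
    rw [ENNReal.lt_ofReal_iff_toReal_lt ((hτη i).trans ENNReal.ofReal_lt_top).ne]
    exact lt_add_of_pos_right _ (by positivity)
  have hw : ∀ i, ∃ w : X → ℝ, LowerSemicontinuous w ∧ (∀ y, 0 ≤ w y) ∧ (∀ y, w y ≤ 1) ∧
      (∀ y ∈ A ∩ ball x (2 * (R / 4 ^ i)), w y = 1) ∧
      (∀ y, y ∉ ball x (2 * (2 * (R / 4 ^ i))) → w y = 0) ∧
      tv μ w univ ≤ ENNReal.ofReal (t i / (2 * (R / 4 ^ i))) * μ (ball x (2 * (R / 4 ^ i))) := by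
    intro i
    refine exists_lowerSemicontinuous_of_vcap1_lt ?_
    have h2s : 0 < 2 * (R / 4 ^ i) := by linarith [hspos i]
    have hb0 := (hX.ball_pos x h2s).ne'
    have hbt := (hX.ball_lt_top x (2 * (R / 4 ^ i))).ne
    have h1 := (ENNReal.div_lt_iff (Or.inl hb0) (Or.inl hbt)).1 (hτt i)
    have h0 : ENNReal.ofReal (2 * (R / 4 ^ i)) ≠ 0 := (ENNReal.ofReal_pos.2 h2s).ne'
    rw [ENNReal.ofReal_div_of_pos h2s, ← ENNReal.mul_div_right_comm]
    rw [mul_comm] at h1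
    rw [ENNReal.lt_div_iff_mul_lt (Or.inl h0) (Or.inl ENNReal.ofReal_ne_top)]
    exact h1
  choose w hw1 hw2 _ hw4 hw5 hw6 using hw
  refine ⟨w, fun i => Cd * t i, by simpa using ht0.const_mul Cd, fun i => ⟨?_, ?_, hw1 i, hw2 i,
    hw4 i, fun y hy => hw5 i y (by rwa [← mul_assoc, show (2 : ℝ) * 2 = 4 by norm_num]), ?_⟩⟩
  · have := htpos i
    positivity
  · calc Cd * t i ≤ Cd * (2 * η) := by gcongr; exact htη i
      _ = ε := by rw [hηdef]; field_simp
  · have := hspos i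
    have := htpos i
    calc 2 * tv μ (w i) univ ≤ 2 * (ENNReal.ofReal (t i / (2 * (R / 4 ^ i))) *
          (ENNReal.ofReal Cd * μ (ball x (R / 4 ^ i)))) :=
          mul_le_mul_right ((hw6 i).trans (mul_le_mul_right
            (hX.doubling x _ (hspos i)).2.1 _)) _
      _ = ENNReal.ofReal (2 * (t i / (2 * (R / 4 ^ i))) * Cd) * μ (ball x (R / 4 ^ i)) := by
          rw [ENNReal.ofReal_mul (by positivity), ENNReal.ofReal_mul (by positivity),
            ENNReal.ofReal_ofNat]
          ring
      _ = _ := by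
          congr 2
          field_simp

end Obstacle

section Cartan

variable [BorelSpace X] {μ : Measure X} {Cd CP lam : ℝ} {A : Set X} {x : X}

theorem MMS.exists_minimal_set_of_isThinAt (hX : MMS μ Cd CP lam) (hxA : x ∉ A)
    (hthin : IsThinAt μ A x) : ∃ R > 0, ∃ S E : Set X,
      IsAdmissible S (ball x (4 * R)) (chi E) ∧
      (∀ v, IsAdmissible S (ball x (4 * R)) v → tv μ (chi E) univ ≤ tv μ v univ) ∧
      tv μ (chi E) univ < ⊤ ∧ (∀ y ∈ A ∩ ball x R, S ∈ 𝓝 y) ∧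
      Tendsto (fun r => μ (E ∩ ball x r) / μ (ball x r)) (𝓝[>] 0) (𝓝 0) := by
  have hCd := hX.hCd
  have hCP := hX.hCP
  have := hX.properSpace
  have := hX.isFiniteMeasureOnCompacts
  have := hX.nontrivial
  obtain ⟨z, hz⟩ := exists_ne x
  obtain ⟨d, C, hd, hC, hdecay⟩ := hX.exists_decay
  have hK : 0 < (1 + Cd ^ 3) * (CP * 4) := by positivity
  set K := (1 + Cd ^ 3) * (CP * 4) with hKdef
  have hε : 0 < min (d / (2 * C)) (d / (4 * K)) := by positivity
  obtain ⟨R₀, hR₀, hobs⟩ := hX.exists_obstacles hthin hε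
  obtain ⟨R, hR, hRlt⟩ := exists_between (lt_min hR₀ (show 0 < dist z x / 12 by
    have := dist_pos.2 hz; positivity))
  obtain ⟨w, e, he, hwe⟩ := hobs R hR (hRlt.trans_le (min_le_left _ _))
  choose he0 heε hlsc hw0 hwA hwoff hwtv using hwe
  have hspos : ∀ i : ℕ, 0 < R / 4 ^ i := fun i => by positivity
  have hsR : ∀ i : ℕ, R / 4 ^ i ≤ R := fun i => div_le_self hR.le (one_le_pow₀ (by norm_num))
  have hzR : ∀ i : ℕ, z ∉ ball x (12 * (R / 4 ^ i)) := fun i h => by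
    have h1 := hRlt.trans_le (min_le_right _ _)
    have h2 := hsR i
    rw [mem_ball] at h
    linarith
  set S := coreSet x R w ∩ ball x R with hS
  have hv : ∀ i, IsAdmissible (S ∩ ball x (R / 4 ^ i)) (ball x (4 * (R / 4 ^ i)))
      fun y => min (2 * w i y) 1 := fun i =>
    ⟨((hlsc i).measurable.const_mul 2).min measurable_const,
      fun y => le_min (by linarith [hw0 i y]) zero_le_one, fun y => min_le_right _ _,
      fun y hy => min_eq_right (by linarith [hy.1.1 i hy.2]),
      fun y hy => by simp [hwoff i y hy]⟩
  have hvtv : ∀ i, tv μ (fun y => min (2 * w i y) 1) univ ≤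
      ENNReal.ofReal (e i / (R / 4 ^ i)) * μ (ball x (R / 4 ^ i)) := fun i =>
    (tv_min_two_mul_le (hlsc i).measurable.aemeasurable isOpen_univ).trans (hwtv i)
  have hvfin : ∀ i, tv μ (fun y => min (2 * w i y) 1) univ ≠ ⊤ := fun i =>
    ne_top_of_le_ne_top (ENNReal.mul_ne_top ENNReal.ofReal_ne_top (hX.ball_lt_top x _).ne) (hvtv i)
  have hv0 : IsAdmissible S (ball x (4 * R)) fun y => min (2 * w 0 y) 1 := by
    have := hv 0
    rwa [pow_zero, div_one, inter_eq_left.2 inter_subset_right] at this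
  obtain ⟨E, hE, hEm, hmin⟩ := hv0.exists_minimizer_set (hvfin 0)
  have hEfin : tv μ (chi E) univ ≠ ⊤ := ne_top_of_le_ne_top (hvfin 0) (hmin _ hv0)
  refine ⟨R, hR, S, E, hE, hmin, hEfin.lt_top, fun y hy =>
    inter_mem (coreSet_mem_nhds hxA hR hlsc hwA hy.1) (isOpen_ball.mem_nhds hy.2), ?_⟩
  let D : ℕ → ℝ := fun i => Nat.rec d (fun j a => C * e j + a / 4) i
  have hD0 : ∀ i, 0 ≤ D i ∧ D i ≤ d := by
    intro i
    induction i with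
    | zero => exact ⟨hd.le, le_rfl⟩
    | succ i ih =>
      have h1 : C * e i ≤ d / 2 := by
        have := (heε i).trans (min_le_left _ _)
        rw [le_div_iff₀ (by positivity)] at this
        linarith
      have h2 := mul_nonneg hC.le (he0 i)
      change 0 ≤ C * e i + D i / 4 ∧ C * e i + D i / 4 ≤ d
      exact ⟨by linarith, by linarith⟩
  refine hX.tendsto_density hR (D := D) (tendsto_zero_of_le_add_quarter (fun i => (hD0 i).1)
    (fun i => le_rfl) (by simpa using he.const_mul C)) fun i => ?_
  induction i with
  | zero =>
    have h1 := hX.lintegral_le_tv_univ hE.measurable.aemeasurable (x := x) (z := z) (r := 4 * R)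
      (by linarith) (by have := hzR 0; rwa [pow_zero, div_one, show 12 * R = 3 * (4 * R) by ring]
        at this) hE.eq_zero
    rw [← setLIntegral_univ, lintegral_abs_chi hEm, inter_univ] at h1
    have h2 := hvtv 0
    rw [pow_zero, div_one] at h2 ⊢
    calc μ (E ∩ ball x R) ≤ ENNReal.ofReal (K * (4 * R)) *
          (ENNReal.ofReal (e 0 / R) * μ (ball x R)) :=
          (measure_mono inter_subset_left).trans (h1.trans
            (mul_le_mul_right ((hmin _ hv0).trans h2) _))
      _ = ENNReal.ofReal (4 * K * e 0) * μ (ball x R) := by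
          rw [← mul_assoc, ← ENNReal.ofReal_mul (by positivity)]
          congr 2
          field_simp
      _ ≤ ENNReal.ofReal d * μ (ball x R) := by
          refine mul_le_mul_left (ENNReal.ofReal_le_ofReal ?_) _
          have := (heε 0).trans (min_le_right _ _)
          rw [le_div_iff₀ (by positivity)] at this
          linarith
  | succ i ih =>
    rw [pow_succ, ← div_div]
    exact hdecay hE hEm hmin hEfin (hspos i)
      (ball_subset_ball (by linarith [hsR i])) (hv i) (hzR i) (he0 i) (hD0 i).1 (hD0 i).2
      (hvtv i) ih

end Cartan

/-- **Weak Cartan property for `p = 1`.** If `A` is 1-thin at `x ∉ A`, then there exist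
`R > 0` and `u₁, u₂ ∈ BV(X)` that are 1-superminimizers in `B(x,R)` such that
`max {u₁^∧, u₂^∧} = 1` on `A ∩ B(x,R)` and `u₁^∨(x) = 0 = u₂^∨(x)`. -/
theorem weak_cartan_property
    {X : Type*} [MetricSpace X] [MeasurableSpace X] [BorelSpace X]
    (μ : Measure X) (Cd CP lam : ℝ) (hX : MMS μ Cd CP lam)
    (A : Set X) (x : X) (hxA : x ∉ A) (hthin : IsThinAt μ A x) :
    ∃ R : ℝ, 0 < R ∧ ∃ u₁ u₂ : X → ℝ,
      MemBV μ u₁ Set.univ ∧ MemBV μ u₂ Set.univ ∧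
      IsSuperminimizer μ u₁ (Metric.ball x R) ∧
      IsSuperminimizer μ u₂ (Metric.ball x R) ∧
      (∀ y ∈ A ∩ Metric.ball x R,
        max (lowerApprox μ u₁ y) (lowerApprox μ u₂ y) = (1 : EReal)) ∧
      upperApprox μ u₁ x = (0 : EReal) ∧ upperApprox μ u₂ x = (0 : EReal) := by
  have := hX.properSpace
  have := hX.isFiniteMeasureOnCompacts
  obtain ⟨R, hR, S, E, hE, hmin, hfin, hS, hdens⟩ := hX.exists_minimal_set_of_isThinAt hxA hthin
  have hBV : MemBV μ (chi E) univ :=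
    ⟨(hE.integrable measurableSet_ball (hX.ball_lt_top x _).ne).integrableOn, hfin⟩
  have hsup : IsSuperminimizer μ (chi E) (ball x R) :=
    hE.isSuperminimizer hmin hBV isOpen_ball (ball_subset_ball (by linarith))
  have hu := hX.upperApprox_chi_eq_zero hdens
  refine ⟨R, hR, chi E, chi E, hBV, hBV, hsup, hsup, fun y hy => ?_, hu, hu⟩
  have hSE : S ⊆ E := fun y hy => by
    by_contra h
    simpa [chi, h] using hE.eq_one y hy
  rw [hX.lowerApprox_chi_eq_one (mem_of_superset (hS y hy) hSE), max_self]

end MetricBV
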